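/- arXiv:2503.16830 — 3 statements merged into one kernel-verified Lean document; each statement's English description precedes it below -/
import Mathlib

section
/- Let K be a local field of characteristic p > 0 with perfect residue field, let a_0 ∈ K with v_K(a_0) = -m_0 where m_0 > 0 and p ∤ m_0, let x_0 ∈ K^sep be a root of X^p - X - a_0, and set K_1 = K(x_0). Then for every 1 ≤ j ≤ n-1, v_{K_1}(S_j(x_0, 0, …, 0, a_0, 0, …, 0)) = -(p^{j+1} - p + 1) m_0, where S_j is the j-th Witt addition polynomial and all variables other than the first of each block are set to 0. -/
noncomputable section

open scoped Classical

/-- The normalized valuation on `k((t))`: `v(x)` is the order of vanishing of `x`,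
with `v(0) = ∞`. -/
def lsVal {k : Type*} [Field k] (x : LaurentSeries k) : WithTop ℤ :=
  if x = 0 then ⊤ else (x.order : WithTop ℤ)

/-- The normalized valuation `v_K` on a local field `K` presented by an isomorphism
`ι : K ≃ k((t))`. -/
def lfVal {K k : Type*} [Field K] [Field k] (ι : K ≃+* LaurentSeries k) (x : K) :
    WithTop ℤ :=
  lsVal (ι x)

/-- `v : L → ℤ ∪ {∞}` is a normalized discrete valuation on the field `L`. -/
def IsNormVal {L : Type*} [Field L] (v : L → WithTop ℤ) : Prop :=
  (∀ x, v x = ⊤ ↔ x = 0) ∧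
  (∀ x y, v (x * y) = v x + v y) ∧
  (∀ x y, min (v x) (v y) ≤ v (x + y)) ∧
  (∃ π, v π = (1 : ℤ))

/-- The valuation `v` on `L` restricts on `K` to `e` times the normalized valuation
`vK` of `K`; `e = e_{L/K}` is the ramification index. -/
def ExtendsWithE {K L : Type*} [Field K] [Field L] [Algebra K L]
    (vK : K → WithTop ℤ) (v : L → WithTop ℤ) (e : ℕ) : Prop :=
  ∀ (x : K) (z : ℤ), vK x = (z : WithTop ℤ) →
    v (algebraMap K L x) = (((e : ℤ) * z : ℤ) : WithTop ℤ)

/-- `S_j(x,0,…;y,0,…)`. -/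
def sw (p : ℕ) [Fact p.Prime] {R : Type*} [CommRing R] (x y : R) (j : ℕ) : R :=
  MvPolynomial.aeval (fun w : Fin 2 × ℕ => if w.2 = 0 then (if w.1 = 0 then x else y) else 0)
    (WittVector.wittAdd p j)

theorem sw_map (p : ℕ) [Fact p.Prime] {R S : Type*} [CommRing R] [CommRing S] (f : R →+* S)
    (x y : R) (j : ℕ) : f (sw p x y j) = sw p (f x) (f y) j := by
  unfold sw
  rw [MvPolynomial.map_aeval, MvPolynomial.aeval_def, MvPolynomial.coe_eval₂Hom]
  congr 1
  · exact RingHom.ext_int _ _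
  · funext w
    split_ifs <;> simp

theorem sw_zero (p : ℕ) [Fact p.Prime] {R : Type*} [CommRing R] (x y : R) :
    sw p x y 0 = x + y := by
  simp [sw, WittVector.wittAdd_zero]

theorem sw_phantom (p : ℕ) [Fact p.Prime] {R : Type*} [CommRing R] (x y : R) (j : ℕ) :
    ∑ i ∈ Finset.range (j + 1), (p : R) ^ i * sw p x y i ^ p ^ (j - i) = x ^ p ^ j + y ^ p ^ j := by
  have h := wittStructureInt_prop p (MvPolynomial.X 0 + MvPolynomial.X 1 : MvPolynomial (Fin 2) ℤ) j
  have h2 := congrArg (MvPolynomial.aeval (fun w : Fin 2 × ℕ =>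
    if w.2 = 0 then (if w.1 = 0 then x else y) else (0:R))) h
  have hp : ∀ n, p ^ n ≠ 0 := fun n => pow_ne_zero _ (Fact.out : p.Prime).ne_zero
  rw [MvPolynomial.aeval_bind₁] at h2
  simp only [map_add, MvPolynomial.bind₁_X_right, MvPolynomial.aeval_rename, wittPolynomial_eq_sum_C_mul_X_pow, map_sum, map_mul, map_pow, MvPolynomial.aeval_X, Function.comp_def, MvPolynomial.aeval_C] at h2
  have e : ∀ z : R, ∑ i ∈ Finset.range (j + 1), (algebraMap ℤ R (p:ℤ)) ^ i * (if i = 0 then z else 0) ^ p ^ (j - i) = z ^ p ^ j := by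
    intro z
    rw [Finset.sum_range_succ']
    simp only [Nat.succ_ne_zero, if_false, zero_pow (hp _), mul_zero]
    simp
  simp at h2
  simp at e
  simp only [sw, WittVector.wittAdd]
  rw [h2, e, e]

theorem sw_hom_dom (p : ℕ) [Fact p.Prime] {R : Type*} [CommRing R] [IsDomain R] [CharZero R]
    (t x y : R) (j : ℕ) : sw p (t * x) (t * y) j = t ^ p ^ j * sw p x y j := by
  induction j using Nat.strong_induction_on with
  | _ j ih =>
    have h1 := sw_phantom p (t * x) (t * y) j
    have h2 := sw_phantom p x y j
    rw [Finset.sum_range_succ] at h1 h2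
    have h3 : ∑ i ∈ Finset.range j, (p : R) ^ i * sw p (t * x) (t * y) i ^ p ^ (j - i)
        = t ^ p ^ j * ∑ i ∈ Finset.range j, (p : R) ^ i * sw p x y i ^ p ^ (j - i) := by
      rw [Finset.mul_sum]
      refine Finset.sum_congr rfl fun i hi => ?_
      have hi := Finset.mem_range.1 hi
      rw [ih i hi, mul_pow, ← pow_mul, ← pow_add, Nat.add_sub_cancel' hi.le]
      ring
    have hp : (p : R) ^ j ≠ 0 := pow_ne_zero _ (by exact_mod_cast (Fact.out : p.Prime).ne_zero)
    apply mul_left_cancel₀ hp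
    rw [h3] at h1
    simp only [Nat.sub_self, pow_zero, pow_one, mul_pow] at h1 h2
    linear_combination h1 - t ^ p ^ j * h2

theorem sw_hom (p : ℕ) [Fact p.Prime] {R : Type*} [CommRing R]
    (t x y : R) (j : ℕ) : sw p (t * x) (t * y) j = t ^ p ^ j * sw p x y j := by
  let f : MvPolynomial (Fin 3) ℤ →+* R := (MvPolynomial.aeval ![t, x, y]).toRingHom
  have h := congrArg f (sw_hom_dom p (MvPolynomial.X 0 : MvPolynomial (Fin 3) ℤ)
    (MvPolynomial.X 1) (MvPolynomial.X 2) j)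
  rw [map_mul, sw_map, sw_map, map_mul, map_mul, map_pow] at h
  simpa [f] using h

theorem X_sq_dvd_one_add (N : ℕ) :
    (Polynomial.X : Polynomial ℤ) ^ 2 ∣ (Polynomial.X + 1) ^ N - 1 - (N : Polynomial ℤ) * Polynomial.X := by
  induction N with
  | zero => simp
  | succ N ih =>
    obtain ⟨c, hc⟩ := ih
    refine ⟨c * (Polynomial.X + 1) + (N : Polynomial ℤ), ?_⟩
    push_cast
    linear_combination (Polynomial.X + 1) * hc

theorem sw_X (p : ℕ) [Fact p.Prime] (j : ℕ) (hj : 1 ≤ j) :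
    (Polynomial.X : Polynomial ℤ) ^ 2 ∣ sw p (Polynomial.X : Polynomial ℤ) 1 j + Polynomial.X := by
  have hp2 := (Fact.out : p.Prime).two_le
  induction j using Nat.strong_induction_on with
  | _ j ih =>
    obtain ⟨j, rfl⟩ : ∃ i, j = i + 1 := ⟨j - 1, by omega⟩
    have h1 := sw_phantom p (Polynomial.X : Polynomial ℤ) 1 (j + 1)
    rw [Finset.sum_range_succ, Finset.sum_range_succ'] at h1
    have h3 : (Polynomial.X : Polynomial ℤ) ^ 2 ∣ ∑ i ∈ Finset.range j, (p : Polynomial ℤ) ^ (i + 1) *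
        sw p (Polynomial.X : Polynomial ℤ) 1 (i + 1) ^ p ^ (j + 1 - (i + 1)) := by
      refine Finset.dvd_sum fun i hi => Dvd.dvd.mul_left ?_ _
      have hi := Finset.mem_range.1 hi
      have h4 := ih (i + 1) (by omega) (by omega)
      have h5 : (Polynomial.X : Polynomial ℤ) ∣ sw p (Polynomial.X : Polynomial ℤ) 1 (i + 1) :=
        (dvd_add_left (dvd_refl _)).1 ((dvd_pow_self _ two_ne_zero).trans h4)
      refine (pow_dvd_pow_of_dvd h5 2).trans (pow_dvd_pow _ ?_)
      calc 2 ≤ p := hp2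
        _ = p ^ 1 := (pow_one p).symm
        _ ≤ _ := Nat.pow_le_pow_right (by omega) (by omega)
    have h6 := X_sq_dvd_one_add (p ^ (j + 1))
    have h7 : (Polynomial.X : Polynomial ℤ) ^ 2 ∣ Polynomial.X ^ p ^ (j + 1) := by
      refine pow_dvd_pow _ ?_
      calc 2 ≤ p := hp2
        _ = p ^ 1 := (pow_one p).symm
        _ ≤ _ := Nat.pow_le_pow_right (by omega) (by omega)
    have h8 := dvd_sub (dvd_sub h7 h6) h3
    have h9 : (Polynomial.X : Polynomial ℤ) ^ 2 ∣
        Polynomial.C ((p : ℤ) ^ (j + 1)) * (sw p (Polynomial.X : Polynomial ℤ) 1 (j + 1) + Polynomial.X) := by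
      convert h8 using 1
      rw [sw_zero] at h1
      simp only [Nat.sub_self, Nat.sub_zero, pow_zero, pow_one, one_pow, one_mul] at h1
      simp only [map_pow, map_natCast]
      push_cast
      simp only [Nat.add_sub_add_right] at h1 ⊢
      linear_combination h1
    rw [Polynomial.X_pow_dvd_iff] at h9 ⊢
    intro d hd
    have := h9 d hd
    rw [Polynomial.coeff_C_mul] at this
    have hp : (p : ℤ) ^ (j + 1) ≠ 0 := pow_ne_zero _ (by exact_mod_cast (Fact.out : p.Prime).ne_zero)
    exact (mul_eq_zero.1 this).resolve_left hp

theorem sum_ne_zero_of_inj {L ι : Type*} [Field L] (v : AddValuation L (WithTop ℤ))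
    (s : Finset ι) (f : ι → L) (hs : s.Nonempty) (h0 : ∀ i ∈ s, f i ≠ 0)
    (hinj : ∀ i ∈ s, ∀ j ∈ s, v (f i) = v (f j) → i = j) : ∑ i ∈ s, f i ≠ 0 := by
  classical
  obtain ⟨i, hi, hmin⟩ := Finset.exists_min_image s (fun i => v (f i)) hs
  have hne : v (f i) ≠ ⊤ := (v.ne_top_iff).2 (h0 i hi)
  have h1 : v (f i) < v (∑ j ∈ s.erase i, f j) := by
    refine v.map_lt_sum hne fun j hj => ?_
    have hj' := Finset.mem_of_mem_erase hj
    refine lt_of_le_of_ne (hmin j hj') fun h => ?_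
    exact (Finset.ne_of_mem_erase hj) (hinj _ hi _ hj' h).symm
  rw [← Finset.add_sum_erase _ _ hi, ← v.ne_top_iff, v.map_add_eq_of_lt_left h1]
  exact hne

theorem int_poly_nonneg {L : Type*} [Field L] (v : AddValuation L (WithTop ℤ)) (u : L)
    (hu : 0 ≤ v u) (G : Polynomial ℤ) : 0 ≤ v (Polynomial.aeval u G) := by
  let O : Subring L := 
    { carrier := {x | 0 ≤ v x}
      mul_mem' := fun {a b} ha hb => by
        change 0 ≤ v (a * b)
        rw [v.map_mul]; exact add_nonneg ha hb
      one_mem' := by simp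
      add_mem' := fun {a b} ha hb => (le_min ha hb).trans (v.map_add a b)
      zero_mem' := by simp
      neg_mem' := fun {a} ha => by simpa using ha }
  have : Polynomial.aeval u G ∈ O := by
    rw [Polynomial.aeval_eq_sum_range]
    exact O.sum_mem fun i _ => O.zsmul_mem (O.pow_mem hu _) _
  exact this

/-- the valuation computation in the proof of Theorem 7.  Let
`K ≅ k((t))` be a local field of characteristic `p > 0` with perfect residue field
`k`, let `a_0 ∈ K` with `v_K(a_0) = -m_0`, `m_0 > 0`, `p ∤ m_0`, let `x_0` be a root
of `X^p - X - a_0` and `K_1 = K(x_0)`.  Then for every `1 ≤ j ≤ n-1`,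
`v_{K_1}(S_j(x_0, 0, …, 0, a_0, 0, …, 0)) = -(p^{j+1} - p + 1) m_0`, where
`S_j = WittVector.wittAdd p j` is the `j`-th Witt addition polynomial (variables
indexed by `Fin 2 × ℕ`, the first block evaluated at `(x_0, 0, …, 0)` and the second
at `(a_0, 0, …, 0)`).  Here `v` is the normalized valuation of `K_1`. -/
theorem stmt_12 {p : ℕ} [Fact p.Prime] (k : Type) [Field k] [PerfectField k] [CharP k p]
    (K : Type) [Field K] [CharP K p] (ι : K ≃+* LaurentSeries k)
    (a0 : K) (m0 : ℕ) (hm0 : 1 ≤ m0) (hpm : ¬ p ∣ m0)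
    (ha0 : lfVal ι a0 = ((-(m0 : ℤ) : ℤ) : WithTop ℤ))
    (K1 : Type) [Field K1] [Algebra K K1]
    (x0 : K1) (hx0 : x0 ^ p - x0 = algebraMap K K1 a0)
    (hgen : IntermediateField.adjoin K {x0} = (⊤ : IntermediateField K K1))
    (v : K1 → WithTop ℤ) (hv : IsNormVal v) (e : ℕ) (he : ExtendsWithE (lfVal ι) v e)
    (n : ℕ) :
    ∀ j : ℕ, 1 ≤ j → j ≤ n - 1 →
      v (MvPolynomial.aeval
          (fun w : Fin 2 × ℕ =>
            if w.2 = 0 then (if w.1 = 0 then x0 else algebraMap K K1 a0) else 0)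
          (WittVector.wittAdd p j)) =
        ((-(((p : ℤ) ^ (j + 1) - p + 1) * m0) : ℤ) : WithTop ℤ) := by
  intro j hj _
  have hpp : p.Prime := Fact.out
  have hp2 := hpp.two_le
  obtain ⟨hv0, hvm, hva, π, hπ⟩ := hv
  have hv1 : v 1 = 0 := by
    have h1 : v 1 ≠ ⊤ := fun h => one_ne_zero ((hv0 1).1 h)
    have h2 := hvm 1 1
    lift v 1 to ℤ using h1 with c hc
    rw [mul_one, ← hc] at h2
    norm_cast at h2 ⊢
    omega
  let w : AddValuation K1 (WithTop ℤ) := AddValuation.of v ((hv0 0).2 rfl) hv1 hva hvm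
  have hw : ∀ x, w x = v x := fun x => rfl
  -- degree bound
  have hroot : Polynomial.aeval x0 (Polynomial.X ^ p - (Polynomial.X + Polynomial.C a0) : Polynomial K) = 0 := by
    simp [← hx0]
  have hdeg : (Polynomial.X + Polynomial.C a0 : Polynomial K).degree < (p : ℕ) := by
    rw [Polynomial.degree_X_add_C]; exact_mod_cast hp2
  have hmon : (Polynomial.X ^ p - (Polynomial.X + Polynomial.C a0) : Polynomial K).Monic :=
    Polynomial.monic_X_pow_sub hdeg
  have hnat : (Polynomial.X ^ p - (Polynomial.X + Polynomial.C a0) : Polynomial K).natDegree = p := by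
    apply Polynomial.natDegree_eq_of_degree_eq_some
    rw [Polynomial.degree_sub_eq_left_of_degree_lt] <;> rw [Polynomial.degree_X_pow]
    exact hdeg
  have hint : IsIntegral K x0 := ⟨_, hmon, hroot⟩
  have hfin : FiniteDimensional K K1 := by
    have := IntermediateField.adjoin.finiteDimensional hint
    rw [hgen] at this
    exact Module.Finite.equiv (IntermediateField.topEquiv (F := K) (E := K1)).toLinearEquiv
  have hrank : Module.finrank K K1 ≤ p := by
    have h1 := IntermediateField.adjoin.finrank hint
    rw [hgen, IntermediateField.finrank_top'] at h1
    rw [h1, ← hnat]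
    exact Polynomial.natDegree_le_of_dvd (minpoly.dvd K x0 hroot) hmon.ne_zero
  have hepos : e ≠ 0 ∧ e ≤ p := by
    by_contra hcon
    have hli : LinearIndependent K (fun i : Fin (p + 1) => π ^ (i : ℕ)) := by
      rw [Fintype.linearIndependent_iff]
      intro g hg
      by_contra hne
      push Not at hne
      obtain ⟨i0, hi0⟩ := hne
      have hval : ∀ i, g i ≠ 0 → ∃ z : ℤ, w (g i • π ^ (i : ℕ)) = ((e * z + i : ℤ) : WithTop ℤ) := by
        intro i hi
        refine ⟨(ι (g i)).order, ?_⟩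
        have h1 := he (g i) (ι (g i)).order (by
          unfold lfVal lsVal
          rw [if_neg]
          simpa using hi)
        rw [Algebra.smul_def, w.map_mul, w.map_pow, hw, hw, h1, hπ]
        simp
      refine sum_ne_zero_of_inj w (Finset.univ.filter fun i => g i ≠ 0)
        (fun i => g i • π ^ (i : ℕ)) ⟨i0, by simpa using hi0⟩ ?_ ?_ ?_
      · intro i hi
        obtain ⟨z, hz⟩ := hval i (by simpa using hi)
        rw [← w.ne_top_iff, hz]
        exact WithTop.coe_ne_top
      · intro i hi j hj hij
        obtain ⟨z, hz⟩ := hval i (by simpa using hi)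
        obtain ⟨z', hz'⟩ := hval j (by simpa using hj)
        rw [hz, hz', WithTop.coe_inj] at hij
        have hd : (e : ℤ) ∣ (i : ℤ) - j := ⟨z' - z, by linear_combination hij⟩
        have hi' := i.2
        have hj' := j.2
        apply Fin.ext
        by_cases he0 : e = 0
        · subst he0
          have := zero_dvd_iff.1 (by simpa using hd)
          omega
        · have hgt : p < e := by
            by_contra h
            exact hcon ⟨he0, by omega⟩
          have := Int.eq_zero_of_abs_lt_dvd hd (by rw [abs_lt]; omega)
          omega
      · rw [Finset.sum_filter_of_ne]
        · exact hg
        · intro i _ hi h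
          apply hi
          simp [h]
    have := hli.fintype_card_le_finrank
    simp at this
    omega
  have hva0 := he a0 _ ha0
  have hx0ne : x0 ≠ 0 := by
    rintro rfl
    rw [zero_pow hpp.ne_zero, sub_zero] at hx0
    rw [← hx0, (hv0 0).2 rfl] at hva0
    exact WithTop.coe_ne_top hva0.symm
  obtain ⟨c, hc⟩ : ∃ c : ℤ, v x0 = c := by
    have : v x0 ≠ ⊤ := fun h => hx0ne ((hv0 _).1 h)
    lift v x0 to ℤ using this with c
    exact ⟨c, rfl⟩
  have hxp : w (x0 ^ p) = ((p * c : ℤ) : WithTop ℤ) := by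
    rw [w.map_pow, hw, hc, ← WithTop.coe_nsmul, nsmul_eq_mul]
  have hem : 0 < (e : ℤ) * m0 := by
    have := Nat.pos_of_ne_zero hepos.1
    positivity
  have hcneg : c < 0 := by
    by_contra hcn
    push Not at hcn
    have h1 := w.map_sub (x0 ^ p) x0
    rw [hx0, hxp, hw, hw, hva0, hc] at h1
    rw [← WithTop.coe_min, WithTop.coe_le_coe] at h1
    have : 0 ≤ (p : ℤ) * c := by positivity
    rcases min_le_iff.1 h1 with h | h <;> linarith
  have hpc : (p : ℤ) * c = e * -m0 := by
    have h1 : w (x0 ^ p) < w x0 := by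
      rw [hxp, hw, hc, WithTop.coe_lt_coe]
      have : (2 : ℤ) ≤ p := by exact_mod_cast hp2
      nlinarith
    have h2 := w.map_sub_eq_of_lt_left h1
    rw [hx0, hxp, hw, hva0, WithTop.coe_inj] at h2
    exact h2.symm
  have hep : e = p := by
    have h1 : (p : ℤ) ∣ e * m0 := ⟨-c, by linear_combination hpc⟩
    have h2 : p ∣ e * m0 := by exact_mod_cast h1
    rcases hpp.dvd_mul.1 h2 with h | h
    · exact le_antisymm hepos.2 (Nat.le_of_dvd (Nat.pos_of_ne_zero hepos.1) h)
    · exact absurd h hpm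
  subst hep
  have hc' : c = -m0 := by
    have : (e : ℤ) ≠ 0 := by exact_mod_cast hepos.1
    exact mul_left_cancel₀ this hpc
  subst hc'
  set y := algebraMap K K1 a0 with hy
  have hyne : y ≠ 0 := by
    rw [← w.ne_top_iff, hw, hva0]; exact WithTop.coe_ne_top
  set u := x0 / y with hu
  have hxu : x0 = y * u := by rw [hu]; field_simp
  have hvu : w u = (((e - 1) * m0 : ℤ) : WithTop ℤ) := by
    have hune : w u ≠ ⊤ := by
      rw [w.ne_top_iff]; exact div_ne_zero hx0ne hyne
    have h1 : w x0 = w y + w u := by rw [← w.map_mul, ← hxu]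
    rw [hw x0, hw y, hc, hva0] at h1
    lift w u to ℤ using hune with d
    rw [← WithTop.coe_add, WithTop.coe_inj] at h1
    rw [WithTop.coe_inj]
    linear_combination -h1
  change v (sw e x0 y j) = _
  have hS : sw e x0 y j = y ^ e ^ j * sw e u 1 j := by
    rw [← sw_hom, mul_one, ← hxu]
  have hd : 0 < ((e : ℤ) - 1) * m0 := by
    have : (2 : ℤ) ≤ e := by exact_mod_cast hp2
    have : (1 : ℤ) ≤ m0 := by exact_mod_cast hm0
    nlinarith
  obtain ⟨G, hG⟩ := sw_X e j hj
  have hG2 := congrArg (Polynomial.aeval u) hG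
  have h3 : Polynomial.aeval u (sw e (Polynomial.X : Polynomial ℤ) 1 j) = sw e u 1 j := by
    have := sw_map e (Polynomial.aeval u : Polynomial ℤ →ₐ[ℤ] K1).toRingHom Polynomial.X 1 j
    simpa using this
  rw [map_add, h3, map_mul, map_pow, Polynomial.aeval_X] at hG2
  have hu0 : (0 : WithTop ℤ) ≤ w u := by
    rw [hvu]; exact_mod_cast hd.le
  have h4 : w (sw e u 1 j) = w u := by
    rw [← w.map_neg u]
    have h5 : w (-u) < w (sw e u 1 j - (-u)) := by
      rw [w.map_neg, sub_neg_eq_add, hG2, w.map_mul, w.map_pow]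
      refine lt_of_lt_of_le ?_ (le_add_of_nonneg_right (int_poly_nonneg w u hu0 G))
      rw [hvu, two_nsmul]
      rw [← WithTop.coe_add, WithTop.coe_lt_coe]
      linarith
    exact w.map_eq_of_lt_sub h5
  rw [hS, ← hw, w.map_mul, w.map_pow, h4, hvu, hw, hva0, ← WithTop.coe_nsmul, ← WithTop.coe_add, WithTop.coe_inj,
    nsmul_eq_mul]
  push_cast
  ring
end
end

section
/- Let K be a local field of characteristic p > 0 with perfect residue field and let a ∈ W_n(K) be a reduced Witt vector. Then there exist a finite unramified Galois extension K'/K and a Witt vector d ∈ W_n(O_{K'}) with integral components such that a ⊕ F(d) ⊖ d ∈ W_n(K') is strongly reduced, and for every index i with v_K(a_i) < 0 the i-th component a_i' of a' = a ⊕ F(d) ⊖ d satisfies v_{K'}(a_i') = v_K(a_i). -/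
noncomputable section

open scoped Classical

/-- The Frobenius `F` on truncated Witt vectors, induced by the `p`-th power map
on components. -/
def wittF {p n : ℕ} {R : Type*} [CommRing R] (x : TruncatedWittVector p n R) :
    TruncatedWittVector p n R :=
  TruncatedWittVector.mk p fun i => x.coeff i ^ p

/-- Componentwise application of a map (e.g. the inclusion `W_n(K) → W_n(K')`). -/
def wittMap {p n : ℕ} {R S : Type*} (f : R → S) (x : TruncatedWittVector p n R) :
    TruncatedWittVector p n S :=
  TruncatedWittVector.mk p fun i => f (x.coeff i)


theorem ws_coeff_pow {p : ℕ} [Fact p.Prime] {F : Type*} [Field F] [CharP F p]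
    (x : PowerSeries F) (m : ℕ) :
    PowerSeries.coeff m (x ^ p) = if p ∣ m then (PowerSeries.coeff (m / p) x) ^ p else 0 := by
  have hp : p ≠ 0 := (Fact.out : p.Prime).ne_zero
  have : ExpChar F p := ExpChar.prime Fact.out
  have h := MvPowerSeries.map_frobenius_expand (σ := Unit) (R := F) p hp (f := x)
  have h2 : PowerSeries.map (frobenius F p) (PowerSeries.expand p hp x) = x ^ p := h
  rw [← h2, PowerSeries.coeff_map, PowerSeries.coeff_expand]
  split_ifs
  · rfl
  · simp

/-- Artin-Schreier recursion for the coefficients. -/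
def asCoeff {F : Type*} [Field F] (p : ℕ) (c : ℕ → F) (x0 : F) (m : ℕ) : F :=
  if h : m = 0 ∨ p ≤ 1 then x0
  else (if p ∣ m then (asCoeff p c x0 (m / p)) ^ p else 0) - c m
termination_by m
decreasing_by
  push Not at h
  exact Nat.div_lt_self (Nat.pos_of_ne_zero h.1) h.2

theorem ws_as {p : ℕ} [Fact p.Prime] {F : Type*} [Field F] [CharP F p]
    (c : PowerSeries F) (x0 : F) (h0 : x0 ^ p - x0 = PowerSeries.coeff 0 c) :
    ∃ x : PowerSeries F, x ^ p - x = c ∧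
      ∀ S : Subring F, x0 ∈ S → (∀ m, PowerSeries.coeff m c ∈ S) →
        ∀ m, PowerSeries.coeff m x ∈ S := by
  have hp : p.Prime := Fact.out
  refine ⟨PowerSeries.mk (asCoeff p (fun m => PowerSeries.coeff m c) x0), ?_, ?_⟩
  · ext m
    rw [map_sub, ws_coeff_pow]
    simp only [PowerSeries.coeff_mk]
    by_cases hm : m = 0
    · subst hm
      simpa [asCoeff] using h0
    · conv_lhs => rw [asCoeff.eq_1 _ _ _ m]
      have : ¬ (m = 0 ∨ p ≤ 1) := by
        push Not; exact ⟨hm, hp.one_lt⟩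
      rw [dif_neg this]
      ring
  · intro S hx hc m
    simp only [PowerSeries.coeff_mk]
    induction m using Nat.strong_induction_on with
    | _ m ih =>
      rw [asCoeff]
      split_ifs with h h'
      · exact hx
      · push Not at h
        exact S.sub_mem (S.pow_mem (ih _ (Nat.div_lt_self (Nat.pos_of_ne_zero h.1) h.2)) _) (hc m)
      · exact S.sub_mem S.zero_mem (hc m)

/-- power series over the algebraic closure with coefficients in a finite extension. -/
def finSub (k : Type*) [Field k] : Subring (PowerSeries (AlgebraicClosure k)) where
  carrier := {f | ∃ E : IntermediateField k (AlgebraicClosure k), FiniteDimensional k E ∧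
    ∀ m, PowerSeries.coeff m f ∈ E}
  zero_mem' := ⟨⊥, inferInstance, fun m => by simp⟩
  one_mem' := ⟨⊥, inferInstance, fun m => by
    rw [PowerSeries.coeff_one]; split_ifs
    · exact one_mem _
    · exact zero_mem _⟩
  add_mem' := by
    rintro f g ⟨E, hE, h⟩ ⟨E', hE', h'⟩
    refine ⟨E ⊔ E', IntermediateField.finiteDimensional_sup E E', fun m => ?_⟩
    rw [map_add]
    exact add_mem ((le_sup_left : E ≤ E ⊔ E') (h m)) ((le_sup_right : E' ≤ E ⊔ E') (h' m))
  mul_mem' := by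
    rintro f g ⟨E, hE, h⟩ ⟨E', hE', h'⟩
    refine ⟨E ⊔ E', IntermediateField.finiteDimensional_sup E E', fun m => ?_⟩
    rw [PowerSeries.coeff_mul]
    exact sum_mem fun i _ => mul_mem ((le_sup_left : E ≤ E ⊔ E') (h _))
      ((le_sup_right : E' ≤ E ⊔ E') (h' _))
  neg_mem' := by
    rintro f ⟨E, hE, h⟩
    exact ⟨E, hE, fun m => by rw [map_neg]; exact neg_mem (h m)⟩

theorem finSub_as {p : ℕ} [Fact p.Prime] (k : Type*) [Field k] [CharP k p]
    (c : finSub k) : ∃ x : finSub k, x ^ p - x = c := by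
  have hp : p.Prime := Fact.out
  have : CharP (AlgebraicClosure k) p :=
    charP_of_injective_algebraMap (algebraMap k (AlgebraicClosure k)).injective p
  obtain ⟨c, E, hE, hc⟩ := c
  set c0 := PowerSeries.coeff 0 c
  obtain ⟨x0, hx0⟩ := IsAlgClosed.exists_root
    (Polynomial.X ^ p - Polynomial.X - Polynomial.C c0 : Polynomial (AlgebraicClosure k)) (by
      rw [sub_sub, Polynomial.degree_sub_eq_left_of_degree_lt]
      · rw [Polynomial.degree_X_pow]; exact_mod_cast hp.ne_zero
      · rw [Polynomial.degree_X_pow, Polynomial.degree_X_add_C]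
        exact_mod_cast hp.one_lt)
  have h0 : x0 ^ p - x0 = c0 := by
    simpa [sub_eq_zero] using hx0
  obtain ⟨x, hx, hS⟩ := ws_as c x0 h0
  have : FiniteDimensional k (IntermediateField.adjoin k {x0}) :=
    IntermediateField.adjoin.finiteDimensional (Algebra.IsIntegral.isIntegral x0)
  refine ⟨⟨x, E ⊔ IntermediateField.adjoin k {x0},
    IntermediateField.finiteDimensional_sup _ _, ?_⟩, Subtype.ext hx⟩
  exact hS (E ⊔ IntermediateField.adjoin k {x0}).toSubalgebra.toSubring
    ((le_sup_right : _ ≤ E ⊔ IntermediateField.adjoin k {x0})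
      (IntermediateField.mem_adjoin_simple_self k x0))
    (fun m => (le_sup_left : E ≤ E ⊔ IntermediateField.adjoin k {x0}) (hc m))

open WittVector in
theorem witt_as {p : ℕ} [Fact p.Prime] {R : Type*} [CommRing R] [CharP R p]
    (hR : ∀ c : R, ∃ x : R, x ^ p - x = c) (n : ℕ) :
    ∀ b : WittVector p R, ∃ d e : WittVector p R,
      WittVector.frobenius d - d = b + verschiebung^[n] e := by
  induction n with
  | zero => intro b; exact ⟨0, -b, by simp⟩
  | succ n ih =>
    intro b
    obtain ⟨x, hx⟩ := hR (b.coeff 0)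
    set u := b - (WittVector.frobenius (teichmuller p x) - teichmuller p x) with hu
    have hu0 : ∀ i < 1, u.coeff i = 0 := by
      intro i hi
      obtain rfl : i = 0 := by omega
      have : (WittVector.constantCoeff : WittVector p R →+* R) u = 0 := by
        rw [hu, map_sub, map_sub]
        simp [WittVector.constantCoeff, coeff_frobenius_charP, hx]
      exact this
    have hV := eq_iterate_verschiebung hu0
    rw [Function.iterate_one] at hV
    obtain ⟨d, e, hd⟩ := ih (u.shift 1)
    refine ⟨teichmuller p x + verschiebung d, e, ?_⟩
    have hc : WittVector.frobenius (verschiebung d) = verschiebung (WittVector.frobenius d) :=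
      ((verschiebung_frobenius_comm (p := p) (R := R)) d).symm
    rw [map_add, hc, Function.iterate_succ_apply']
    have h3 := congrArg verschiebung hd
    rw [map_sub, map_add, ← hV] at h3
    have : b = u + (WittVector.frobenius (teichmuller p x) - teichmuller p x) := by
      rw [hu]; ring
    rw [this]
    linear_combination h3

theorem witt_as' {p : ℕ} [Fact p.Prime] {R : Type*} [CommRing R] [CharP R p]
    (hR : ∀ c : R, ∃ x : R, x ^ p - x = c) (n : ℕ) (b : WittVector p R) :
    ∃ d : WittVector p R, WittVector.truncate n (WittVector.frobenius d - d) =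
      WittVector.truncate n b := by
  obtain ⟨d, e, h⟩ := witt_as hR n b
  refine ⟨d, ?_⟩
  rw [h, map_add]
  have : WittVector.truncate n (WittVector.verschiebung^[n] e) = 0 := by
    ext i
    rw [WittVector.coeff_truncate, WittVector.iterate_verschiebung_coeff_eq_zero _ i.2]
    simp
  rw [this, add_zero]

theorem witt_map_frob {p : ℕ} [Fact p.Prime] {R S : Type*} [CommRing R] [CharP R p]
    [CommRing S] [CharP S p] (f : R →+* S) (x : WittVector p R) :
    WittVector.map f (WittVector.frobenius x) = WittVector.frobenius (WittVector.map f x) := by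
  ext i
  simp only [WittVector.map_coeff, WittVector.coeff_frobenius_charP, map_pow]

theorem truncate_eq_iff {p : ℕ} [Fact p.Prime] {R : Type*} [CommRing R] (n : ℕ)
    (x y : WittVector p R) :
    WittVector.truncate n x = WittVector.truncate n y ↔ ∀ i < n, x.coeff i = y.coeff i := by
  constructor
  · intro h i hi
    have := congrArg (TruncatedWittVector.coeff ⟨i, hi⟩) h
    simpa using this
  · intro h; ext i; simpa using h i i.2

theorem truncate_frob {p : ℕ} [Fact p.Prime] {R : Type*} [CommRing R] [CharP R p] (n : ℕ)
    (x y : WittVector p R) (h : WittVector.truncate n x = WittVector.truncate n y) :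
    WittVector.truncate n (WittVector.frobenius x - x) =
      WittVector.truncate n (WittVector.frobenius y - y) := by
  rw [map_sub, map_sub, h]
  congr 1
  rw [truncate_eq_iff] at *
  intro i hi
  rw [WittVector.coeff_frobenius_charP, WittVector.coeff_frobenius_charP, h i hi]

theorem main_as {p : ℕ} [Fact p.Prime] (k : Type*) [Field k] [PerfectField k] [CharP k p]
    (n : ℕ) (b : WittVector p (PowerSeries k)) :
    ∃ E : IntermediateField k (AlgebraicClosure k), FiniteDimensional k E ∧ IsGalois k E ∧
      ∃ d : WittVector p (PowerSeries E),
        WittVector.truncate n (WittVector.frobenius d - d) =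
          WittVector.truncate n (WittVector.map (PowerSeries.map (algebraMap k E)) b) := by
  have : CharP (AlgebraicClosure k) p :=
    charP_of_injective_algebraMap (algebraMap k (AlgebraicClosure k)).injective p
  have hcp : CharP (PowerSeries (AlgebraicClosure k)) p :=
    charP_of_injective_ringHom (f := PowerSeries.C) PowerSeries.C_injective p
  have : CharP (finSub k) p := 
    (finSub k).subtype.charP Subtype.val_injective p
  let j : PowerSeries k →+* finSub k :=
    (PowerSeries.map (algebraMap k (AlgebraicClosure k))).codRestrict (finSub k)
      (fun f => ⟨⊥, inferInstance, fun m => by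
        rw [PowerSeries.coeff_map]; exact IntermediateField.algebraMap_mem _ _⟩)
  obtain ⟨d, hd⟩ := witt_as' (finSub_as (p := p) k) n (WittVector.map j b)
  choose E hE hcoef using fun i => (d.coeff i).2
  let E0 : IntermediateField k (AlgebraicClosure k) := ⨆ i : Fin n, E i
  have : FiniteDimensional k E0 := by
    have := hE
    exact IntermediateField.finiteDimensional_iSup_of_finite
  have : IsGalois k (AlgebraicClosure k) := inferInstance
  let E1 : IntermediateField k (AlgebraicClosure k) := IntermediateField.normalClosure k E0 (AlgebraicClosure k)
  have hle : E0 ≤ E1 := IntermediateField.le_normalClosure E0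
  have hmem : ∀ i, i < n → ∀ m, PowerSeries.coeff m (d.coeff i : PowerSeries _) ∈ E1 :=
    fun i hi m => hle ((le_iSup (fun i : Fin n => E i) ⟨i, hi⟩) (hcoef i m))
  refine ⟨E1, inferInstance, inferInstance, ?_⟩
  have : CharP (PowerSeries E1) p := by
    have : CharP E1 p := charP_of_injective_algebraMap (algebraMap k E1).injective p
    exact charP_of_injective_ringHom (f := PowerSeries.C) PowerSeries.C_injective p
  let d' : WittVector p (PowerSeries E1) := WittVector.mk p fun i =>
    if hi : i < n then PowerSeries.mk fun m => ⟨_, hmem i hi m⟩ else 0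
  refine ⟨d', ?_⟩
  let φ : PowerSeries E1 →+* PowerSeries (AlgebraicClosure k) :=
    PowerSeries.map (algebraMap E1 (AlgebraicClosure k))
  have hφ : Function.Injective φ := PowerSeries.map_injective _ (algebraMap E1 _).injective
  have h1 : WittVector.truncate n (WittVector.map φ d') =
      WittVector.truncate n (WittVector.map (finSub k).subtype d) := by
    rw [truncate_eq_iff]
    intro i hi
    rw [WittVector.map_coeff, WittVector.map_coeff]
    ext m
    simp [φ, d', WittVector.coeff_mk, hi]
  have h2 := truncate_frob n _ _ h1
  rw [truncate_eq_iff] at h2 hd ⊢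
  intro i hi
  apply hφ
  rw [← WittVector.map_coeff, ← WittVector.map_coeff]
  have e1 : WittVector.map φ (WittVector.frobenius d' - d') =
    WittVector.frobenius (WittVector.map φ d') - WittVector.map φ d' := by
    rw [map_sub, witt_map_frob]
  have e2 : WittVector.map (finSub k).subtype (WittVector.frobenius d - d) =
    WittVector.frobenius (WittVector.map (finSub k).subtype d)
      - WittVector.map (finSub k).subtype d := by
    rw [map_sub, witt_map_frob]
  rw [e1, h2 i hi, ← e2, WittVector.map_coeff, hd i hi]
  simp only [WittVector.map_coeff]
  ext m
  simp [φ, j]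
  rfl

/-- Coefficientwise map of Laurent series. -/
def lsMap {k E : Type*} [Field k] [Field E] (f : k →+* E) :
    LaurentSeries k →+* LaurentSeries E where
  toFun x := HahnSeries.map x f
  map_zero' := by ext; simp
  map_one' := HahnSeries.map_one f.toMonoidWithZeroHom
  map_add' x y := HahnSeries.map_add (f : k →+ E)
  map_mul' x y := HahnSeries.map_mul (f : k →ₙ+* E)

theorem lsMap_coeff {k E : Type*} [Field k] [Field E] (f : k →+* E) (x : LaurentSeries k)
    (m : ℤ) : (lsMap f x).coeff m = f (x.coeff m) := rfl

theorem ls_sum {k E : Type*} [Field k] [Field E] [Algebra k E] [FiniteDimensional k E]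
    (x : LaurentSeries E) : ∃ y : Fin (Module.finrank k E) → LaurentSeries k,
      x = ∑ i, lsMap (algebraMap k E) (y i) * HahnSeries.C (Module.finBasis k E i) := by
  refine ⟨fun i => HahnSeries.map x ((Module.finBasis k E).coord i), ?_⟩
  ext m
  rw [HahnSeries.coeff_sum]
  conv_lhs => rw [← (Module.finBasis k E).sum_repr (x.coeff m)]
  simp [Algebra.smul_def, lsMap_coeff]

theorem ls_galois {k E K : Type*} [Field k] [Field E] [Algebra k E] [FiniteDimensional k E]
    [IsGalois k E] [Field K] (ι : K ≃+* LaurentSeries k) [Algebra K (LaurentSeries E)]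
    (hal : ∀ x, algebraMap K (LaurentSeries E) x = lsMap (algebraMap k E) (ι x)) :
    FiniteDimensional K (LaurentSeries E) ∧ IsGalois K (LaurentSeries E) := by
  have key : ∀ x : LaurentSeries E, ∃ y : Fin (Module.finrank k E) → K,
      x = ∑ i, y i • (HahnSeries.C (Module.finBasis k E i) : LaurentSeries E) := by
    intro x
    obtain ⟨y, hy⟩ := ls_sum (k := k) x
    refine ⟨fun i => ι.symm (y i), ?_⟩
    simpa only [Algebra.smul_def, hal, RingEquiv.apply_symm_apply] using hy
  have hfin : FiniteDimensional K (LaurentSeries E) := by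
    refine ⟨⟨Finset.univ.image fun i => (HahnSeries.C (Module.finBasis k E i) : LaurentSeries E), ?_⟩⟩
    rw [eq_top_iff]
    rintro x -
    obtain ⟨y, rfl⟩ := key x
    exact Submodule.sum_mem _ fun i _ => Submodule.smul_mem _ _
      (Submodule.subset_span (by simp))
  refine ⟨hfin, ?_⟩
  obtain ⟨T, hT, hs⟩ := IsGalois.is_separable_splitting_field k E
  let g : k →+* K := (ι.symm : LaurentSeries k →+* K).comp HahnSeries.C
  have hg : (algebraMap K (LaurentSeries E)).comp g =
      (HahnSeries.C : E →+* LaurentSeries E).comp (algebraMap k E) := by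
    ext1 x
    simp only [RingHom.comp_apply, hal, g, RingHom.coe_coe, RingEquiv.apply_symm_apply]
    exact HahnSeries.map_C (Γ := ℤ) x (algebraMap k E)
  have hmap : (T.map g).map (algebraMap K (LaurentSeries E)) =
      (T.map (algebraMap k E)).map HahnSeries.C := by
    rw [Polynomial.map_map, Polynomial.map_map, hg]
  have : (T.map g).IsSplittingField K (LaurentSeries E) := by
    constructor
    · rw [hmap]
      exact hs.splits'.map _
    · have hroot : ∀ x ∈ T.rootSet E, (HahnSeries.C x : LaurentSeries E) ∈
          (T.map g).rootSet (LaurentSeries E) := by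
        intro x hx
        rw [Polynomial.mem_rootSet'] at hx ⊢
        rw [hmap]
        refine ⟨(Polynomial.map_ne_zero_iff HahnSeries.C_injective).2 hx.1, ?_⟩
        rw [Polynomial.aeval_def, ← Polynomial.eval_map, hmap, Polynomial.eval_map,
          Polynomial.eval₂_hom, Polynomial.eval_map, ← Polynomial.aeval_def, hx.2, map_zero]
      have hC : ∀ x : E, (HahnSeries.C x : LaurentSeries E) ∈
          Algebra.adjoin K ((T.map g).rootSet (LaurentSeries E)) := by
        intro x
        have hx : x ∈ Algebra.adjoin k (T.rootSet E) := by rw [hs.adjoin_rootSet']; trivial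
        induction hx using Algebra.adjoin_induction with
        | mem x hx => exact Algebra.subset_adjoin (hroot x hx)
        | algebraMap r =>
          have := congrArg (fun f => f r) hg
          simp only [RingHom.comp_apply] at this
          rw [← this]
          exact Subalgebra.algebraMap_mem _ _
        | add x y _ _ h1 h2 => rw [map_add]; exact add_mem h1 h2
        | mul x y _ _ h1 h2 => rw [map_mul]; exact mul_mem h1 h2
      rw [eq_top_iff]
      rintro x -
      obtain ⟨y, rfl⟩ := key x
      exact sum_mem fun i _ => Subalgebra.smul_mem _ (hC _) _
  exact IsGalois.of_separable_splitting_field (p := T.map g) hT.map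

theorem lsVal_eq {k : Type*} [Field k] (x : LaurentSeries k) : lsVal x = x.orderTop := by
  unfold lsVal
  split_ifs with h
  · simp [h]
  · exact HahnSeries.order_eq_orderTop_of_ne_zero h

theorem lsVal_normVal {k : Type*} [Field k] : IsNormVal (lsVal (k := k)) := by
  refine ⟨fun x => ?_, fun x y => ?_, fun x y => ?_, HahnSeries.single 1 1, ?_⟩
  · rw [lsVal_eq, HahnSeries.orderTop_eq_top]
  · rw [lsVal_eq, lsVal_eq, lsVal_eq, HahnSeries.orderTop_mul]
  · rw [lsVal_eq, lsVal_eq, lsVal_eq]; exact HahnSeries.min_orderTop_le_orderTop_add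
  · rw [lsVal_eq, HahnSeries.orderTop_single one_ne_zero]

theorem lsVal_lsMap {k E : Type*} [Field k] [Field E] (f : k →+* E) (x : LaurentSeries k) :
    lsVal (lsMap f x) = lsVal x := by
  by_cases hx : x = 0
  · simp [hx, lsVal]
  rw [lsVal_eq, lsVal_eq]
  have hx' : lsMap f x ≠ 0 := (map_ne_zero _).2 hx
  rw [← HahnSeries.order_eq_orderTop_of_ne_zero hx, ← HahnSeries.order_eq_orderTop_of_ne_zero hx']
  congr 1
  apply le_antisymm
  · apply HahnSeries.order_le_of_coeff_ne_zero
    rw [lsMap_coeff]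
    exact (map_ne_zero f).2 (HahnSeries.coeff_order_eq_zero.not.2 hx)
  · apply HahnSeries.order_le_of_coeff_ne_zero
    have := HahnSeries.coeff_order_eq_zero.not.2 hx'
    rw [lsMap_coeff] at this
    exact (map_ne_zero f).1 this

theorem lsVal_nonneg {k : Type*} [Field k] (q : PowerSeries k) :
    0 ≤ lsVal (HahnSeries.ofPowerSeries ℤ k q) := by
  unfold lsVal
  split_ifs with h
  · exact le_top
  · have h1 := HahnSeries.coeff_order_eq_zero.not.2 h
    rw [PowerSeries.coeff_coe] at h1
    have : 0 ≤ (HahnSeries.ofPowerSeries ℤ k q).order := by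
      by_contra hc
      rw [if_pos (not_le.1 hc)] at h1
      exact h1 rfl
    exact_mod_cast this

theorem exists_ps {k : Type*} [Field k] (x : LaurentSeries k) (hx : 0 ≤ lsVal x) :
    ∃ q : PowerSeries k, HahnSeries.ofPowerSeries ℤ k q = x := by
  refine ⟨PowerSeries.mk fun m => x.coeff m, ?_⟩
  ext m
  rw [PowerSeries.coeff_coe]
  split_ifs with h
  · symm
    apply HahnSeries.coeff_eq_zero_of_lt_orderTop
    rw [← lsVal_eq]
    exact lt_of_lt_of_le (by exact_mod_cast h) hx
  · rw [PowerSeries.coeff_mk, Int.natAbs_of_nonneg (not_lt.1 h)]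

theorem lsMap_ofPS {k E : Type*} [Field k] [Field E] (f : k →+* E) (q : PowerSeries k) :
    HahnSeries.ofPowerSeries ℤ E (PowerSeries.map f q) =
      lsMap f (HahnSeries.ofPowerSeries ℤ k q) := by
  ext m
  rw [lsMap_coeff, PowerSeries.coeff_coe, PowerSeries.coeff_coe]
  split_ifs <;> simp

/-- The core computation over an abstract field. -/
theorem witt_core {p : ℕ} [Fact p.Prime] {L : Type*} [Field L] [CharP L p] (n : ℕ)
    (P B D : WittVector p L) (hdis : ∀ i, P.coeff i = 0 ∨ B.coeff i = 0)
    (hD : WittVector.truncate n (WittVector.frobenius D - D) = WittVector.truncate n (-B))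
    (x : TruncatedWittVector p n L) (hx : ∀ i : Fin n, x.coeff i = P.coeff i + B.coeff i) :
    x + wittF (WittVector.truncate n D) - WittVector.truncate n D = WittVector.truncate n P := by
  have h1 : x = WittVector.truncate n (P + B) := by
    ext i
    rw [hx, WittVector.coeff_truncate, WittVector.coeff_add_of_disjoint _ _ _ hdis]
  have h2 : wittF (WittVector.truncate n D) = WittVector.truncate n (WittVector.frobenius D) := by
    ext i
    rw [wittF, TruncatedWittVector.coeff_mk, WittVector.coeff_truncate, WittVector.coeff_truncate,
      WittVector.coeff_frobenius_charP]
  rw [h1, h2, add_sub_assoc, ← map_sub, hD, ← map_add]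
  congr 1
  ring

/-- the reduction step in the proof of Theorem 7.  Let `K ≅ k((t))`
be a local field of characteristic `p > 0` with perfect residue field `k` and let
`a ∈ W_n(K)` be reduced.  Then there exist a finite unramified Galois extension
`K'/K` and `d ∈ W_n(O_{K'})` (i.e. with integral components) such that
`a' = a ⊕ F(d) ⊖ d ∈ W_n(K')` is strongly reduced, and `v_{K'}(a_i') = v_K(a_i)`
for every `i` with `v_K(a_i) < 0`.  Here `v'` is the normalized valuation of `K'`,
which restricts to `v_K` on `K` (ramification index `1`, i.e. `K'/K` unramified). -/
theorem stmt_13 {p : ℕ} [Fact p.Prime] (k : Type) [Field k] [PerfectField k] [CharP k p]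
    (K : Type) [Field K] [CharP K p] (ι : K ≃+* LaurentSeries k)
    (n : ℕ) (a : TruncatedWittVector p n K)
    (hred : ∀ i : Fin n, 0 ≤ lfVal ι (a.coeff i) ∨
      ∀ z : ℤ, lfVal ι (a.coeff i) = (z : WithTop ℤ) → ¬ (p : ℤ) ∣ z) :
    ∃ (K' : IntermediateField K (AlgebraicClosure K)),
      FiniteDimensional K K' ∧ IsGalois K K' ∧
      ∃ v' : K' → WithTop ℤ, IsNormVal v' ∧ ExtendsWithE (lfVal ι) v' 1 ∧
      ∃ d : TruncatedWittVector p n K',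
        (∀ i : Fin n, 0 ≤ v' (d.coeff i)) ∧
        (∀ i : Fin n,
          (wittMap (algebraMap K K') a + wittF d - d).coeff i = 0 ∨
          ∀ z : ℤ, v' ((wittMap (algebraMap K K') a + wittF d - d).coeff i) =
              (z : WithTop ℤ) → ¬ (p : ℤ) ∣ z) ∧
        (∀ i : Fin n, lfVal ι (a.coeff i) < (0 : ℤ) →
          v' ((wittMap (algebraMap K K') a + wittF d - d).coeff i) =
            lfVal ι (a.coeff i)) := by
  classical
  have hq : ∀ i : ℕ, ∃ q : PowerSeries k, ∀ h : i < n,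
      HahnSeries.ofPowerSeries ℤ k q =
        if 0 ≤ lfVal ι (a.coeff ⟨i, h⟩) then ι (a.coeff ⟨i, h⟩) else 0 := by
    intro i
    by_cases h : i < n
    · by_cases h0 : 0 ≤ lfVal ι (a.coeff ⟨i, h⟩)
      · obtain ⟨q, hq⟩ := exists_ps _ h0
        exact ⟨q, fun _ => by rw [if_pos h0, hq]⟩
      · exact ⟨0, fun _ => by rw [if_neg h0, map_zero]⟩
    · exact ⟨0, fun h' => absurd h' h⟩
  choose q hq using hq
  obtain ⟨E, hE, hGal, d, hd⟩ := main_as (p := p) k n (-(WittVector.mk p q))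
  letI : Algebra K (LaurentSeries E) :=
    ((lsMap (algebraMap k E)).comp (ι : K →+* LaurentSeries k)).toAlgebra
  have hal : ∀ x, algebraMap K (LaurentSeries E) x = lsMap (algebraMap k E) (ι x) := fun x => rfl
  obtain ⟨hfin, hgal⟩ := ls_galois ι hal
  let σ : LaurentSeries E →ₐ[K] AlgebraicClosure K := IsAlgClosed.lift
  let K' : IntermediateField K (AlgebraicClosure K) := σ.fieldRange
  let e : LaurentSeries E ≃ₐ[K] K' := AlgEquiv.ofInjectiveField σ
  have hcE : CharP (PowerSeries E) p := by
    have : CharP E p := charP_of_injective_algebraMap (algebraMap k E).injective p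
    exact charP_of_injective_ringHom (f := PowerSeries.C) PowerSeries.C_injective p
  have hcK : CharP K' p := charP_of_injective_algebraMap (algebraMap K K').injective p
  have hv : IsNormVal (fun x : K' => lsVal (e.symm x)) := by
    obtain ⟨h1, h2, h3, π, h4⟩ := lsVal_normVal (k := E)
    refine ⟨fun x => ?_, fun x y => ?_, fun x y => ?_, e π, ?_⟩
    · simp only [h1, map_eq_zero]
    · simp only [map_mul, h2]
    · simp only [map_add]; exact h3 _ _
    · simpa using h4
  have hext : ∀ x : K, lsVal (e.symm (algebraMap K K' x)) = lfVal ι x := by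
    intro x
    rw [AlgEquiv.commutes, hal, lsVal_lsMap]; rfl
  let ψ : PowerSeries E →+* K' :=
    (e : LaurentSeries E →+* K').comp (HahnSeries.ofPowerSeries ℤ E)
  let D : WittVector p K' := WittVector.map ψ d
  let B : WittVector p K' :=
    WittVector.map (ψ.comp (PowerSeries.map (algebraMap k E))) (WittVector.mk p q)
  let P : WittVector p K' := WittVector.mk p fun i => if h : i < n then
    (if 0 ≤ lfVal ι (a.coeff ⟨i, h⟩) then 0 else algebraMap K K' (a.coeff ⟨i, h⟩)) else 0
  have hB : ∀ i (h : i < n), B.coeff i =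
      if 0 ≤ lfVal ι (a.coeff ⟨i, h⟩) then algebraMap K K' (a.coeff ⟨i, h⟩) else 0 := by
    intro i h
    have h1 : B.coeff i = e (lsMap (algebraMap k E) (HahnSeries.ofPowerSeries ℤ k (q i))) := by
      rw [← lsMap_ofPS]; rfl
    rw [h1, hq i h]
    split_ifs
    · rw [← hal, AlgEquiv.commutes]
    · simp
  have hP : ∀ i (h : i < n), P.coeff i =
      if 0 ≤ lfVal ι (a.coeff ⟨i, h⟩) then 0 else algebraMap K K' (a.coeff ⟨i, h⟩) := by
    intro i h
    simp only [P, WittVector.coeff_mk, dif_pos h]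
  have hdis : ∀ i, P.coeff i = 0 ∨ B.coeff i = 0 := by
    intro i
    by_cases h : i < n
    · rw [hP i h, hB i h]
      split_ifs <;> simp
    · left
      simp [P, WittVector.coeff_mk, h]
  have hD : WittVector.truncate n (WittVector.frobenius D - D) = WittVector.truncate n (-B) := by
    rw [truncate_eq_iff] at hd ⊢
    intro i hi
    have h1 := congrArg ψ (hd i hi)
    rw [← WittVector.map_coeff, ← WittVector.map_coeff, map_sub, witt_map_frob] at h1
    rw [h1]
    have h2 : -B = WittVector.map (ψ.comp (PowerSeries.map (algebraMap k E)))
        (-(WittVector.mk p q)) := by rw [map_neg]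
    rw [h2]
    simp only [WittVector.map_coeff]
    rfl
  have hcore := witt_core n P B D hdis hD (wittMap (algebraMap K K') a) (by
    intro i
    rw [hP i i.2, hB i i.2, wittMap, TruncatedWittVector.coeff_mk]
    split_ifs <;> simp)
  refine ⟨K', LinearEquiv.finiteDimensional e.toLinearEquiv, IsGalois.of_algEquiv e,
    fun x => lsVal (e.symm x), hv, ?_, WittVector.truncate n D, ?_, ?_, ?_⟩
  · intro x z hz
    beta_reduce
    rw [hext, hz]; simp
  · intro i
    rw [WittVector.coeff_truncate, WittVector.map_coeff]
    have : e.symm (ψ (d.coeff i)) = HahnSeries.ofPowerSeries ℤ E (d.coeff i) :=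
      e.symm_apply_apply _
    beta_reduce
    rw [this]
    exact lsVal_nonneg _
  · intro i
    rw [hcore, WittVector.coeff_truncate, hP i i.2]
    split_ifs with h
    · exact Or.inl rfl
    · right
      beta_reduce
      rw [hext]
      exact (hred i).resolve_left h
  · intro i hi
    rw [hcore, WittVector.coeff_truncate, hP i i.2]
    have h0 : ¬ 0 ≤ lfVal ι (a.coeff i) := not_le.2 hi
    beta_reduce
    rw [if_neg h0, hext]
end
end

section
/- Let K be a local field of characteristic p > 0 with perfect residue field, let a_0 ∈ K with v_K(a_0) = -m_0 where m_0 > 0 and p ∤ m_0, and let a = (a_0, 0, …, 0) ∈ W_n(K). Then K[a]/K is a totally ramified (Z/p^nZ)-extension whose upper ramification breaks are m_0, p m_0, p^2 m_0, …, p^{n-1} m_0, and whose lower ramification breaks are b_i = (p^{2i-2} - p^{2i-3} + ⋯ + p^2 - p + 1) m_0 for 1 ≤ i ≤ n (i.e., b_i = m_0 · Σ_{j=0}^{2i-2} (-1)^j p^{2i-2-j}). -/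
noncomputable section

open scoped Classical

/-- `σ` lies in the inertia subgroup `G_0` of `Gal(L/F)`: `σ` induces the identity
on the residue field. -/
def InInertia {F L : Type*} [Field F] [Field L] [Algebra F L]
    (v : L → WithTop ℤ) (σ : L ≃ₐ[F] L) : Prop :=
  ∀ x : L, 0 ≤ v x → (1 : ℤ) ≤ v (σ x - x)

/-- The ramification group `G_x = {σ ∈ G_0 : v_L(σ(π_L) - π_L) ≥ x + 1}` of `Gal(L/F)`
in the lower numbering (for real `x`); since `v_L` is integer valued, the condition
`v_L(σ(π_L) - π_L) ≥ x + 1` is expressed via the ceiling `⌈x + 1⌉`. -/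
def ramGrp (F : Type*) {L : Type*} [Field F] [Field L] [Algebra F L]
    (v : L → WithTop ℤ) (π : L) (x : ℝ) : Set (L ≃ₐ[F] L) :=
  {σ | InInertia v σ ∧ ((⌈x + 1⌉ : ℤ) : WithTop ℤ) ≤ v (σ π - π)}

/-- The Hasse–Herbrand function `φ_{L/F}(x) = ∫_0^x dt / (G_0 : G_t)`, where
`1/(G_0 : G_t) = |G_t|/|G_0|`. -/
def hhPhi (F : Type*) {L : Type*} [Field F] [Field L] [Algebra F L]
    (v : L → WithTop ℤ) (π : L) (x : ℝ) : ℝ :=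
  ∫ t in (0 : ℝ)..x, ((ramGrp F v π t).ncard : ℝ) / ((ramGrp F v π 0).ncard : ℝ)

/-- `ψ_{L/F}`, the inverse of the Hasse–Herbrand bijection `φ_{L/F} : ℝ_{≥0} → ℝ_{≥0}`. -/
def hhPsi (F : Type*) {L : Type*} [Field F] [Field L] [Algebra F L]
    (v : L → WithTop ℤ) (π : L) (u : ℝ) : ℝ :=
  Function.invFunOn (hhPhi F v π) (Set.Ici 0) u

/-- The ramification group `G^u = G_{ψ_{L/F}(u)}` in the upper numbering. -/
def upperRamGrp (F : Type*) {L : Type*} [Field F] [Field L] [Algebra F L]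
    (v : L → WithTop ℤ) (π : L) (u : ℝ) : Set (L ≃ₐ[F] L) :=
  ramGrp F v π (hhPsi F v π u)

/-- `b` is a lower ramification break of `L/F`: `b ≥ 0` and `G_{b+ε} ≠ G_b` for all
`ε > 0`. -/
def IsLowerBreak (F : Type*) {L : Type*} [Field F] [Field L] [Algebra F L]
    (v : L → WithTop ℤ) (π : L) (b : ℝ) : Prop :=
  0 ≤ b ∧ ∀ ε : ℝ, 0 < ε → ramGrp F v π (b + ε) ≠ ramGrp F v π b

/-- `u` is an upper ramification break of `L/F`: `u ≥ 0` and `G^{u+ε} ≠ G^u` for all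
`ε > 0`. -/
def IsUpperBreak (F : Type*) {L : Type*} [Field F] [Field L] [Algebra F L]
    (v : L → WithTop ℤ) (π : L) (u : ℝ) : Prop :=
  0 ≤ u ∧ ∀ ε : ℝ, 0 < ε → upperRamGrp F v π (u + ε) ≠ upperRamGrp F v π u

/-- A separable closure `K^sep` of `K`. -/
abbrev SepCl (K : Type*) [Field K] : Type _ :=
  separableClosure K (AlgebraicClosure K)

section ValLemmas

variable {L : Type*} [Field L] (w : AddValuation L (WithTop ℚ))

theorem av_exists {x : L} (hx : x ≠ 0) : ∃ q : ℚ, w x = (q : WithTop ℚ) := by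
  have h := (AddValuation.ne_top_iff w (x := x)).2 hx
  obtain ⟨q, hq⟩ := WithTop.ne_top_iff_exists.1 h
  exact ⟨q, hq.symm⟩

theorem av_ne_zero {x : L} {q : ℚ} (h : w x = (q : WithTop ℚ)) : x ≠ 0 := by
  rintro rfl
  rw [AddValuation.map_zero] at h
  exact WithTop.coe_ne_top h.symm

theorem av_mono {x : L} {r s : ℚ} (h : (s : WithTop ℚ) ≤ w x) (hrs : r ≤ s) :
    (r : WithTop ℚ) ≤ w x := (WithTop.coe_le_coe.2 hrs).trans h

theorem av_mul_ge {x y : L} {r s : ℚ} (hx : (r : WithTop ℚ) ≤ w x) (hy : (s : WithTop ℚ) ≤ w y) :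
    ((r + s : ℚ) : WithTop ℚ) ≤ w (x * y) := by
  rw [AddValuation.map_mul, WithTop.coe_add]; exact add_le_add hx hy

theorem av_mul_eq {x y : L} {r s : ℚ} (hx : w x = (r : WithTop ℚ)) (hy : w y = (s : WithTop ℚ)) :
    w (x * y) = ((r + s : ℚ) : WithTop ℚ) := by
  rw [AddValuation.map_mul, WithTop.coe_add, hx, hy]

theorem av_pow_eq {x : L} {r : ℚ} (hx : w x = (r : WithTop ℚ)) (n : ℕ) :
    w (x ^ n) = ((n * r : ℚ) : WithTop ℚ) := by
  induction n with
  | zero => simp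
  | succ n ih => rw [pow_succ, av_mul_eq w ih hx]; congr 1; push_cast; ring

theorem av_pow_ge {x : L} {r : ℚ} (hx : (r : WithTop ℚ) ≤ w x) (n : ℕ) :
    ((n * r : ℚ) : WithTop ℚ) ≤ w (x ^ n) := by
  induction n with
  | zero => simp
  | succ n ih => rw [pow_succ]; refine av_mono w (av_mul_ge w ih hx) (le_of_eq ?_); push_cast; ring

theorem av_inv_eq {x : L} {r : ℚ} (hx : w x = (r : WithTop ℚ)) :
    w (x⁻¹) = ((-r : ℚ) : WithTop ℚ) := by
  have h0 := av_ne_zero w hx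
  obtain ⟨q, hq⟩ := av_exists w (inv_ne_zero h0)
  have := av_mul_eq w hx hq
  rw [mul_inv_cancel₀ h0, AddValuation.map_one] at this
  have h2 : (0 : ℚ) = r + q := by exact_mod_cast this
  rw [hq]; congr 1; linarith

theorem av_div_eq {x y : L} {r s : ℚ} (hx : w x = (r : WithTop ℚ)) (hy : w y = (s : WithTop ℚ)) :
    w (x / y) = ((r - s : ℚ) : WithTop ℚ) := by
  rw [div_eq_mul_inv, av_mul_eq w hx (av_inv_eq w hy), sub_eq_add_neg r s]

theorem av_add_eq {x y : L} {r s : ℚ} (hx : w x = (r : WithTop ℚ)) (hy : (s : WithTop ℚ) ≤ w y)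
    (h : r < s) : w (x + y) = (r : WithTop ℚ) := by
  rw [AddValuation.map_add_eq_of_lt_left, hx]
  rw [hx]; exact (WithTop.coe_lt_coe.2 h).trans_le hy

theorem av_le_of_eq {x : L} {r s : ℚ} (hx : w x = (r : WithTop ℚ))
    (h : (s : WithTop ℚ) ≤ w x) : s ≤ r := by
  rw [hx] at h; exact WithTop.coe_le_coe.1 h

theorem av_eq_of_eq {x : L} {r s : ℚ} (hx : w x = (r : WithTop ℚ))
    (h : w x = (s : WithTop ℚ)) : r = s := by
  rw [hx] at h; exact WithTop.coe_injective h

/-- nonzero elements of the prime field have valuation zero -/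
theorem av_prime {p : ℕ} (hp : p.Prime) {x : L} (hx : x ≠ 0) (h : x ^ p = x) :
    w x = ((0 : ℚ) : WithTop ℚ) := by
  obtain ⟨q, hq⟩ := av_exists w hx
  have h1 := av_pow_eq w hq p
  rw [h] at h1
  have h2 := av_eq_of_eq w hq h1
  have h3 : (1 : ℚ) < p := by exact_mod_cast hp.one_lt
  rw [hq]; congr 1; nlinarith [mul_self_nonneg q]

theorem av_natCast {p : ℕ} [Fact p.Prime] [CharP L p] {l : ℕ} (h : ¬ p ∣ l) :
    w (l : L) = ((0 : ℚ) : WithTop ℚ) := by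
  refine av_prime w (Fact.out : p.Prime) ?_ ?_
  · rwa [Ne, CharP.cast_eq_zero_iff L p]
  · have := map_natCast (frobenius L p) l
    rwa [frobenius_def] at this

theorem av_natCast_ge {p : ℕ} [Fact p.Prime] [CharP L p] (l : ℕ) :
    ((0 : ℚ) : WithTop ℚ) ≤ w (l : L) := by
  by_cases h : p ∣ l
  · rw [(CharP.cast_eq_zero_iff L p l).2 h, AddValuation.map_zero]; exact le_top
  · rw [av_natCast w h]

/-- Artin–Schreier: `y^p - y` of negative valuation -/
theorem av_as_neg {p : ℕ} (hp : p.Prime) {y : L} {r : ℚ} (hr : r < 0)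
    (h : w (y ^ p - y) = (r : WithTop ℚ)) : w y = ((r / p : ℚ) : WithTop ℚ) := by
  have hp1 : (1 : ℚ) < p := by exact_mod_cast hp.one_lt
  have hy : y ≠ 0 := by
    rintro rfl
    rw [zero_pow hp.ne_zero, sub_zero] at h
    exact av_ne_zero w h rfl
  obtain ⟨q, hq⟩ := av_exists w hy
  have h1 := av_pow_eq w hq p
  have hneg : w (-y) = (q : WithTop ℚ) := by rw [AddValuation.map_neg, hq]
  by_cases hq0 : q < 0
  · have := av_add_eq w h1 hneg.ge (by nlinarith)
    rw [← sub_eq_add_neg] at this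
    have := av_eq_of_eq w h this
    rw [hq, this]; congr 1; field_simp
  · push Not at hq0
    have : ((0 : ℚ) : WithTop ℚ) ≤ w (y ^ p + -y) :=
      AddValuation.map_le_add w (av_mono w h1.ge (by positivity)) (av_mono w hneg.ge hq0)
    rw [← sub_eq_add_neg] at this
    have := av_le_of_eq w h this
    linarith

theorem av_as_of_neg {p : ℕ} (hp : p.Prime) {y : L} {q : ℚ} (hq0 : q < 0)
    (hq : w y = (q : WithTop ℚ)) : w (y ^ p - y) = ((p * q : ℚ) : WithTop ℚ) := by
  have hp1 : (1 : ℚ) < p := by exact_mod_cast hp.one_lt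
  have h1 := av_pow_eq w hq p
  have hneg : w (-y) = (q : WithTop ℚ) := by rw [AddValuation.map_neg, hq]
  rw [sub_eq_add_neg]
  exact av_add_eq w h1 hneg.ge (by nlinarith)

/-- a finite sum of terms with distinct valuations -/
theorem av_sum_distinct {ι : Type*} (s : Finset ι) (f : ι → L)
    (h : ∀ i ∈ s, ∀ j ∈ s, i ≠ j → f i ≠ 0 → f j ≠ 0 → w (f i) ≠ w (f j)) :
    (∀ i ∈ s, f i = 0) ∨ ∃ i ∈ s, f i ≠ 0 ∧ w (∑ j ∈ s, f j) = w (f i) ∧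
      ∀ j ∈ s, j ≠ i → w (f i) < w (f j) := by
  induction s using Finset.induction_on with
  | empty => left; simp
  | insert a s ha ih =>
    have h' := ih (fun i hi j hj => h i (Finset.mem_insert_of_mem hi) j (Finset.mem_insert_of_mem hj))
    rw [Finset.sum_insert ha]
    by_cases hfa : f a = 0
    · rcases h' with h0 | ⟨i, hi, hfi, hsum, hlt⟩
      · left; intro i hi; rcases Finset.mem_insert.1 hi with rfl | hi
        · exact hfa
        · exact h0 i hi
      · right
        refine ⟨i, Finset.mem_insert_of_mem hi, hfi, by rw [hfa, zero_add, hsum], ?_⟩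
        intro j hj hji
        rcases Finset.mem_insert.1 hj with rfl | hj
        · rw [hfa, AddValuation.map_zero]; exact lt_top_iff_ne_top.2 ((AddValuation.ne_top_iff w).2 hfi)
        · exact hlt j hj hji
    · right
      rcases h' with h0 | ⟨i, hi, hfi, hsum, hlt⟩
      · refine ⟨a, Finset.mem_insert_self _ _, hfa, by rw [Finset.sum_eq_zero h0, add_zero], ?_⟩
        intro j hj hja
        rcases Finset.mem_insert.1 hj with rfl | hj
        · exact absurd rfl hja
        · rw [h0 j hj, AddValuation.map_zero]
          exact lt_top_iff_ne_top.2 ((AddValuation.ne_top_iff w).2 hfa)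
      · have hai : a ≠ i := fun e => ha (e ▸ hi)
        have hne := h a (Finset.mem_insert_self _ _) i (Finset.mem_insert_of_mem hi) hai hfa hfi
        rcases lt_or_gt_of_ne hne with hl | hl
        · refine ⟨a, Finset.mem_insert_self _ _, hfa, AddValuation.map_add_eq_of_lt_left w (hsum ▸ hl), ?_⟩
          intro j hj hja
          rcases Finset.mem_insert.1 hj with rfl | hj
          · exact absurd rfl hja
          · by_cases hji : j = i
            · rwa [hji]
            · exact hl.trans (hlt j hj hji)
        · refine ⟨i, Finset.mem_insert_of_mem hi, hfi, ?_, ?_⟩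
          · rw [AddValuation.map_add_eq_of_lt_right w (by rw [hsum]; exact hl), hsum]
          · intro j hj hji
            rcases Finset.mem_insert.1 hj with rfl | hj
            · exact hl
            · exact hlt j hj hji

/-- `(1+ε)^l - 1 - lε` has valuation at least `2s`. -/
theorem av_binom {p : ℕ} [Fact p.Prime] [CharP L p] {ε : L} {s : ℚ} (hs : 0 ≤ s)
    (h : (s : WithTop ℚ) ≤ w ε) (l : ℕ) :
    ((2 * s : ℚ) : WithTop ℚ) ≤ w ((1 + ε) ^ l - 1 - l * ε) := by
  have h1 : ((0 : ℚ) : WithTop ℚ) ≤ w (1 + ε) :=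
    AddValuation.map_le_add w (by rw [AddValuation.map_one]; rfl) (av_mono w h hs)
  induction l with
  | zero => simp
  | succ l ih =>
    have : (1 + ε) ^ (l + 1) - 1 - ((l + 1 : ℕ) : L) * ε
        = ((1 + ε) ^ l - 1 - l * ε) * (1 + ε) + l * (ε * ε) := by push_cast; ring
    rw [this]
    refine AddValuation.map_le_add w (av_mono w (av_mul_ge w ih h1) (by linarith))
      (av_mono w (av_mul_ge w (av_natCast_ge (p := p) w l) (av_mul_ge w h h)) (by linarith))

end ValLemmas

section Graded

variable {K L : Type*} [Field K] [Field L] [Algebra K L] (w : AddValuation L (WithTop ℚ))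

/-- valuations on `K` are integral -/
def KInt (K : Type*) {L : Type*} [Field K] [Field L] [Algebra K L]
    (w : AddValuation L (WithTop ℚ)) : Prop :=
  ∀ a : K, a ≠ 0 → ∃ m : ℤ, w (algebraMap K L a) = ((m : ℚ) : WithTop ℚ)

theorem gr_arith {p : ℕ} (hp : p.Prime) {i : ℕ} {b : ℤ} (hb : ¬ (p : ℤ) ∣ b) {m m' : ℤ} {l l' : ℕ}
    (hl : l < p ^ i) (hl' : l' < p ^ i)
    (h : (m : ℚ) + l * (-(b : ℚ) / p ^ i) = m' + l' * (-(b : ℚ) / p ^ i)) : l = l' := by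
  have hp0 : (p : ℚ) ^ i ≠ 0 := pow_ne_zero _ (by exact_mod_cast hp.ne_zero)
  field_simp at h
  have h2 : (p : ℤ) ^ i * (m - m') = ((l : ℤ) - l') * b := by
    have : ((p : ℚ)) ^ i * (m - m') = ((l : ℚ) - l') * b := by linarith
    exact_mod_cast this
  have hcop : IsCoprime ((p : ℤ) ^ i) b := by
    refine IsCoprime.pow_left ?_
    exact ((Nat.prime_iff_prime_int.1 hp).coprime_iff_not_dvd).2 hb
  have hd : (p : ℤ) ^ i ∣ (l : ℤ) - l' := hcop.dvd_of_dvd_mul_right ⟨_, h2.symm⟩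
  have h3 : |(l : ℤ) - l'| < (p : ℤ) ^ i := by
    have e1 : (l : ℤ) < (p : ℤ) ^ i := by exact_mod_cast hl
    have e2 : (l' : ℤ) < (p : ℤ) ^ i := by exact_mod_cast hl'
    rw [abs_lt]; constructor <;> linarith [Int.natCast_nonneg l, Int.natCast_nonneg l']
  have := Int.eq_zero_of_abs_lt_dvd hd h3
  omega

theorem gr_distinct {p : ℕ} (hp : p.Prime) (hK : KInt K w) {i : ℕ} {b : ℤ} (hb : ¬ (p : ℤ) ∣ b)
    {y : L} (hy : w y = ((-(b : ℚ) / p ^ i : ℚ) : WithTop ℚ)) (a : ℕ → K) :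
    ∀ l ∈ Finset.range (p ^ i), ∀ l' ∈ Finset.range (p ^ i), l ≠ l' →
      algebraMap K L (a l) * y ^ l ≠ 0 → algebraMap K L (a l') * y ^ l' ≠ 0 →
      w (algebraMap K L (a l) * y ^ l) ≠ w (algebraMap K L (a l') * y ^ l') := by
  intro l hl l' hl' hne h0 h0' heq
  have ha : a l ≠ 0 := by rintro h; simp [h] at h0
  have ha' : a l' ≠ 0 := by rintro h; simp [h] at h0'
  obtain ⟨m, hm⟩ := hK _ ha
  obtain ⟨m', hm'⟩ := hK _ ha'
  rw [av_mul_eq w hm (av_pow_eq w hy l), av_mul_eq w hm' (av_pow_eq w hy l')] at heq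
  exact hne (gr_arith hp hb (Finset.mem_range.1 hl) (Finset.mem_range.1 hl')
    (WithTop.coe_injective heq))

theorem gr_expand [FiniteDimensional K L] {p : ℕ} (hp : p.Prime) (hK : KInt K w) {i : ℕ} {b : ℤ}
    (hb : ¬ (p : ℤ) ∣ b)
    {y : L} (hy : w y = ((-(b : ℚ) / p ^ i : ℚ) : WithTop ℚ)) (M : IntermediateField K L)
    (hyM : y ∈ M) (hM : Module.finrank K M ≤ p ^ i) (z : L) (hz : z ∈ M) :
    ∃ a : ℕ → K, z = ∑ l ∈ Finset.range (p ^ i), algebraMap K L (a l) * y ^ l := by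
  let f : Fin (p ^ i) → M := fun l => ⟨y, hyM⟩ ^ (l : ℕ)
  have hy0 : y ≠ 0 := av_ne_zero w hy
  have hli : LinearIndependent K f := by
    rw [Fintype.linearIndependent_iff]
    intro g hg
    let a : ℕ → K := fun l => if h : l < p ^ i then g ⟨l, h⟩ else 0
    have hsum : ∑ l ∈ Finset.range (p ^ i), algebraMap K L (a l) * y ^ l = 0 := by
      rw [Finset.sum_range]
      have := congrArg (fun t : M => (t : L)) hg
      simpa [f, a, Algebra.smul_def] using this
    rcases av_sum_distinct w _ _ (gr_distinct w hp hK hb hy a) with h | ⟨l, hl, hl0, hw, -⟩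
    · intro l
      have := h l (Finset.mem_range.2 l.2)
      simpa [a, hy0] using this
    · rw [hsum, AddValuation.map_zero] at hw
      exact absurd ((AddValuation.top_iff w).1 hw.symm) hl0
  have hcard : Fintype.card (Fin (p ^ i)) = Module.finrank K M :=
    le_antisymm hli.fintype_card_le_finrank (by simpa using hM)
  have : Nonempty (Fin (p ^ i)) := ⟨⟨0, pow_pos hp.pos i⟩⟩
  have hspan := hli.span_eq_top_of_card_eq_finrank hcard
  have hz' : (⟨z, hz⟩ : M) ∈ Submodule.span K (Set.range f) := by rw [hspan]; trivial
  obtain ⟨g, hg⟩ := (Submodule.mem_span_range_iff_exists_fun K).1 hz'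
  refine ⟨fun l => if h : l < p ^ i then g ⟨l, h⟩ else 0, ?_⟩
  rw [Finset.sum_range]
  have := congrArg (fun t : M => (t : L)) hg
  simpa [f, Algebra.smul_def] using this.symm

/-- full form of the expansion -/
theorem gr_expand' [FiniteDimensional K L] {p : ℕ} (hp : p.Prime) (hK : KInt K w) {i : ℕ} {b : ℤ}
    (hb : ¬ (p : ℤ) ∣ b)
    {y : L} (hy : w y = ((-(b : ℚ) / p ^ i : ℚ) : WithTop ℚ)) (M : IntermediateField K L)
    (hyM : y ∈ M) (hM : Module.finrank K M ≤ p ^ i) (z : L) (hz : z ∈ M) (hz0 : z ≠ 0) :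
    ∃ a : ℕ → K, ∃ l < p ^ i, ∃ m : ℤ, ∃ r : ℚ, a l ≠ 0 ∧
      z = ∑ l ∈ Finset.range (p ^ i), algebraMap K L (a l) * y ^ l ∧
      w (algebraMap K L (a l)) = ((m : ℚ) : WithTop ℚ) ∧
      r = m - l * b / p ^ i ∧
      w z = (r : WithTop ℚ) ∧ w (algebraMap K L (a l) * y ^ l) = (r : WithTop ℚ) ∧
      (∀ l' < p ^ i, l' ≠ l → (r : WithTop ℚ) < w (algebraMap K L (a l') * y ^ l')) := by
  obtain ⟨a, ha⟩ := gr_expand w hp hK hb hy M hyM hM z hz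
  rcases av_sum_distinct w _ _ (gr_distinct w hp hK hb hy a) with h | ⟨l, hl, hl0, hw, hlt⟩
  · rw [Finset.sum_eq_zero h] at ha; exact absurd ha hz0
  · have hal : a l ≠ 0 := by rintro h; simp [h] at hl0
    obtain ⟨m, hm⟩ := hK _ hal
    have h1 := av_mul_eq w hm (av_pow_eq w hy l)
    have e : (m : ℚ) + l * (-(b : ℚ) / p ^ i) = m - l * b / p ^ i := by ring
    rw [e] at h1
    refine ⟨a, l, Finset.mem_range.1 hl, m, _, hal, ha, hm, rfl, ?_, h1, ?_⟩
    · rw [ha, hw, h1]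
    · intro l' hl' hne
      rw [← h1]; exact hlt l' (Finset.mem_range.2 hl') hne

/-- discreteness -/
theorem gr_disc [FiniteDimensional K L] {p : ℕ} (hp : p.Prime) (hK : KInt K w) {i : ℕ} {b : ℤ}
    (hb : ¬ (p : ℤ) ∣ b)
    {y : L} (hy : w y = ((-(b : ℚ) / p ^ i : ℚ) : WithTop ℚ)) (M : IntermediateField K L)
    (hyM : y ∈ M) (hM : Module.finrank K M ≤ p ^ i) (z : L) (hz : z ∈ M) (hz0 : z ≠ 0) :
    ∃ m : ℤ, w z = ((m / p ^ i : ℚ) : WithTop ℚ) := by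
  obtain ⟨a, l, hl, m, r, -, -, -, hr, hw, -⟩ := gr_expand' w hp hK hb hy M hyM hM z hz hz0
  have hp0 : (p : ℚ) ^ i ≠ 0 := pow_ne_zero _ (by exact_mod_cast hp.ne_zero)
  refine ⟨p ^ i * m - l * b, ?_⟩
  rw [hw, hr]; congr 1; push_cast; field_simp

/-- residue field -/
theorem gr_res [FiniteDimensional K L] {p : ℕ} (hp : p.Prime) (hK : KInt K w) {i : ℕ} {b : ℤ}
    (hb : ¬ (p : ℤ) ∣ b)
    {y : L} (hy : w y = ((-(b : ℚ) / p ^ i : ℚ) : WithTop ℚ)) (M : IntermediateField K L)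
    (hyM : y ∈ M) (hM : Module.finrank K M ≤ p ^ i) (z : L) (hz : z ∈ M)
    (hz0 : w z = ((0 : ℚ) : WithTop ℚ)) :
    ∃ a : K, w (algebraMap K L a) = ((0 : ℚ) : WithTop ℚ) ∧
      ((0 : ℚ) : WithTop ℚ) < w (z - algebraMap K L a) := by
  obtain ⟨a, l, hl, m, r, -, hs, hm, hr, hw, hw', hlt⟩ :=
    gr_expand' w hp hK hb hy M hyM hM z hz (av_ne_zero w hz0)
  have hr0 := av_eq_of_eq w hw hz0
  have hl0 : l = 0 := by
    refine gr_arith hp hb hl (pow_pos hp.pos i) (m := m) (m' := 0) ?_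
    rw [hr] at hr0
    have e : (m : ℚ) + l * (-(b : ℚ) / p ^ i) = m - l * b / p ^ i := by ring
    rw [e, hr0]; simp
  subst hl0
  subst hr0
  refine ⟨a 0, by simpa using hw', ?_⟩
  have : z - algebraMap K L (a 0)
      = ∑ l ∈ (Finset.range (p ^ i)).erase 0, algebraMap K L (a l) * y ^ l := by
    rw [hs, ← Finset.add_sum_erase _ _ (Finset.mem_range.2 hl)]; simp
  rw [this]
  refine AddValuation.map_lt_sum w WithTop.coe_ne_top ?_
  intro l' hl'
  rw [Finset.mem_erase, Finset.mem_range] at hl'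
  exact hlt l' hl'.2 hl'.1

theorem gr_term {p : ℕ} [Fact p.Prime] [CharP L p] (σ : L ≃ₐ[K] L)
    {y : L} {q s : ℚ} (hy : w y = (q : WithTop ℚ)) (hs : 0 < s)
    (hσ : w (σ y - y) = ((q + s : ℚ) : WithTop ℚ)) (a : K) (l : ℕ) :
    (w (algebraMap K L a * y ^ l) + (s : WithTop ℚ)
      ≤ w (σ (algebraMap K L a * y ^ l) - algebraMap K L a * y ^ l)) ∧
    (¬ p ∣ l → w (σ (algebraMap K L a * y ^ l) - algebraMap K L a * y ^ l) =
      w (algebraMap K L a * y ^ l) + (s : WithTop ℚ)) := by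
  have hy0 : y ≠ 0 := av_ne_zero w hy
  set ε : L := (σ y - y) / y with hε
  have hwε : w ε = (s : WithTop ℚ) := by
    rw [hε, av_div_eq w hσ hy]; congr 1; ring
  have hσy : σ y = y * (1 + ε) := by rw [hε]; field_simp; ring
  have e1 : σ (algebraMap K L a * y ^ l) - algebraMap K L a * y ^ l
      = (algebraMap K L a * y ^ l) * (((1 + ε) ^ l - 1 - l * ε) + l * ε) := by
    rw [map_mul, map_pow, AlgEquiv.commutes, hσy, mul_pow]; ring
  have h2 := av_binom (p := p) w hs.le hwε.ge l
  rw [e1, AddValuation.map_mul w (algebraMap K L a * y ^ l) (((1 + ε) ^ l - 1 - l * ε) + l * ε)]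
  constructor
  · refine add_le_add le_rfl (AddValuation.map_le_add w (av_mono w h2 (by linarith)) ?_)
    exact av_mono w (av_mul_ge w (av_natCast_ge (p := p) w l) hwε.ge) (by linarith)
  · intro hpl
    congr 1
    have h3 := av_mul_eq w (av_natCast (p := p) w hpl) hwε
    rw [zero_add] at h3
    rw [add_comm]
    exact av_add_eq w h3 h2 (by linarith)

theorem gr_sigma [FiniteDimensional K L] {p : ℕ} [Fact p.Prime] [CharP L p]
    (hK : KInt K w) {i : ℕ} {b : ℤ} (hb : ¬ (p : ℤ) ∣ b)
    {y : L} (hy : w y = ((-(b : ℚ) / p ^ i : ℚ) : WithTop ℚ)) (M : IntermediateField K L)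
    (hyM : y ∈ M) (hM : Module.finrank K M ≤ p ^ i) (σ : L ≃ₐ[K] L) {s : ℚ} (hs : 0 < s)
    (hσ : w (σ y - y) = ((-(b : ℚ) / p ^ i + s : ℚ) : WithTop ℚ)) (z : L) (hz : z ∈ M) {r : ℚ}
    (hr : (r : WithTop ℚ) ≤ w z) : ((r + s : ℚ) : WithTop ℚ) ≤ w (σ z - z) := by
  have hp : p.Prime := Fact.out
  by_cases hz0 : z = 0
  · subst hz0; simp
  obtain ⟨a, l, hl, m, r', -, hsum, hm, hr', hw, hw', hlt⟩ :=
    gr_expand' w hp hK hb hy M hyM hM z hz hz0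
  have hrr := av_le_of_eq w hw hr
  refine av_mono w (s := r' + s) ?_ (by linarith)
  have : σ z - z = ∑ l ∈ Finset.range (p ^ i), (σ (algebraMap K L (a l) * y ^ l)
      - algebraMap K L (a l) * y ^ l) := by
    conv_lhs => rw [hsum]
    rw [map_sum, Finset.sum_sub_distrib]
  rw [this]
  refine AddValuation.map_le_sum w ?_
  intro l' hl'
  refine le_trans ?_ (gr_term (p := p) w σ hy hs hσ (a l') l').1
  rw [WithTop.coe_add]
  refine add_le_add ?_ le_rfl
  by_cases h : l' = l
  · subst h; exact hw'.ge
  · exact (hlt l' (Finset.mem_range.1 hl') h).le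

theorem gr_sigma_eq [FiniteDimensional K L] {p : ℕ} [Fact p.Prime] [CharP L p]
    (hK : KInt K w) {i : ℕ} (hi : 1 ≤ i) {b : ℤ} (hb : ¬ (p : ℤ) ∣ b)
    {y : L} (hy : w y = ((-(b : ℚ) / p ^ i : ℚ) : WithTop ℚ)) (M : IntermediateField K L)
    (hyM : y ∈ M) (hM : Module.finrank K M ≤ p ^ i) (σ : L ≃ₐ[K] L) {s : ℚ} (hs : 0 < s)
    (hσ : w (σ y - y) = ((-(b : ℚ) / p ^ i + s : ℚ) : WithTop ℚ)) (z : L) (hz : z ∈ M) {c : ℤ}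
    (hc : ¬ (p : ℤ) ∣ c) (hwz : w z = ((c / p ^ i : ℚ) : WithTop ℚ)) :
    w (σ z - z) = ((c / p ^ i + s : ℚ) : WithTop ℚ) := by
  have hp : p.Prime := Fact.out
  have hp0 : (p : ℚ) ^ i ≠ 0 := pow_ne_zero _ (by exact_mod_cast hp.ne_zero)
  obtain ⟨a, l, hl, m, r', hal, hsum, hm, hr', hw, hw', hlt⟩ :=
    gr_expand' w hp hK hb hy M hyM hM z hz (av_ne_zero w hwz)
  have hrr := av_eq_of_eq w hw hwz
  have hpl : ¬ p ∣ l := by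
    intro hd
    apply hc
    rw [hr'] at hrr
    field_simp at hrr
    have h2 : (p : ℤ) ^ i * m - l * b = c := by rw [mul_comm]; exact_mod_cast hrr
    rw [← h2]
    refine dvd_sub ((dvd_pow_self _ (by omega)).mul_right _) (Dvd.dvd.mul_right ?_ _)
    exact_mod_cast hd
  have : σ z - z = ∑ l ∈ Finset.range (p ^ i), (σ (algebraMap K L (a l) * y ^ l)
      - algebraMap K L (a l) * y ^ l) := by
    conv_lhs => rw [hsum]
    rw [map_sum, Finset.sum_sub_distrib]
  have hterm := (gr_term (p := p) w σ hy hs hσ (a l) l).2 hpl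
  rw [hw', ← WithTop.coe_add] at hterm
  rw [this, ← Finset.add_sum_erase _ _ (Finset.mem_range.2 hl), ← hrr,
    AddValuation.map_add_eq_of_lt_left, hterm]
  rw [hterm]
  refine AddValuation.map_lt_sum w WithTop.coe_ne_top ?_
  intro l' hl'
  rw [Finset.mem_erase, Finset.mem_range] at hl'
  refine lt_of_lt_of_le ?_ (gr_term (p := p) w σ hy hs hσ (a l') l').1
  rw [WithTop.coe_add]
  exact WithTop.add_lt_add_right WithTop.coe_ne_top (hlt l' hl'.2 hl'.1)

end Graded

set_option linter.unusedSectionVars false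

section WittGen

open WittVector

variable {p : ℕ} [hp : Fact p.Prime] {R : Type*} [CommRing R]

/-- equality of the first `N` components -/
def WEq (N : ℕ) (a b : WittVector p R) : Prop := ∀ j < N, a.coeff j = b.coeff j

theorem weq_iff {N : ℕ} {a b : WittVector p R} :
    WEq N a b ↔ truncate N a = truncate N b := by
  constructor
  · intro h
    ext i
    rw [coeff_truncate, coeff_truncate]
    exact h i i.2
  · intro h j hj
    have := congrArg (fun t => TruncatedWittVector.coeff ⟨j, hj⟩ t) h
    simpa [coeff_truncate] using this

theorem weq_refl (N : ℕ) (a : WittVector p R) : WEq N a a := fun _ _ => rfl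
theorem weq_symm {N : ℕ} {a b : WittVector p R} (h : WEq N a b) : WEq N b a :=
  fun j hj => (h j hj).symm
theorem weq_trans {N : ℕ} {a b c : WittVector p R} (h : WEq N a b) (h' : WEq N b c) : WEq N a c :=
  fun j hj => (h j hj).trans (h' j hj)

theorem weq_add {N : ℕ} {a b c d : WittVector p R} (h : WEq N a b) (h' : WEq N c d) :
    WEq N (a + c) (b + d) := by
  rw [weq_iff] at *; rw [map_add, map_add, h, h']
theorem weq_sub {N : ℕ} {a b c d : WittVector p R} (h : WEq N a b) (h' : WEq N c d) :
    WEq N (a - c) (b - d) := by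
  rw [weq_iff] at *; rw [map_sub, map_sub, h, h']
theorem weq_neg {N : ℕ} {a b : WittVector p R} (h : WEq N a b) :
    WEq N (-a) (-b) := by
  rw [weq_iff] at *; rw [map_neg, map_neg, h]
theorem weq_mul {N : ℕ} {a b c d : WittVector p R} (h : WEq N a b) (h' : WEq N c d) :
    WEq N (a * c) (b * d) := by
  rw [weq_iff] at *; rw [map_mul, map_mul, h, h']
theorem weq_init (N : ℕ) (a : WittVector p R) : WEq N (init N a) a := by
  intro j hj; simp [init, select, hj]
theorem weq_map {S : Type*} [CommRing S] {N : ℕ} {a b : WittVector p R} (g : R →+* S)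
    (h : WEq N a b) : WEq N (map g a) (map g b) := by
  intro j hj; rw [map_coeff, map_coeff, h j hj]

theorem weq_frob [CharP R p] {N : ℕ} {a b : WittVector p R}
    (h : WEq N a b) : WEq N (frobenius a) (frobenius b) := by
  intro j hj; rw [coeff_frobenius_charP, coeff_frobenius_charP, h j hj]

theorem decomp_zero (a : WittVector p R) :
    a = teichmuller p (a.coeff 0) + verschiebung (a.shift 1) := by
  ext j
  rw [coeff_add_of_disjoint]
  · rcases j with _ | j
    · simp
    · rw [teichmuller_coeff_pos _ _ _ (Nat.succ_pos j), verschiebung_coeff_succ, shift_coeff,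
        zero_add, add_comm 1 j]
  · intro j
    rcases j with _ | j
    · right; simp
    · left; exact teichmuller_coeff_pos _ _ _ (Nat.succ_pos j)

theorem frob_teich [CharP R p] (r : R) :
    frobenius (teichmuller p r) = teichmuller p (r ^ p) := by
  rw [frobenius_eq_map_frobenius, map_teichmuller]; rfl

theorem teich_mul_coeff [CharP R p] (r : R) (a : WittVector p R) (j : ℕ) :
    (teichmuller p r * a).coeff j = r ^ p ^ j * a.coeff j := by
  induction j generalizing r a with
  | zero => rw [mul_coeff_zero]; simp
  | succ j ih =>
    have h : teichmuller p r * a = teichmuller p (r * a.coeff 0)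
        + verschiebung (teichmuller p (r ^ p) * a.shift 1) := by
      conv_lhs => rw [decomp_zero a]
      rw [mul_add, ← map_mul, ← frob_teich, mul_comm (WittVector.frobenius _), verschiebung_mul_frobenius,
        mul_comm (teichmuller p r)]
    rw [h, coeff_add_of_disjoint, teichmuller_coeff_pos _ _ _ (Nat.succ_pos j),
      verschiebung_coeff_succ, ih, shift_coeff, zero_add, add_comm 1 j, ← pow_mul, pow_succ']
    intro j
    rcases j with _ | j
    · right; simp
    · left; exact teichmuller_coeff_pos _ _ _ (Nat.succ_pos j)

/-- adding a vector that vanishes below `i` -/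
theorem coeff_add_of_low {i : ℕ} (x z : WittVector p R) (hz : ∀ j < i, z.coeff j = 0) :
    (∀ j < i, (x + z).coeff j = x.coeff j) ∧ (x + z).coeff i = x.coeff i + z.coeff i := by
  have h1 : WEq i (x + z) x := by
    have : WEq i z 0 := fun j hj => by rw [hz j hj, zero_coeff]
    simpa using weq_add (weq_refl i x) this
  refine ⟨h1, ?_⟩
  have ht : tail i x = verschiebung^[i] ((tail i x).shift i) := by
    apply eq_iterate_verschiebung
    intro j hj
    simp [tail, select, hj]
  have hz' := eq_iterate_verschiebung hz
  have e : x + z = init i x + verschiebung^[i] ((tail i x).shift i + z.shift i) := by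
    rw [iterate_map_add, ← ht, ← hz', ← add_assoc, init_add_tail]
  rw [e, coeff_add_of_disjoint]
  · have := iterate_verschiebung_coeff ((tail i x).shift i + z.shift i) i 0
    rw [zero_add] at this
    rw [this, add_coeff_zero, shift_coeff, shift_coeff]
    simp [init, tail, select]
  · intro j
    rcases lt_or_ge j i with h | h
    · right; exact iterate_verschiebung_coeff_eq_zero _ h
    · left; simp [init, select, h]

end WittGen

section Fil
open WittVector

variable {p : ℕ} [hp : Fact p.Prime] {L : Type*} [Field L] (w : AddValuation L (WithTop ℚ))

/-- the valuation ring -/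
def avO : Subring L where
  carrier := {x | 0 ≤ w x}
  mul_mem' := by
    intro a b ha hb
    simp only [Set.mem_ofPred_eq] at *
    rw [AddValuation.map_mul]; exact add_nonneg ha hb
  one_mem' := by simp
  add_mem' := by
    intro a b ha hb
    exact AddValuation.map_le_add w ha hb
  zero_mem' := by simp
  neg_mem' := by
    intro a ha
    simpa [AddValuation.map_neg] using ha

theorem mem_avO {x : L} : x ∈ avO w ↔ 0 ≤ w x := Iff.rfl

/-- integral vectors -/
def WInt (a : WittVector p L) : Prop := ∃ a' : WittVector p (avO w), map (avO w).subtype a' = a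

theorem wint_iff {a : WittVector p L} : WInt w a ↔ ∀ j, 0 ≤ w (a.coeff j) := by
  constructor
  · rintro ⟨a', rfl⟩ j
    rw [map_coeff]; exact (a'.coeff j).2
  · intro h
    refine ⟨WittVector.mk p fun j => ⟨a.coeff j, h j⟩, ?_⟩
    ext j; rw [map_coeff]; rfl

theorem wint_add {a b : WittVector p L} (ha : WInt w a) (hb : WInt w b) : WInt w (a + b) := by
  obtain ⟨a', rfl⟩ := ha; obtain ⟨b', rfl⟩ := hb
  exact ⟨a' + b', map_add _ _ _⟩

theorem wint_neg {a : WittVector p L} (ha : WInt w a) : WInt w (-a) := by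
  obtain ⟨a', rfl⟩ := ha
  exact ⟨-a', map_neg _ _⟩

/-- the filtration -/
def Fil (ρ : ℚ) (N : ℕ) (a : WittVector p L) : Prop :=
  ∀ j < N, ((-ρ * p ^ j : ℚ) : WithTop ℚ) ≤ w (a.coeff j)

theorem fil_weq {ρ : ℚ} {N : ℕ} {a b : WittVector p L} (h : WEq N a b) (ha : Fil w ρ N a) :
    Fil w ρ N b := fun j hj => by rw [← h j hj]; exact ha j hj

theorem fil_mono {ρ ρ' : ℚ} {N : ℕ} {a : WittVector p L} (h : ρ ≤ ρ') (ha : Fil w ρ N a) :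
    Fil w ρ' N a := fun j hj => by
  refine av_mono w (ha j hj) ?_
  have : (0 : ℚ) ≤ (p : ℚ) ^ j := by positivity
  nlinarith

theorem pow_le_cancel {x : L} {m : ℕ} (hm : 0 < m) {r : ℚ}
    (h : ((r : ℚ) : WithTop ℚ) ≤ w (x ^ m)) : ((r / m : ℚ) : WithTop ℚ) ≤ w x := by
  by_cases hx : x = 0
  · subst hx; simp
  obtain ⟨q, hq⟩ := av_exists w hx
  rw [av_pow_eq w hq m] at h
  rw [hq]
  have h2 : r ≤ m * q := WithTop.coe_le_coe.1 h
  refine WithTop.coe_le_coe.2 ?_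
  rw [div_le_iff₀ (by exact_mod_cast hm)]; linarith

variable [CharP L p]

theorem fil_key {t : L} (ht : w t = ((1 : ℚ) : WithTop ℚ)) {ρ : ℚ} {N : ℕ} (m : ℕ)
    {a : WittVector p L} (ha : Fil w ρ N a) :
    ∃ a' : WittVector p L, WInt w a' ∧ WEq N a'
      (teichmuller p (t ^ ⌈ρ * p ^ m⌉) * frobenius^[m] a) := by
  refine ⟨init N (teichmuller p (t ^ ⌈ρ * p ^ m⌉) * frobenius^[m] a), ?_, weq_init _ _⟩
  rw [wint_iff]
  intro j
  by_cases hj : j < N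
  · rw [weq_init N _ j hj, teich_mul_coeff, iterate_frobenius_coeff]
    have h1 : w (t ^ ⌈ρ * p ^ m⌉) = (((⌈ρ * p ^ m⌉ : ℤ) : ℚ) : WithTop ℚ) := by
      rcases Int.eq_nat_or_neg ⌈ρ * p ^ m⌉ with ⟨n, h | h⟩
      · rw [h, zpow_natCast, av_pow_eq w ht]; simp
      · rw [h, zpow_neg, zpow_natCast, av_inv_eq w (av_pow_eq w ht n)]; simp
    have h2 := av_mul_ge w (av_pow_eq w h1 (p ^ j)).ge (av_pow_ge w (ha j hj) (p ^ m))
    refine le_trans ?_ h2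
    rw [← WithTop.coe_zero]
    refine WithTop.coe_le_coe.2 ?_
    have h3 := Int.le_ceil (ρ * (p : ℚ) ^ m)
    have : (0 : ℚ) ≤ (p : ℚ) ^ j := by positivity
    push_cast
    nlinarith
  · simp [init, select, hj]

theorem fil_key' {t : L} (ht : w t = ((1 : ℚ) : WithTop ℚ)) {ρ : ℚ} {N : ℕ}
    {a : WittVector p L} (h : ∀ m : ℕ, ∃ a' : WittVector p L, WInt w a' ∧ WEq N a'
      (teichmuller p (t ^ ⌈ρ * p ^ m⌉) * frobenius^[m] a)) : Fil w ρ N a := by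
  intro j hj
  by_cases h0 : a.coeff j = 0
  · rw [h0]; simp
  obtain ⟨q, hq⟩ := av_exists w h0
  rw [hq]
  refine WithTop.coe_le_coe.2 ?_
  have hp1 : (1 : ℚ) < p := by exact_mod_cast hp.out.one_lt
  have key : ∀ m : ℕ, - ρ * p ^ j - p ^ j * (1 / p) ^ m ≤ q := by
    intro m
    obtain ⟨a', ha', he⟩ := h m
    have h1 : w (t ^ ⌈ρ * p ^ m⌉) = (((⌈ρ * p ^ m⌉ : ℤ) : ℚ) : WithTop ℚ) := by
      rcases Int.eq_nat_or_neg ⌈ρ * p ^ m⌉ with ⟨n, h | h⟩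
      · rw [h, zpow_natCast, av_pow_eq w ht]; simp
      · rw [h, zpow_neg, zpow_natCast, av_inv_eq w (av_pow_eq w ht n)]; simp
    have h2 := (wint_iff w).1 ha' j
    rw [he j hj, teich_mul_coeff, iterate_frobenius_coeff,
      av_mul_eq w (av_pow_eq w h1 (p ^ j)) (av_pow_eq w hq (p ^ m)), ← WithTop.coe_zero] at h2
    have h3 := WithTop.coe_le_coe.1 h2
    have h4 := Int.ceil_lt_add_one (ρ * (p : ℚ) ^ m)
    push_cast at h3
    have hj0 : (0 : ℚ) < (p : ℚ) ^ j := by positivity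
    have hm0 : (0 : ℚ) < (p : ℚ) ^ m := by positivity
    have h5 : 0 ≤ (p : ℚ) ^ j * (ρ * p ^ m + 1) + p ^ m * q := by nlinarith
    rw [div_pow, one_pow]
    have h6 : (-ρ * p ^ j - p ^ j * (1 / (p : ℚ) ^ m)) * p ^ m ≤ q * p ^ m := by
      have : (-ρ * p ^ j - p ^ j * (1 / (p : ℚ) ^ m)) * p ^ m = - ((p : ℚ) ^ j * (ρ * p ^ m + 1)) := by
        field_simp; ring
      rw [this]; linarith
    exact le_of_mul_le_mul_right h6 hm0
  by_contra hlt
  push Not at hlt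
  have hj0 : (0 : ℚ) < (p : ℚ) ^ j := by positivity
  obtain ⟨m, hm⟩ := exists_pow_lt_of_lt_one (y := (1 / p : ℚ))
    (show 0 < (-ρ * p ^ j - q) / p ^ j from div_pos (by linarith) hj0) (by
      rw [div_lt_one (by linarith)]; exact hp1)
  have := key m
  rw [lt_div_iff₀ hj0] at hm
  linarith

theorem fil_add {t : L} (ht : w t = ((1 : ℚ) : WithTop ℚ)) {ρ : ℚ} {N : ℕ}
    {a b : WittVector p L} (ha : Fil w ρ N a) (hb : Fil w ρ N b) : Fil w ρ N (a + b) := by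
  refine fil_key' w ht fun m => ?_
  obtain ⟨a', h1, h2⟩ := fil_key w ht m ha
  obtain ⟨b', h3, h4⟩ := fil_key w ht m hb
  refine ⟨a' + b', wint_add w h1 h3, ?_⟩
  rw [iterate_map_add, mul_add]
  exact weq_add h2 h4

theorem fil_neg {t : L} (ht : w t = ((1 : ℚ) : WithTop ℚ)) {ρ : ℚ} {N : ℕ}
    {a : WittVector p L} (ha : Fil w ρ N a) : Fil w ρ N (-a) := by
  refine fil_key' w ht fun m => ?_
  obtain ⟨a', h1, h2⟩ := fil_key w ht m ha
  refine ⟨-a', wint_neg w h1, ?_⟩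
  rw [iterate_map_neg, mul_neg]
  exact weq_neg h2

theorem fil_sub {t : L} (ht : w t = ((1 : ℚ) : WithTop ℚ)) {ρ : ℚ} {N : ℕ}
    {a b : WittVector p L} (ha : Fil w ρ N a) (hb : Fil w ρ N b) : Fil w ρ N (a - b) := by
  rw [sub_eq_add_neg]; exact fil_add w ht ha (fil_neg w ht hb)

/-- valuation of `[u] - 1` -/
theorem teich_sub_one {u : L} {h : ℚ} (hh : 0 ≤ h) (hu : (h : WithTop ℚ) ≤ w (u - 1)) (k : ℕ) :
    (h : WithTop ℚ) ≤ w ((teichmuller p u - 1).coeff k) := by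
  let I : Ideal (avO w) :=
    { carrier := {x | (h : WithTop ℚ) ≤ w (x : L)}
      add_mem' := by
        intro a b ha hb
        exact AddValuation.map_le_add w ha hb
      zero_mem' := by simp
      smul_mem' := by
        intro c x hx
        have hc : 0 ≤ w (c : L) := c.2
        simp only [Set.mem_ofPred_eq, smul_eq_mul, Subring.coe_mul, AddValuation.map_mul] at *
        exact le_trans hx (le_add_of_nonneg_left hc) }
  have hu0 : 0 ≤ w u := by
    have : u = (u - 1) + 1 := by ring
    rw [this]
    refine AddValuation.map_le_add w (le_trans ?_ hu) (by simp)
    exact_mod_cast hh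
  let u' : avO w := ⟨u, hu0⟩
  have e1 : map (Ideal.Quotient.mk I) (teichmuller p u' - 1) = 0 := by
    rw [map_sub, map_teichmuller, map_one, sub_eq_zero, ← map_one (teichmuller p)]
    congr 1
    rw [← map_one (Ideal.Quotient.mk I), Ideal.Quotient.mk_eq_mk_iff_sub_mem]
    exact hu
  have e2 : map (avO w).subtype (teichmuller p u' - 1) = teichmuller p u - 1 := by
    rw [map_sub, map_teichmuller, map_one]; rfl
  rw [← e2, map_coeff]
  have e3 := congrArg (fun t => t.coeff k) e1
  simp only [map_coeff, zero_coeff] at e3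
  exact Ideal.Quotient.eq_zero_iff_mem.1 e3

end Fil

set_option linter.unusedSectionVars false

section Approx
open WittVector

variable {p : ℕ} [hp : Fact p.Prime] {L : Type*} [Field L] (w : AddValuation L (WithTop ℚ))
  [CharP L p]

theorem fil_versch {ρ : ℚ} {N c : ℕ} {x : WittVector p L}
    (h : ∀ k, k + c < N → ((-ρ * p ^ (k + c) : ℚ) : WithTop ℚ) ≤ w (x.coeff k)) :
    Fil w ρ N (verschiebung^[c] x) := by
  intro j hj
  rcases lt_or_ge j c with hc | hc
  · rw [iterate_verschiebung_coeff_eq_zero _ hc]; simp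
  · obtain ⟨k, rfl⟩ := Nat.exists_eq_add_of_le' hc
    rw [iterate_verschiebung_coeff]; exact h k hj

theorem fil_versch_teich {ρ : ℚ} {N c : ℕ} {z : L}
    (h : ((-ρ * p ^ c : ℚ) : WithTop ℚ) ≤ w z) :
    Fil w ρ N (verschiebung^[c] (teichmuller p z)) := by
  apply fil_versch
  intro k hk
  rcases Nat.eq_zero_or_pos k with rfl | hk0
  · simpa using h
  · rw [teichmuller_coeff_pos _ _ _ hk0]; simp

theorem map_versch_iter (g : L →+* L) (c : ℕ) (x : WittVector p L) :
    map g (verschiebung^[c] x) = verschiebung^[c] (map g x) := by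
  induction c with
  | zero => rfl
  | succ c ih => rw [Function.iterate_succ_apply', Function.iterate_succ_apply', map_verschiebung, ih]

theorem frob_versch_iter (c : ℕ) (x : WittVector p L) :
    WittVector.frobenius (verschiebung^[c] x) = verschiebung^[c] (WittVector.frobenius x) := by
  induction c with
  | zero => rfl
  | succ c ih => rw [Function.iterate_succ_apply', Function.iterate_succ_apply',
      ← verschiebung_frobenius_comm, ih]

/-- the abstract scalar approximation property -/
def ScalarApprox (p : ℕ) {L : Type*} [Field L] (w : AddValuation L (WithTop ℚ)) (g g' : L →+* L)
    (h : ℚ) : Prop :=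
  ∀ α : L, g α = α → α ≠ 0 → ∃ β γ u : L, g γ = γ ∧ g' β = β ∧ w γ = w α ∧
    w α < w (α - γ) ∧ γ = β ^ p * u ∧ (h : WithTop ℚ) ≤ w (u - 1)

theorem map_eq_iff (g : L →+* L) (a : WittVector p L) :
    map g a = a ↔ ∀ j, g (a.coeff j) = a.coeff j := by
  constructor
  · intro h j
    conv_rhs => rw [← h]
    rw [map_coeff]
  · intro h; ext j; rw [map_coeff, h]

theorem witt_approx {t : L} (ht : w t = ((1 : ℚ) : WithTop ℚ)) (g g' : L →+* L) (N D : ℕ)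
    (hD : 0 < D) (hdisc : ∀ z, g z = z → z ≠ 0 → ∃ m : ℤ, w z = ((m / D : ℚ) : WithTop ℚ))
    {h : ℚ} (hh : 0 < h) (hS : ScalarApprox p w g g' h) (ρ : ℚ) (a : WittVector p L)
    (hga : map g a = a) (ha : Fil w ρ N a) :
    ∃ u : WittVector p L, map g' u = u ∧ Fil w (ρ / p) N u ∧
      Fil w (ρ - h / p ^ (N - 1)) N (a - WittVector.frobenius u) := by
  have hp0 : (0 : ℚ) < p := by exact_mod_cast hp.out.pos
  set ρ' := ρ - h / p ^ (N - 1) with hrho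
  -- outer induction
  suffices H : ∀ r c, c + r = N → ∀ a : WittVector p L, map g a = a → Fil w ρ N a →
      (∀ j < c, a.coeff j = 0) →
      ∃ u : WittVector p L, map g' u = u ∧ Fil w (ρ / p) N u ∧
      Fil w ρ' N (a - WittVector.frobenius u) from
    H N 0 (by simp) a hga ha (by simp)
  intro r
  induction r with
  | zero =>
    intro c hc a hga ha ha0
    refine ⟨0, map_zero _, fun j hj => by simp, fun j hj => ?_⟩
    rw [map_zero, sub_zero, ha0 j (by omega)]; simp
  | succ r ih =>
    intro c hc a hga ha ha0
    have hcN : c < N := by omega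
    -- inner base
    have base : ∀ a : WittVector p L, map g a = a → Fil w ρ N a →
      (∀ j < c, a.coeff j = 0) → ((-ρ' * p ^ c : ℚ) : WithTop ℚ) ≤ w (a.coeff c) →
      ∃ u : WittVector p L, map g' u = u ∧ Fil w (ρ / p) N u ∧
      Fil w ρ' N (a - WittVector.frobenius u) := by
      intro a hga ha ha0 hac
      have e1 : map g (a - verschiebung^[c] (teichmuller p (a.coeff c)))
          = a - verschiebung^[c] (teichmuller p (a.coeff c)) := by
        rw [map_sub, hga, map_versch_iter, map_teichmuller, (map_eq_iff g a).1 hga]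
      have hz : ∀ j < c, (-verschiebung^[c] (teichmuller p (a.coeff c))).coeff j = 0 := by
        have : WEq c (-verschiebung^[c] (teichmuller p (a.coeff c))) (-0) :=
          weq_neg fun j hj => by rw [iterate_verschiebung_coeff_eq_zero _ hj, zero_coeff]
        intro j hj
        rw [this j hj]; simp
      have hz' : ∀ j < c + 1, (a - verschiebung^[c] (teichmuller p (a.coeff c))).coeff j = 0 := by
        rw [← le_coeff_eq_iff_le_sub_coeff_eq_zero]
        intro j hj
        rcases Nat.lt_succ_iff_lt_or_eq.1 hj with hj | rfl
        · rw [ha0 j hj, iterate_verschiebung_coeff_eq_zero _ hj]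
        · have := iterate_verschiebung_coeff (teichmuller p (a.coeff j)) j 0
          rw [zero_add] at this
          rw [this, teichmuller_coeff_zero]
      obtain ⟨u, hu1, hu2, hu3⟩ := ih (c + 1) (by omega) _ e1
        (fil_sub w ht ha (fil_versch_teich w (ha c hcN))) hz'
      refine ⟨u, hu1, hu2, ?_⟩
      have := fil_add w ht hu3 (fil_versch_teich w (N := N) hac)
      convert this using 1
      ring
    -- inner induction
    have inner : ∀ d : ℕ, ∀ a : WittVector p L, map g a = a → Fil w ρ N a →
      (∀ j < c, a.coeff j = 0) → ((-ρ' * p ^ c - d / D : ℚ) : WithTop ℚ) ≤ w (a.coeff c) →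
      ∃ u : WittVector p L, map g' u = u ∧ Fil w (ρ / p) N u ∧
      Fil w ρ' N (a - WittVector.frobenius u) := by
      intro d
      induction d with
      | zero =>
        intro a hga ha ha0 hac
        exact base a hga ha ha0 (by simpa using hac)
      | succ d ihd =>
        intro a hga ha ha0 hac
        by_cases hc0 : a.coeff c = 0
        · exact base a hga ha ha0 (by rw [hc0]; simp)
        have hgc := (map_eq_iff g a).1 hga c
        obtain ⟨β, γ, u, hγ, hβ, hwγ, hlt, hγβ, hu⟩ := hS (a.coeff c) hgc hc0
        have hwγ' : ((-ρ * p ^ c : ℚ) : WithTop ℚ) ≤ w γ := by rw [hwγ]; exact ha c hcN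
        have hfil : Fil w ρ N (verschiebung^[c] (teichmuller p γ)) := fil_versch_teich w hwγ'
        obtain ⟨q, hq⟩ := av_exists w hc0
        have hγq : w γ = (q : WithTop ℚ) := hwγ.trans hq
        have hq1 := av_le_of_eq w hq (ha c hcN)
        -- u is a unit
        have hwu : w u = ((0 : ℚ) : WithTop ℚ) := by
          have : u = 1 + (u - 1) := by ring
          rw [this]
          exact av_add_eq w (by simp) hu hh
        have hγ0 : γ ≠ 0 := av_ne_zero w hγq
        have hβ0 : β ≠ 0 := by
          rintro rfl
          rw [zero_pow hp.out.ne_zero, zero_mul] at hγβ; exact hγ0 hγβ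
        obtain ⟨b, hb⟩ := av_exists w hβ0
        have hbq : p * b = q := by
          have := av_mul_eq w (av_pow_eq w hb p) hwu
          rw [← hγβ] at this
          have := av_eq_of_eq w this hγq
          linarith
        have hfilβ : Fil w (ρ / p) N (verschiebung^[c] (teichmuller p β)) := by
          apply fil_versch_teich
          rw [hb]
          refine WithTop.coe_le_coe.2 ?_
          have : -(ρ / p) * (p : ℚ) ^ c = (-ρ * p ^ c) / p := by ring
          rw [this, div_le_iff₀ hp0]; linarith
        set a' := a - verschiebung^[c] (teichmuller p γ) with ha'
        have e1 : map g a' = a' := by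
          rw [ha', map_sub, hga, map_versch_iter, map_teichmuller, hγ]
        have hz : ∀ j < c, (-verschiebung^[c] (teichmuller p γ)).coeff j = 0 := by
          have : WEq c (-verschiebung^[c] (teichmuller p γ)) (-0) :=
            weq_neg fun j hj => by rw [iterate_verschiebung_coeff_eq_zero _ hj, zero_coeff]
          intro j hj
          rw [this j hj]; simp
        have hneg : -verschiebung^[c] (teichmuller p γ)
            = verschiebung^[c] (-teichmuller p γ) := by
          rw [iterate_map_neg]
        have hnc : (-verschiebung^[c] (teichmuller p γ)).coeff c = -γ := by
          have := iterate_verschiebung_coeff (-teichmuller p γ) c 0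
          rw [zero_add] at this
          rw [hneg, this]
          have h2 := add_coeff_zero (teichmuller p γ) (-teichmuller p γ)
          rw [add_neg_cancel, zero_coeff, teichmuller_coeff_zero] at h2
          linear_combination -h2
        obtain ⟨hl1, hl2⟩ := coeff_add_of_low a _ hz
        rw [← sub_eq_add_neg, ← ha'] at hl1 hl2
        rw [hnc, ← sub_eq_add_neg] at hl2
        obtain ⟨v, hv1, hv2, hv3⟩ := ihd a' e1 (fil_sub w ht ha hfil)
          (fun j hj => by rw [hl1 j hj, ha0 j hj]) (by
            rw [hl2]
            by_cases hd0 : a.coeff c - γ = 0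
            · rw [hd0]; simp
            have hg2 : g (a.coeff c - γ) = a.coeff c - γ := by rw [map_sub, hgc, hγ]
            obtain ⟨m, hm⟩ := hdisc _ hg2 hd0
            obtain ⟨m', hm'⟩ := hdisc _ hgc hc0
            rw [hm, hm'] at hlt
            have hlt' : (m' / D : ℚ) < m / D := WithTop.coe_lt_coe.1 hlt
            have hD' : (0 : ℚ) < D := by exact_mod_cast hD
            rw [div_lt_div_iff_of_pos_right hD'] at hlt'
            have hmm : m' + 1 ≤ m := by exact_mod_cast hlt'
            rw [hm'] at hac
            have hac' := WithTop.coe_le_coe.1 hac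
            rw [hm]
            refine WithTop.coe_le_coe.2 ?_
            have h4 : ((m' : ℚ) + 1) / D ≤ m / D := by
              rw [div_le_div_iff_of_pos_right hD']; exact_mod_cast hmm
            rw [add_div] at h4
            push_cast at hac'
            rw [add_div] at hac'
            linarith)
        refine ⟨v + verschiebung^[c] (teichmuller p β), ?_, fil_add w ht hv2 hfilβ, ?_⟩
        · rw [map_add, hv1, map_versch_iter, map_teichmuller, hβ]
        · have e3 : a - WittVector.frobenius (v + verschiebung^[c] (teichmuller p β))
              = (a' - WittVector.frobenius v)
                + verschiebung^[c] (teichmuller p (β ^ p) * (teichmuller p u - 1)) := by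
            rw [mul_sub, mul_one, ← map_mul, ← hγβ, iterate_map_sub, map_add, frob_versch_iter,
              frob_teich, ha']
            ring
          rw [e3]
          refine fil_add w ht hv3 (fil_versch w ?_)
          intro k hk
          rw [teich_mul_coeff]
          have h5 := av_mul_ge w (av_pow_eq w (av_pow_eq w hb p) (p ^ k)).ge
            (teich_sub_one (p := p) w hh.le hu k)
          refine av_mono w h5 ?_
          rw [hbq, hrho]
          push_cast
          have hk0 : (0 : ℚ) < (p : ℚ) ^ k := by positivity
          have h6 : -(ρ - h / (p : ℚ) ^ (N - 1)) * p ^ (k + c)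
              = p ^ k * (-ρ * p ^ c) + h * (p ^ (k + c) / p ^ (N - 1)) := by
            rw [pow_add]; ring
          rw [h6]
          have h7 : (p : ℚ) ^ (k + c) / p ^ (N - 1) ≤ 1 := by
            rw [div_le_one (by positivity)]
            exact pow_le_pow_right₀ (by exact_mod_cast hp.out.one_le) (by omega)
          nlinarith
    -- conclude
    obtain ⟨d, hd⟩ := exists_nat_ge (((-ρ' * p ^ c) - (-ρ * p ^ c)) * D)
    refine inner d a hga ha ha0 (av_mono w (ha c hcN) ?_)
    have hD' : (0 : ℚ) < D := by exact_mod_cast hD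
    have := (le_div_iff₀ hD').2 hd
    linarith

end Approx

set_option linter.unusedSectionVars false

section Numbers

/-- `bs p m i` is the break `b_{i+1}` -/
def bs (p m : ℕ) : ℕ → ℤ
  | 0 => m
  | i + 1 => bs p m i + ((p : ℤ) ^ (2 * i + 2) - (p : ℤ) ^ (2 * i + 1)) * m

/-- accumulated loss -/
def sg (p m : ℕ) (i : ℕ) : ℚ := ∑ j ∈ Finset.range i, ((p : ℚ) - 1) * ((bs p m j : ℚ) / p ^ (j + 1))

theorem sg_zero (p m : ℕ) : sg p m 0 = 0 := by simp [sg]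
theorem sg_succ (p m i : ℕ) : sg p m (i + 1) = sg p m i + ((p : ℚ) - 1) * ((bs p m i : ℚ) / p ^ (i + 1)) := by
  rw [sg, Finset.sum_range_succ]; rfl

variable {p m : ℕ}

theorem bs_closed (p m : ℕ) (i : ℕ) : ((p : ℤ) + 1) * bs p m i = m * ((p : ℤ) ^ (2 * i + 1) + 1) := by
  induction i with
  | zero => simp [bs]; ring
  | succ i ih => rw [bs, mul_add, ih]; ring

theorem bs_lt_succ (hp : p.Prime) (hm : 0 < m) (i : ℕ) : bs p m i < bs p m (i + 1) := by
  rw [bs]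
  have h1 : (p : ℤ) ^ (2 * i + 1) < (p : ℤ) ^ (2 * i + 2) :=
    pow_lt_pow_right₀ (by exact_mod_cast hp.one_lt) (by omega)
  have h2 : (0 : ℤ) < m := by exact_mod_cast hm
  nlinarith

theorem bs_strictMono (hp : p.Prime) (hm : 0 < m) : StrictMono (bs p m) := strictMono_nat_of_lt_succ (bs_lt_succ hp hm)

theorem bs_pos (hp : p.Prime) (hm : 0 < m) (i : ℕ) : 0 < bs p m i := by
  have := (bs_strictMono hp hm).monotone (Nat.zero_le i)
  have h : bs p m 0 = m := rfl
  have h2 : (0 : ℤ) < m := by exact_mod_cast hm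
  linarith

theorem bs_mod (hpm : ¬ p ∣ m) (i : ℕ) : ¬ (p : ℤ) ∣ bs p m i := by
  intro h
  apply hpm
  have h2 := bs_closed p m i
  have h3 : (p : ℤ) ∣ m * ((p : ℤ) ^ (2 * i + 1) + 1) := by rw [← h2]; exact h.mul_left _
  rw [mul_add, mul_one] at h3
  have h4 : (p : ℤ) ∣ m * (p : ℤ) ^ (2 * i + 1) := (dvd_pow_self _ (by omega)).mul_left _
  exact_mod_cast (dvd_add_right h4).1 h3

theorem bs_id1 (hp : p.Prime) (i : ℕ) : (bs p m i : ℚ) / p ^ i + sg p m i = p ^ i * m := by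
  have hp0 : (p : ℚ) ≠ 0 := by exact_mod_cast hp.ne_zero
  induction i with
  | zero => simp [bs, sg_zero]
  | succ i ih =>
    rw [sg_succ, bs]; push_cast
    have : (p : ℚ) ^ (i + 1) * m = p ^ i * m + (p ^ (i + 1) - p ^ i) * m := by ring
    rw [this, ← ih]
    field_simp; ring

theorem bs_id2 (hp : p.Prime) (i : ℕ) : (bs p m i : ℚ) / p ^ (i + 1) = m / p ^ (i + 1) + sg p m i := by
  have hp0 : (p : ℚ) ≠ 0 := by exact_mod_cast hp.ne_zero
  have h1 := bs_id1 (m := m) hp i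
  have h2 : ((p : ℚ) + 1) * bs p m i = m * ((p : ℚ) ^ (2 * i + 1) + 1) := by
    exact_mod_cast bs_closed p m i
  have h3 : sg p m i = p ^ i * m - (bs p m i : ℚ) / p ^ i := by linarith
  rw [h3]
  have hpi : (p : ℚ) ^ i ≠ 0 := pow_ne_zero _ hp0
  rw [pow_succ]
  field_simp
  linear_combination h2

theorem sg_nonneg (hp : p.Prime) (hm : 0 < m) (i : ℕ) : 0 ≤ sg p m i := by
  refine Finset.sum_nonneg fun j _ => ?_
  have h1 : (1 : ℚ) ≤ p := by exact_mod_cast hp.one_le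
  have h2 : (0 : ℚ) < bs p m j := by exact_mod_cast bs_pos hp hm j
  exact mul_nonneg (by linarith) (by positivity)

theorem sg_pos (hp : p.Prime) (hm : 0 < m) (i : ℕ) : 0 < sg p m (i + 1) := by
  rw [sg_succ]
  have h1 : (1 : ℚ) < p := by exact_mod_cast hp.one_lt
  have h2 : (0 : ℚ) < bs p m i := by exact_mod_cast bs_pos hp hm i
  have h3 := sg_nonneg hp hm i
  have : 0 < ((p : ℚ) - 1) * ((bs p m i : ℚ) / p ^ (i + 1)) := mul_pos (by linarith) (by positivity)
  linarith

end Numbers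

section Stage
open WittVector

/-- fixed field of `τ^(p^i)` -/
def Fx (p : ℕ) {K L : Type*} [Field K] [Field L] [Algebra K L] (τ : L ≃ₐ[K] L) (i : ℕ) :
    IntermediateField K L := IntermediateField.fixedField (Subgroup.zpowers (τ ^ p ^ i))

theorem mem_Fx {p : ℕ} {K L : Type*} [Field K] [Field L] [Algebra K L] {τ : L ≃ₐ[K] L} {i : ℕ}
    {z : L} : z ∈ Fx p τ i ↔ (τ ^ p ^ i) z = z := by
  rw [Fx, IntermediateField.mem_fixedField_iff]
  constructor
  · intro h; exact h _ (Subgroup.mem_zpowers _)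
  · intro h f hf
    have h1 : τ ^ p ^ i ∈ MulAction.stabilizer (L ≃ₐ[K] L) z := h
    exact (Subgroup.zpowers_le.2 h1) hf

/-- all the data -/
structure TW (p : ℕ) [Fact p.Prime] {K L : Type*} [Field K] [Field L] [Algebra K L]
    (w : AddValuation L (WithTop ℚ)) (τ : L ≃ₐ[K] L) (n m0 : ℕ) (a0 : K)
    (X c : WittVector p L) : Prop where
  kint : KInt K w
  unif : ∃ t : K, w (algebraMap K L t) = ((1 : ℚ) : WithTop ℚ)
  perf : ∀ a : K, w (algebraMap K L a) = ((0 : ℚ) : WithTop ℚ) →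
    ∃ κ : K, w (algebraMap K L κ) = ((0 : ℚ) : WithTop ℚ) ∧
      ((0 : ℚ) : WithTop ℚ) < w (algebraMap K L a - algebraMap K L κ ^ p)
  fr : ∀ i ≤ n, Module.finrank K (Fx p τ i) ≤ p ^ i
  m0pos : 0 < m0
  hpm : ¬ p ∣ m0
  wa0 : w (algebraMap K L a0) = ((-(m0 : ℚ) : ℚ) : WithTop ℚ)
  relX : WEq n (WittVector.frobenius X) (X + teichmuller p (algebraMap K L a0))
  relτ : WEq n (map (τ : L →+* L) X) (X + c)
  cfix : map (τ : L →+* L) c = c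
  cp : ∀ j, c.coeff j ^ p = c.coeff j
  c0 : c.coeff 0 ≠ 0

/-- stage `i` -/
def Stage (p : ℕ) {K L : Type*} [Field K] [Field L] [Algebra K L]
    (w : AddValuation L (WithTop ℚ)) (τ : L ≃ₐ[K] L) (m0 : ℕ) (i : ℕ) (y : L) : Prop :=
  y ∈ Fx p τ (i + 1) ∧ w y = ((-(bs p m0 i : ℚ) / p ^ (i + 1) : ℚ) : WithTop ℚ) ∧
  y ^ p - y ∈ Fx p τ i ∧ ∀ j ≤ i, ∀ q : ℕ, ¬ p ∣ q →
    w ((τ ^ (p ^ j * q)) y - y)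
      = ((-(bs p m0 i : ℚ) / p ^ (i + 1) + (bs p m0 j : ℚ) / p ^ (i + 1) : ℚ) : WithTop ℚ)

variable {p : ℕ} [hp : Fact p.Prime] {K L : Type*} [Field K] [Field L] [Algebra K L]
  [FiniteDimensional K L] [CharP L p]
  {w : AddValuation L (WithTop ℚ)} {τ : L ≃ₐ[K] L} {n m0 : ℕ} {a0 : K} {X c : WittVector p L}

theorem stage_wA (T : TW p w τ n m0 a0 X c) {i : ℕ} {y : L} (hy : Stage p w τ m0 i y) :
    w (y ^ p - y) = ((-(bs p m0 i : ℚ) / p ^ i : ℚ) : WithTop ℚ) := by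
  have h2 : (0 : ℚ) < bs p m0 i := by exact_mod_cast bs_pos hp.out T.m0pos i
  have hp0 : (0 : ℚ) < p := by exact_mod_cast hp.out.pos
  have := av_as_of_neg w hp.out (q := -(bs p m0 i : ℚ) / p ^ (i + 1))
    (by rw [neg_div]; exact neg_neg_of_pos (by positivity)) hy.2.1
  rw [this]; congr 1; field_simp; ring

theorem scalar_approx (T : TW p w τ n m0 a0 X c) {i : ℕ} (hi : i ≤ n) {y : L}
    (hy : Stage p w τ m0 i y) :
    ScalarApprox p w ((τ ^ p ^ i : L ≃ₐ[K] L) : L →+* L) ((τ ^ p ^ (i + 1) : L ≃ₐ[K] L) : L →+* L)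
      (((p : ℚ) - 1) * ((bs p m0 i : ℚ) / p ^ (i + 1))) := by
  intro α hα hα0
  have hα' : α ∈ Fx p τ i := mem_Fx.2 hα
  have hp0 : (p : ℚ) ≠ 0 := by exact_mod_cast hp.out.ne_zero
  have hp1 : (1 : ℚ) ≤ p := by exact_mod_cast hp.out.one_le
  have hbpos : (0 : ℚ) < bs p m0 i := by exact_mod_cast bs_pos hp.out T.m0pos i
  have hb := bs_mod T.hpm i
  have hwA := stage_wA T hy
  obtain ⟨hy1, hy2, hy3, -⟩ := hy
  set A := y ^ p - y with hA
  set b := bs p m0 i with hbdef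
  have hA0 := av_ne_zero w hwA
  have hy0 := av_ne_zero w hy2
  obtain ⟨m, hm⟩ := gr_disc w hp.out T.kint hb hwA _ hy3 (T.fr i hi) α hα' hα0
  obtain ⟨t, ht⟩ := T.unif
  have ht0 : algebraMap K L t ≠ 0 := av_ne_zero w ht
  -- solve the congruence
  obtain ⟨l, k, hlk⟩ : ∃ l : ℕ, ∃ k : ℤ, (p : ℤ) ^ (i + 1) * k - l * b = m := by
    have hcop : IsCoprime b ((p : ℤ) ^ (i + 1)) := by
      refine IsCoprime.pow_right ?_
      exact ((Nat.prime_iff_prime_int.1 hp.out).coprime_iff_not_dvd.2 hb).symm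
    obtain ⟨u, v, huv⟩ := hcop
    have hP : (0 : ℤ) < (p : ℤ) ^ (i + 1) := by have := hp.out.pos; positivity
    refine ⟨((-m * u) % (p : ℤ) ^ (i + 1)).toNat, v * m - ((-m * u) / (p : ℤ) ^ (i + 1)) * b, ?_⟩
    rw [Int.toNat_of_nonneg (Int.emod_nonneg _ hP.ne')]
    have := Int.emod_add_mul_ediv (-m * u) ((p : ℤ) ^ (i + 1))
    linear_combination m * huv - b * this
  have hwtk : w (algebraMap K L (t ^ k)) = ((k : ℚ) : WithTop ℚ) := by
    rw [map_zpow₀]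
    rcases Int.eq_nat_or_neg k with ⟨n, h | h⟩
    · rw [h, zpow_natCast, av_pow_eq w ht]; simp
    · rw [h, zpow_neg, zpow_natCast, av_inv_eq w (av_pow_eq w ht n)]; simp
  have hwE : w (algebraMap K L (t ^ k) ^ p * A ^ l) = ((m / p ^ i : ℚ) : WithTop ℚ) := by
    rw [av_mul_eq w (av_pow_eq w hwtk p) (av_pow_eq w hwA l)]
    congr 1
    have : (m : ℚ) = (p : ℚ) ^ (i + 1) * k - l * b := by exact_mod_cast hlk.symm
    rw [this]; field_simp; ring
  set E := algebraMap K L (t ^ k) ^ p * A ^ l with hE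
  have hE0 := av_ne_zero w hwE
  have hEM : E ∈ Fx p τ i :=
    mul_mem (pow_mem (IntermediateField.algebraMap_mem _ _) _) (pow_mem hy3 _)
  have hR : w (α / E) = ((0 : ℚ) : WithTop ℚ) := by
    rw [av_div_eq w hm hwE, sub_self]
  obtain ⟨a, ha1, ha2⟩ := gr_res w hp.out T.kint hb hwA _ hy3 (T.fr i hi) (α / E)
    (div_mem hα' hEM) hR
  obtain ⟨κ, hκ1, hκ2⟩ := T.perf a ha1
  refine ⟨algebraMap K L (t ^ k * κ) * y ^ l, E * algebraMap K L κ ^ p, (A / y ^ p) ^ l,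
    ?_, ?_, ?_, ?_, ?_, ?_⟩
  · exact mem_Fx.1 (mul_mem hEM (pow_mem (IntermediateField.algebraMap_mem _ _) _))
  · exact mem_Fx.1 (mul_mem (IntermediateField.algebraMap_mem _ _) (pow_mem hy1 _))
  · rw [av_mul_eq w hwE (av_pow_eq w hκ1 p), hm]; simp
  · have e1 : α - E * algebraMap K L κ ^ p
        = E * ((α / E - algebraMap K L a) + (algebraMap K L a - algebraMap K L κ ^ p)) := by
      field_simp; ring
    rw [e1, AddValuation.map_mul, hwE, hm]
    have := AddValuation.map_lt_add w ha2 hκ2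
    calc ((m / p ^ i : ℚ) : WithTop ℚ) = ((m / p ^ i : ℚ) : WithTop ℚ) + ((0 : ℚ) : WithTop ℚ) := by simp
      _ < _ := WithTop.add_lt_add_left WithTop.coe_ne_top this
  · rw [hE, map_mul, div_pow]; field_simp; ring
  · have hε : w (-(y / y ^ p)) = ((((p : ℚ) - 1) * ((b : ℚ) / p ^ (i + 1)) : ℚ) : WithTop ℚ) := by
      rw [AddValuation.map_neg, av_div_eq w hy2 (av_pow_eq w hy2 p)]
      congr 1; ring
    have e2 : A / y ^ p = 1 + (-(y / y ^ p)) := by rw [hA]; field_simp; ring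
    have hs : (0 : ℚ) ≤ ((p : ℚ) - 1) * ((b : ℚ) / p ^ (i + 1)) :=
      mul_nonneg (by linarith) (by positivity)
    have h2 := av_binom (p := p) w hs hε.ge l
    rw [e2]
    set ε := -(y / y ^ p)
    have e3 : (1 + ε) ^ l - 1 = ((1 + ε) ^ l - 1 - l * ε) + l * ε := by ring
    rw [e3]
    refine AddValuation.map_le_add w (av_mono w h2 (by linarith)) ?_
    exact av_mono w (av_mul_ge w (av_natCast_ge (p := p) w l) hε.ge) (by linarith)

end Stage

set_option linter.unusedSectionVars false

section StageStep
open WittVector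

variable {p : ℕ} [hp : Fact p.Prime] {K L : Type*} [Field K] [Field L] [Algebra K L]
  [FiniteDimensional K L] [CharP L p]
  {w : AddValuation L (WithTop ℚ)} {τ : L ≃ₐ[K] L} {n m0 : ℕ} {a0 : K} {X c : WittVector p L}

theorem fix_mono {j : ℕ} {z : L} (h : (τ ^ p ^ j) z = z) : (τ ^ p ^ (j + 1)) z = z := by
  have h1 : τ ^ p ^ j ∈ MulAction.stabilizer (L ≃ₐ[K] L) z := h
  have h2 := pow_mem h1 p
  rw [← pow_mul, ← pow_succ] at h2
  exact h2

theorem map_fix_mono {j : ℕ} {a : WittVector p L}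
    (h : map ((τ ^ p ^ j : L ≃ₐ[K] L) : L →+* L) a = a) :
    map ((τ ^ p ^ (j + 1) : L ≃ₐ[K] L) : L →+* L) a = a := by
  rw [map_eq_iff] at *
  intro k
  exact fix_mono (h k)

theorem map_frob (g : L →+* L) (u : WittVector p L) :
    map g (WittVector.frobenius u) = WittVector.frobenius (map g u) := by
  ext k
  rw [map_coeff, coeff_frobenius_charP, coeff_frobenius_charP, map_coeff, map_pow]

theorem iter_approx (T : TW p w τ n m0 a0 X c) {i : ℕ} (hin : i + 1 ≤ n)
    (hst : ∀ j < i, ∃ y, Stage p w τ m0 j y) : ∀ j ≤ i, ∃ U a : WittVector p L,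
      map ((τ ^ p ^ j : L ≃ₐ[K] L) : L →+* L) U = U ∧
      map ((τ ^ p ^ j : L ≃ₐ[K] L) : L →+* L) a = a ∧
      a = teichmuller p (algebraMap K L a0) - WittVector.frobenius U + U ∧
      Fil w ((p ^ i * m0 - sg p m0 j) / p ^ i) (i + 1) a := by
  have hp0 : (0 : ℚ) < p := by exact_mod_cast hp.out.pos
  have hp1 : (1 : ℚ) < p := by exact_mod_cast hp.out.one_lt
  obtain ⟨t, ht⟩ := T.unif
  intro j
  induction j with
  | zero =>
    intro _
    refine ⟨0, teichmuller p (algebraMap K L a0), map_zero _, ?_, by simp, ?_⟩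
    · rw [map_teichmuller]; congr 1
      exact AlgEquiv.commutes _ _
    · have : ((p : ℚ) ^ i * m0 - sg p m0 0) / p ^ i = m0 := by rw [sg_zero]; field_simp; ring
      rw [this]
      have := fil_versch_teich (p := p) w (ρ := m0) (N := i + 1) (c := 0) (z := algebraMap K L a0)
        (by rw [T.wa0]; simp)
      simpa using this
  | succ j ih =>
    intro hj
    obtain ⟨U, a, hU, ha, hrel, hfil⟩ := ih (by omega)
    obtain ⟨y, hy⟩ := hst j (by omega)
    have hbpos : (0 : ℚ) < bs p m0 j := by exact_mod_cast bs_pos hp.out T.m0pos j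
    have hh : 0 < ((p : ℚ) - 1) * ((bs p m0 j : ℚ) / p ^ (j + 1)) :=
      mul_pos (by linarith) (by positivity)
    have hdisc : ∀ z, ((τ ^ p ^ j : L ≃ₐ[K] L) : L →+* L) z = z → z ≠ 0 →
        ∃ m : ℤ, w z = ((m / (p ^ j : ℕ) : ℚ) : WithTop ℚ) := by
      intro z hz hz0
      have := gr_disc w hp.out T.kint (bs_mod T.hpm j) (stage_wA T hy) _ hy.2.2.1
        (T.fr j (by omega)) z (mem_Fx.2 hz) hz0
      simpa using this
    obtain ⟨u, hu1, hu2, hu3⟩ := witt_approx w ht _ _ (i + 1) (p ^ j) (pow_pos hp.out.pos j) hdisc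
      hh (scalar_approx T (by omega) hy) _ a ha hfil
    have hrho : ((p : ℚ) ^ i * m0 - sg p m0 j) / p ^ i
        - ((p : ℚ) - 1) * ((bs p m0 j : ℚ) / p ^ (j + 1)) / p ^ (i + 1 - 1)
        = ((p : ℚ) ^ i * m0 - sg p m0 (j + 1)) / p ^ i := by
      rw [sg_succ, Nat.add_sub_cancel]; ring
    rw [hrho] at hu3
    have hle : ((p : ℚ) ^ i * m0 - sg p m0 j) / p ^ i / p
        ≤ ((p : ℚ) ^ i * m0 - sg p m0 (j + 1)) / p ^ i := by
      rw [div_right_comm, div_le_div_iff_of_pos_right (by positivity), div_le_iff₀ hp0, sg_succ]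
      have h1 := bs_id1 (m := m0) hp.out j
      have h2 : (p : ℚ) ^ j * m0 ≤ p ^ i * m0 := by
        have : (p : ℚ) ^ j ≤ p ^ i := pow_le_pow_right₀ hp1.le (by omega)
        exact mul_le_mul_of_nonneg_right this (by positivity)
      have h3 : (bs p m0 j : ℚ) / p ^ (j + 1) * p = bs p m0 j / p ^ j := by
        rw [pow_succ]; field_simp
      have h4 : (bs p m0 j : ℚ) / p ^ j ≤ p ^ i * m0 - sg p m0 j := by linarith
      have h5 : ((p : ℚ) - 1) * (bs p m0 j / p ^ j) ≤ (p - 1) * (p ^ i * m0 - sg p m0 j) :=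
        mul_le_mul_of_nonneg_left h4 (by linarith)
      calc (p : ℚ) ^ i * m0 - sg p m0 j
          = p * (p ^ i * m0 - sg p m0 j) - (p - 1) * (p ^ i * m0 - sg p m0 j) := by ring
        _ ≤ p * (p ^ i * m0 - sg p m0 j) - (p - 1) * (bs p m0 j / p ^ j) := by linarith
        _ = _ := by rw [← h3]; ring
    refine ⟨U + u, a - WittVector.frobenius u + u, ?_, ?_, ?_,
      fil_add w ht hu3 (fil_mono w hle hu2)⟩
    · rw [map_add, map_fix_mono hU, hu1]
    · rw [map_add, map_sub, map_fix_mono ha, hu1]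
      congr 2
      rw [map_frob, hu1]
    · rw [hrel, map_add]; ring

/-- iterating the action -/
theorem act_pow (T : TW p w τ n m0 a0 X c) (m : ℕ) :
    WEq n (map ((τ ^ m : L ≃ₐ[K] L) : L →+* L) X) (X + m • c) := by
  induction m with
  | zero =>
    have : map ((τ ^ 0 : L ≃ₐ[K] L) : L →+* L) X = X := by
      ext j; rw [map_coeff]; simp
    rw [this]; simpa using weq_refl n X
  | succ m ih =>
    have e : map ((τ ^ (m + 1) : L ≃ₐ[K] L) : L →+* L) X
        = map (τ : L →+* L) (map ((τ ^ m : L ≃ₐ[K] L) : L →+* L) X) := by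
      ext j; rw [map_coeff, map_coeff, map_coeff, pow_succ']; rfl
    rw [e]
    refine weq_trans (weq_map _ ih) ?_
    rw [map_add, map_nsmul, T.cfix, succ_nsmul', ← add_assoc]
    exact weq_add T.relτ (weq_refl _ _)

theorem fil_exists (ρ : ℚ) (hρ : 0 < ρ) (N : ℕ) (x : WittVector p L) :
    ∃ k : ℕ, Fil w (ρ * p ^ k) N x := by
  have hp1 : (1 : ℚ) < p := by exact_mod_cast hp.out.one_lt
  induction N with
  | zero => exact ⟨0, fun j hj => absurd hj (by omega)⟩
  | succ N ih =>
    obtain ⟨k, hk⟩ := ih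
    obtain ⟨k', hk'⟩ : ∃ k' : ℕ, ((-(ρ * p ^ k') * p ^ N : ℚ) : WithTop ℚ) ≤ w (x.coeff N) := by
      by_cases h0 : x.coeff N = 0
      · exact ⟨0, by rw [h0]; simp⟩
      obtain ⟨q, hq⟩ := av_exists w h0
      obtain ⟨k', hk'⟩ := pow_unbounded_of_one_lt (-q / ρ) hp1
      refine ⟨k', ?_⟩
      rw [hq]
      refine WithTop.coe_le_coe.2 ?_
      rw [div_lt_iff₀ hρ] at hk'
      have h1 : (1 : ℚ) ≤ (p : ℚ) ^ N := one_le_pow₀ hp1.le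
      have h2 : 0 < ρ * (p : ℚ) ^ k' := by positivity
      nlinarith
    refine ⟨max k k', fun j hj => ?_⟩
    rcases Nat.lt_succ_iff_lt_or_eq.1 hj with hj | rfl
    · refine fil_mono w ?_ hk j hj
      exact mul_le_mul_of_nonneg_left (pow_le_pow_right₀ hp1.le (le_max_left _ _)) hρ.le
    · refine av_mono w hk' ?_
      have h3 : (p : ℚ) ^ k' ≤ p ^ max k k' := pow_le_pow_right₀ hp1.le (le_max_right _ _)
      have h4 : ρ * (p : ℚ) ^ k' ≤ ρ * p ^ max k k' := mul_le_mul_of_nonneg_left h3 hρ.le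
      have h5 : ρ * (p : ℚ) ^ k' * p ^ j ≤ ρ * p ^ max k k' * p ^ j :=
        mul_le_mul_of_nonneg_right h4 (by positivity)
      linarith

theorem fil_descend {t : L} (ht : w t = ((1 : ℚ) : WithTop ℚ)) {ρ : ℚ} (hρ : 0 < ρ) {N : ℕ}
    {x a : WittVector p L} (hrel : WEq N (WittVector.frobenius x) (x + a)) (ha : Fil w ρ N a) :
    Fil w (ρ / p) N x := by
  have hp0 : (0 : ℚ) < p := by exact_mod_cast hp.out.pos
  have hp1 : (1 : ℚ) < p := by exact_mod_cast hp.out.one_lt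
  have step : ∀ R, ρ ≤ R → Fil w R N x → Fil w (R / p) N x := by
    intro R hR hx j hj
    have h1 := fil_weq w (weq_symm hrel) (fil_add w ht hx (fil_mono w hR ha)) j hj
    rw [coeff_frobenius_charP] at h1
    have := pow_le_cancel w hp.out.pos h1
    convert this using 2
    ring
  obtain ⟨k, hk⟩ := fil_exists (w := w) ρ hρ N x
  induction k with
  | zero => exact step ρ le_rfl (by simpa using hk)
  | succ k ih =>
    apply ih
    have h := step _ ?_ hk
    · convert h using 1
      rw [pow_succ]; field_simp
    · have : (1 : ℚ) ≤ (p : ℚ) ^ (k + 1) := one_le_pow₀ hp1.le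
      nlinarith

end StageStep

set_option linter.unusedSectionVars false

section StageMain
open WittVector

variable {p : ℕ} [hp : Fact p.Prime] {K L : Type*} [Field K] [Field L] [Algebra K L]
  [FiniteDimensional K L] [CharP L p]
  {w : AddValuation L (WithTop ℚ)} {τ : L ≃ₐ[K] L} {n m0 : ℕ} {a0 : K} {X c : WittVector p L}

theorem tl_pow (m : ℕ) (z : L) : ((τ.toLinearMap : Module.End K L) ^ m) z = (τ ^ m) z := by
  induction m with
  | zero => simp
  | succ m ih => rw [pow_succ', pow_succ', Module.End.mul_apply, ih]; rfl

theorem tl_frob (j : ℕ) : ((τ.toLinearMap : Module.End K L) - 1) ^ p ^ j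
    = (τ.toLinearMap : Module.End K L) ^ p ^ j - 1 := by
  have : CharP K p := (algebraMap K L).charP (algebraMap K L).injective p
  have : CharP (Module.End K L) p :=
    charP_of_injective_algebraMap (algebraMap K (Module.End K L)).injective p
  rw [sub_pow_char_pow_of_commute _ _ (Commute.one_right _), one_pow]

theorem tl_frob_apply (j : ℕ) (z : L) : (((τ.toLinearMap : Module.End K L) - 1) ^ p ^ j) z
    = (τ ^ p ^ j) z - z := by
  rw [tl_frob, LinearMap.sub_apply, tl_pow]; rfl

theorem op_bound (T : TW p w τ n m0 a0 X c) {i : ℕ} (hin : i ≤ n)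
    (hst : ∀ j < i, ∃ y, Stage p w τ m0 j y) : ∀ j ≤ i, ∀ z ∈ Fx p τ j, ∀ r : ℚ,
      (r : WithTop ℚ) ≤ w z →
      ((r + sg p m0 j : ℚ) : WithTop ℚ)
        ≤ w ((((τ.toLinearMap : Module.End K L) - 1) ^ (p ^ j - 1)) z) := by
  intro j
  induction j with
  | zero =>
    intro _ z _ r hr
    simpa [sg_zero] using hr
  | succ j ih =>
    intro hj z hz r hr
    obtain ⟨y, hy1, hy2, hy3, hy4⟩ := hst j (by omega)
    have hbpos : (0 : ℚ) < bs p m0 j := by exact_mod_cast bs_pos hp.out T.m0pos j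
    have hp0 : (0 : ℚ) < p := by exact_mod_cast hp.out.pos
    have hs : (0 : ℚ) < (bs p m0 j : ℚ) / p ^ (j + 1) := by positivity
    set T0 : Module.End K L := (τ.toLinearMap : Module.End K L) - 1 with hT0
    have key : ∀ m : ℕ, (T0 ^ (p ^ j * m)) z ∈ Fx p τ (j + 1) ∧
        ((r + m * ((bs p m0 j : ℚ) / p ^ (j + 1)) : ℚ) : WithTop ℚ) ≤ w ((T0 ^ (p ^ j * m)) z) := by
      intro m
      induction m with
      | zero => simpa using ⟨hz, hr⟩
      | succ m ihm =>
        have e : (T0 ^ (p ^ j * (m + 1))) z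
            = (τ ^ p ^ j) ((T0 ^ (p ^ j * m)) z) - (T0 ^ (p ^ j * m)) z := by
          rw [mul_add, mul_one, add_comm, pow_add, Module.End.mul_apply, hT0, tl_frob_apply]
        rw [e]
        obtain ⟨h1, h2⟩ := ihm
        refine ⟨sub_mem ?_ h1, ?_⟩
        · rw [mem_Fx] at h1 ⊢
          rw [← AlgEquiv.mul_apply, (Commute.pow_pow_self τ _ _).eq, AlgEquiv.mul_apply, h1]
        · have h3 := hy4 j le_rfl 1 (by
            intro h; exact hp.out.one_lt.ne' (Nat.dvd_one.1 h))
          rw [mul_one] at h3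
          have := gr_sigma (p := p) w T.kint (bs_mod T.hpm j) hy2 _ hy1 (T.fr (j + 1) (by omega))
            (τ ^ p ^ j) hs h3 _ h1 h2
          refine av_mono w this ?_
          push_cast; linarith
    obtain ⟨-, h2⟩ := key (p - 1)
    have hz' : (T0 ^ (p ^ j * (p - 1))) z ∈ Fx p τ j := by
      rw [mem_Fx, ← sub_eq_zero, ← tl_frob_apply (K := K), ← hT0, ← Module.End.mul_apply, ← pow_add]
      have : p ^ j + p ^ j * (p - 1) = p ^ (j + 1) := by
        obtain ⟨q, hq⟩ := Nat.exists_eq_add_of_le hp.out.one_le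
        rw [hq]; simp; ring
      rw [this, hT0, tl_frob_apply, sub_eq_zero]
      exact mem_Fx.1 hz
    have h3 := ih (by omega) _ hz' _ h2
    rw [← Module.End.mul_apply, ← pow_add] at h3
    have e1 : p ^ j - 1 + p ^ j * (p - 1) = p ^ (j + 1) - 1 := by
      obtain ⟨q, hq⟩ := Nat.exists_eq_add_of_le hp.out.one_le
      have h4 : 1 ≤ p ^ j := Nat.one_le_pow _ _ hp.out.pos
      have : p ^ (j + 1) = p ^ j + p ^ j * (p - 1) := by
        rw [hq]; simp; ring
      omega
    rw [e1] at h3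
    refine av_mono w h3 ?_
    rw [sg_succ, Nat.cast_sub hp.out.one_le]; push_cast; linarith

/-- properties following from `g_i y = y + c'` -/
theorem as_props {i : ℕ} {y c' : L} (hc' : c' ≠ 0) (hcp : c' ^ p = c') (hτc : τ c' = c')
    (hy : (τ ^ p ^ i) y = y + c') :
    y ∈ Fx p τ (i + 1) ∧ y ^ p - y ∈ Fx p τ i ∧ τ y - y ∈ Fx p τ i ∧
    (∀ q : ℕ, ¬ p ∣ q → w ((τ ^ (p ^ i * q)) y - y) = ((0 : ℚ) : WithTop ℚ)) := by
  have hfix : ∀ m, (τ ^ m) c' = c' := by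
    intro m
    have h1 : τ ∈ MulAction.stabilizer (L ≃ₐ[K] L) c' := hτc
    exact pow_mem h1 m
  have hq : ∀ q : ℕ, (τ ^ (p ^ i * q)) y = y + q * c' := by
    intro q
    induction q with
    | zero => simp
    | succ q ih =>
      rw [mul_add, mul_one, add_comm, pow_add, AlgEquiv.mul_apply, ih, map_add, map_mul, map_natCast,
        hfix, hy]; push_cast; ring
  refine ⟨?_, ?_, ?_, ?_⟩
  · rw [mem_Fx, pow_succ, hq]; simp
  · rw [mem_Fx, map_sub, map_pow, hy, add_pow_char, hcp]; ring
  · rw [mem_Fx, map_sub, ← AlgEquiv.mul_apply, (Commute.pow_self τ _).eq, AlgEquiv.mul_apply, hy,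
      map_add, hτc]; ring
  · intro q hpq
    rw [hq, add_sub_cancel_left, av_mul_eq w (av_natCast (p := p) w hpq) (av_prime w hp.out hc' hcp)]
    simp

theorem stage_zero (T : TW p w τ n m0 a0 X c) (hn : 1 ≤ n) : ∃ y, Stage p w τ m0 0 y := by
  have hp0 : (p : ℚ) ≠ 0 := by exact_mod_cast hp.out.ne_zero
  have hc' : τ (c.coeff 0) = c.coeff 0 := by
    have := (map_eq_iff _ _).1 T.cfix 0
    exact this
  have h1 := T.relτ 0 (by omega)
  rw [map_coeff, add_coeff_zero] at h1
  have h2 := T.relX 0 (by omega)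
  rw [coeff_frobenius_charP, add_coeff_zero, teichmuller_coeff_zero] at h2
  obtain ⟨hA, hB, -, hC⟩ := as_props (w := w) (τ := τ) (i := 0) T.c0 (T.cp 0) hc'
    (y := X.coeff 0) (by rw [pow_zero, pow_one]; exact h1)
  have hm : (0 : ℚ) < m0 := by exact_mod_cast T.m0pos
  refine ⟨X.coeff 0, hA, ?_, hB, ?_⟩
  · rw [av_as_neg w hp.out (y := X.coeff 0) (r := -m0) (by linarith) (by
      rw [h2, add_sub_cancel_left]; exact T.wa0)]
    simp [bs]
  · intro j hj q hq
    obtain rfl : j = 0 := by omega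
    rw [hC q hq]; congr 1; ring

theorem stage_succ (T : TW p w τ n m0 a0 X c) {i : ℕ} (hi : 1 ≤ i) (hin : i + 1 ≤ n)
    (hst : ∀ j < i, ∃ y, Stage p w τ m0 j y) : ∃ y, Stage p w τ m0 i y := by
  have hp0 : (0 : ℚ) < p := by exact_mod_cast hp.out.pos
  obtain ⟨t, ht⟩ := T.unif
  obtain ⟨U, a, hU, ha, hrel, hfil⟩ := iter_approx T hin hst i le_rfl
  have hid1 := bs_id1 (m := m0) hp.out i
  have hid2 := bs_id2 (m := m0) hp.out i
  have hbpos : (0 : ℚ) < bs p m0 i := by exact_mod_cast bs_pos hp.out T.m0pos i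
  have hρ : ((p : ℚ) ^ i * m0 - sg p m0 i) / p ^ i = bs p m0 i / p ^ i / p ^ i := by
    rw [← hid1]; ring
  rw [hρ] at hfil
  have hcut : ∀ {A B : WittVector p L}, WEq n A B → WEq (i + 1) A B :=
    fun h j hj => h j (by omega)
  have hxrel : WEq (i + 1) (WittVector.frobenius (X - U)) ((X - U) + a) := by
    rw [map_sub, hrel]
    have := weq_sub (hcut T.relX) (weq_refl (i + 1) (WittVector.frobenius U))
    convert this using 1
    ring
  have hxfil := fil_descend ht (by positivity) hxrel hfil
  set y := (X - U).coeff i with hy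
  have hwy := hxfil i (by omega)
  rw [← hy] at hwy
  have hwy' : ((-(bs p m0 i : ℚ) / p ^ (i + 1) : ℚ) : WithTop ℚ) ≤ w y := by
    convert hwy using 2
    rw [pow_succ]; field_simp
  -- action of g_i
  set c' := c.coeff 0 ^ p ^ i with hc'
  have hcc : c.coeff 0 ^ p ^ i = c.coeff 0 := by
    clear_value c'
    clear hc'
    induction i with
    | zero => simp
    | succ k _ =>
      have : ∀ k : ℕ, c.coeff 0 ^ p ^ k = c.coeff 0 := by
        intro k
        induction k with
        | zero => simp
        | succ k ih => rw [pow_succ, pow_mul, ih, T.cp 0]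
      exact this _
  have hτc : τ (c.coeff 0) = c.coeff 0 := (map_eq_iff _ _).1 T.cfix 0
  have hgi : (τ ^ p ^ i) y = y + c.coeff 0 := by
    have h1 := hcut (act_pow T (p ^ i))
    have h2 := weq_sub h1 (weq_refl (i + 1) U)
    have h3 := h2 i (by omega)
    have h4 : map ((τ ^ p ^ i : L ≃ₐ[K] L) : L →+* L) X - U
        = map ((τ ^ p ^ i : L ≃ₐ[K] L) : L →+* L) (X - U) := by rw [map_sub, hU]
    rw [h4, map_coeff] at h3
    have h5 : X + p ^ i • c - U = (X - U) + c * (p : WittVector p L) ^ i := by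
      rw [nsmul_eq_mul]; push_cast; ring
    rw [h5, (coeff_add_of_low (X - U) _ (fun j hj => mul_pow_charP_coeff_zero c hj)).2] at h3
    have h6 := mul_pow_charP_coeff_succ c (m := 0) (n := i)
    rw [zero_add] at h6
    rw [h6, hcc] at h3
    exact h3
  obtain ⟨hA, hB, hd, hC⟩ := as_props (w := w) T.c0 (T.cp 0) hτc hgi
  -- lower bound
  obtain ⟨z, hz1, hz2, hz3, hz4⟩ := hst (i - 1) (by omega)
  have hi1 : i - 1 + 1 = i := by omega
  rw [hi1] at hz1 hz2 hz4
  set d := τ y - y with hddef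
  have hop := op_bound T (by omega) hst i le_rfl d hd
  have hTd : (((τ.toLinearMap : Module.End K L) - 1) ^ (p ^ i - 1)) d = c.coeff 0 := by
    have e1 : d = ((τ.toLinearMap : Module.End K L) - 1) y := rfl
    have h1 : 1 ≤ p ^ i := Nat.one_le_pow _ _ hp.out.pos
    rw [e1, ← Module.End.mul_apply, ← pow_succ, Nat.sub_add_cancel h1, tl_frob_apply, hgi]; ring
  rw [hTd] at hop
  have hd0 : d ≠ 0 := by
    intro h; rw [h, map_zero] at hTd; exact T.c0 hTd.symm
  obtain ⟨q, hq⟩ := av_exists w hd0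
  have hc0w := av_prime w hp.out T.c0 (T.cp 0)
  have hqle : q + sg p m0 i ≤ 0 := av_le_of_eq w hc0w (hop q hq.ge)
  have hsg : 0 < sg p m0 i := by
    have := sg_pos hp.out T.m0pos (i - 1); rwa [hi1] at this
  have hdd := av_as_of_neg w hp.out (q := q) (by linarith) hq
  set B := y ^ p - y with hBdef
  have hASσ : ∀ σ : L ≃ₐ[K] L, (σ y - y) ^ p - (σ y - y) = σ B - B := by
    intro σ
    rw [hBdef, map_sub, map_pow, sub_pow_char]; ring
  rw [hddef, hASσ] at hdd
  have hB0 : B ≠ 0 := by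
    intro h
    rw [h, map_zero, sub_zero, AddValuation.map_zero] at hdd
    exact absurd hdd WithTop.top_ne_coe
  obtain ⟨r, hr⟩ := av_exists w hB0
  have hm0 : (0 : ℚ) < m0 := by exact_mod_cast T.m0pos
  have hz5 := hz4 0 (by omega) 1 (by intro h; exact hp.out.one_lt.ne' (Nat.dvd_one.1 h))
  rw [pow_zero, mul_one, pow_one] at hz5
  have hb00 : (bs p m0 0 : ℚ) = m0 := by simp [bs]
  have hrle : r + (bs p m0 0 : ℚ) / p ^ i ≤ p * q := by
    have := gr_sigma (p := p) w T.kint (bs_mod T.hpm (i - 1)) hz2 _ hz1 (T.fr i (by omega))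
      τ (by rw [hb00]; positivity) hz5 B hB hr.ge
    exact av_le_of_eq w hdd this
  have hrle2 : r ≤ -(bs p m0 i : ℚ) / p ^ i := by
    have h1 : (bs p m0 i : ℚ) / p ^ i = m0 / p ^ i + p * sg p m0 i := by
      have : (bs p m0 i : ℚ) / p ^ i = p * (bs p m0 i / p ^ (i + 1)) := by
        rw [pow_succ]; field_simp
      rw [this, hid2, pow_succ]; field_simp
    rw [neg_div, h1]
    rw [hb00] at hrle
    have : (p : ℚ) * q ≤ p * (- sg p m0 i) := mul_le_mul_of_nonneg_left (by linarith) hp0.le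
    linarith
  have hrneg : r < 0 := by
    have : 0 < (bs p m0 i : ℚ) / p ^ i := by positivity
    rw [neg_div] at hrle2; linarith
  have hwyr := av_as_neg w hp.out hrneg hr
  have hreq : r = -(bs p m0 i : ℚ) / p ^ i := by
    refine le_antisymm hrle2 ?_
    have h1 := av_le_of_eq w hwyr hwy'
    rw [pow_succ, ← div_div, div_le_div_iff_of_pos_right hp0] at h1
    exact h1
  have hwyfin : w y = ((-(bs p m0 i : ℚ) / p ^ (i + 1) : ℚ) : WithTop ℚ) := by
    rw [hwyr, hreq, pow_succ, div_div]
  refine ⟨y, hA, hwyfin, hB, ?_⟩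
  intro j hj q' hq'
  rcases Nat.lt_or_eq_of_le hj with hj | rfl
  · have hbj : (bs p m0 j : ℚ) < bs p m0 i := by exact_mod_cast bs_strictMono hp.out T.m0pos hj
    have hbj0 : (0 : ℚ) < bs p m0 j := by exact_mod_cast bs_pos hp.out T.m0pos j
    have h1 := gr_sigma_eq (p := p) w T.kint hi (bs_mod T.hpm (i - 1)) hz2 _ hz1 (T.fr i (by omega))
      (τ ^ (p ^ j * q')) (s := (bs p m0 j : ℚ) / p ^ i) (by positivity)
      (hz4 j (by omega) q' hq') B hB (c := -bs p m0 i)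
      (by rw [dvd_neg]; exact bs_mod T.hpm i) (by rw [hr, hreq]; push_cast; rfl)
    rw [← hASσ] at h1
    have hneg : ((-bs p m0 i : ℤ) : ℚ) / (p : ℚ) ^ i + (bs p m0 j : ℚ) / p ^ i < 0 := by
      rw [← add_div]
      refine div_neg_of_neg_of_pos ?_ (by positivity)
      push_cast; linarith
    rw [av_as_neg w hp.out hneg h1]
    congr 1
    push_cast
    rw [pow_succ]; field_simp
  · rw [hC q' hq']
    congr 1; ring

theorem stage_all (T : TW p w τ n m0 a0 X c) : ∀ i, i + 1 ≤ n → ∃ y, Stage p w τ m0 i y := by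
  intro i
  induction i using Nat.strong_induction_on with
  | _ i ih =>
    intro hi
    rcases Nat.eq_zero_or_pos i with rfl | h
    · exact stage_zero T hi
    · exact stage_succ T h hi fun j hj => ih j hj (by omega)

end StageMain

set_option linter.unusedSectionVars false

section ScaleVal

variable {L : Type*} [Field L]

/-- rescaled valuation as an additive valuation with rational values -/
def scaleVal (v : L → WithTop ℤ) (hv : IsNormVal v) (c : ℚ) (hc : 0 < c) :
    AddValuation L (WithTop ℚ) :=
  AddValuation.of (fun z => (v z).map (fun k : ℤ => (k : ℚ) * c))
    (by rw [(hv.1 0).2 rfl]; rfl)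
    (by
      have h1 : v 1 ≠ ⊤ := fun h => one_ne_zero ((hv.1 1).1 h)
      obtain ⟨q, hq⟩ := WithTop.ne_top_iff_exists.1 h1
      have h2 := hv.2.1 1 1
      rw [mul_one, ← hq, ← WithTop.coe_add] at h2
      have h3 : q = 0 := by have := WithTop.coe_injective h2; omega
      rw [← hq, h3]; simp)
    (by
      intro x y
      have hmono : Monotone (WithTop.map (fun k : ℤ => (k : ℚ) * c)) := by
        refine Monotone.withTop_map ?_
        intro a b h
        exact mul_le_mul_of_nonneg_right (by exact_mod_cast h) hc.le
      rw [← hmono.map_min]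
      exact hmono (hv.2.2.1 x y))
    (by
      intro x y
      rw [hv.2.1]
      generalize v x = A
      generalize v y = B
      induction A using WithTop.recTopCoe with
      | top => simp
      | coe a =>
        induction B using WithTop.recTopCoe with
        | top => simp
        | coe b =>
          rw [← WithTop.coe_add]
          simp only [WithTop.map_coe]
          rw [← WithTop.coe_add]; congr 1; push_cast; ring)

theorem scaleVal_apply {v : L → WithTop ℤ} (hv : IsNormVal v) {c : ℚ} (hc : 0 < c) (z : L) :
    scaleVal v hv c hc z = (v z).map (fun k : ℤ => (k : ℚ) * c) := rfl

theorem scaleVal_eq_iff {v : L → WithTop ℤ} (hv : IsNormVal v) {c : ℚ} (hc : 0 < c) (z : L) (k : ℤ) :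
    scaleVal v hv c hc z = ((k * c : ℚ) : WithTop ℚ) ↔ v z = (k : WithTop ℤ) := by
  rw [scaleVal_apply]
  generalize v z = A
  induction A using WithTop.recTopCoe with
  | top => exact iff_of_false WithTop.top_ne_coe WithTop.top_ne_coe
  | coe a =>
    simp only [WithTop.map_coe, WithTop.coe_inj]
    constructor
    · intro h; exact_mod_cast mul_right_cancel₀ hc.ne' h
    · rintro rfl; rfl

theorem scaleVal_ge_iff {v : L → WithTop ℤ} (hv : IsNormVal v) {c : ℚ} (hc : 0 < c) (z : L) (k : ℤ) :
    ((k * c : ℚ) : WithTop ℚ) ≤ scaleVal v hv c hc z ↔ (k : WithTop ℤ) ≤ v z := by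
  rw [scaleVal_apply]
  generalize v z = A
  induction A using WithTop.recTopCoe with
  | top => simp
  | coe a =>
    simp only [WithTop.map_coe, WithTop.coe_le_coe]
    constructor
    · intro h; exact_mod_cast le_of_mul_le_mul_right h hc
    · intro h; exact mul_le_mul_of_nonneg_right (by exact_mod_cast h) hc.le

variable {k K : Type*} [Field k] [Field K] (ι : K ≃+* LaurentSeries k) [Algebra K L]

theorem lfVal_of_ne {a : K} (ha : a ≠ 0) : ∃ z : ℤ, lfVal ι a = (z : WithTop ℤ) := by
  refine ⟨(ι a).order, ?_⟩
  rw [lfVal, lsVal, if_neg]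
  simpa using ha

theorem e_ne_zero [FiniteDimensional K L] {v : L → WithTop ℤ} (hv : IsNormVal v) {e : ℕ}
    (he : ExtendsWithE (lfVal ι) v e) : e ≠ 0 := by
  rintro rfl
  obtain ⟨π, hπ⟩ := hv.2.2.2
  have hK : ∀ a : K, a ≠ 0 → v (algebraMap K L a) = ((0 : ℤ) : WithTop ℤ) := by
    intro a ha
    obtain ⟨z, hz⟩ := lfVal_of_ne ι ha
    have := he a z hz
    simpa using this
  set w := scaleVal v hv 1 one_pos with hw
  have hintg : IsIntegral K π := Algebra.IsIntegral.isIntegral π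
  set P := minpoly K π with hP
  have hP0 : P ≠ 0 := minpoly.ne_zero hintg
  have h0 : ∑ i ∈ Finset.range (P.natDegree + 1), algebraMap K L (P.coeff i) * π ^ i = 0 := by
    have := minpoly.aeval K π
    rw [Polynomial.aeval_eq_sum_range] at this
    simpa [Algebra.smul_def] using this
  have hwπ : w π = ((1 : ℚ) : WithTop ℚ) := by
    have := (scaleVal_eq_iff hv one_pos π 1).2 hπ
    simpa using this
  have hval : ∀ i, algebraMap K L (P.coeff i) * π ^ i ≠ 0 →
      w (algebraMap K L (P.coeff i) * π ^ i) = ((i : ℚ) : WithTop ℚ) := by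
    intro i hi
    have hc : P.coeff i ≠ 0 := by
      intro h; rw [h, map_zero, zero_mul] at hi; exact hi rfl
    have h1 : w (algebraMap K L (P.coeff i)) = ((0 : ℚ) : WithTop ℚ) := by
      have := (scaleVal_eq_iff hv one_pos _ 0).2 (hK _ hc)
      simpa using this
    rw [av_mul_eq w h1 (av_pow_eq w hwπ i)]
    congr 1; ring
  rcases av_sum_distinct w (Finset.range (P.natDegree + 1))
    (fun i => algebraMap K L (P.coeff i) * π ^ i) (by
      intro i _ j _ hij hi hj h
      rw [hval i hi, hval j hj] at h
      exact hij (by exact_mod_cast WithTop.coe_injective h)) with h | ⟨i, -, hi, h, -⟩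
  · have h1 := h P.natDegree (by simp)
    have hπ0 := av_ne_zero w hwπ
    simp [hπ0, hP0] at h1
  · rw [h0, AddValuation.map_zero, hval i hi] at h
    exact WithTop.top_ne_coe h

theorem wK {v : L → WithTop ℤ} (hv : IsNormVal v) {e : ℕ}
    (he : ExtendsWithE (lfVal ι) v e) (hc : (0 : ℚ) < 1 / e) {a : K} {z : ℤ}
    (h : lfVal ι a = (z : WithTop ℤ)) :
    scaleVal v hv (1 / e) hc (algebraMap K L a) = ((z : ℚ) : WithTop ℚ) := by
  have h1 := (scaleVal_eq_iff hv hc _ _).2 (he a z h)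
  rw [h1]; congr 1
  have : (e : ℚ) ≠ 0 := by
    intro h; rw [h] at hc; simp at hc
  push_cast; field_simp

theorem wK_kint {v : L → WithTop ℤ} (hv : IsNormVal v) {e : ℕ}
    (he : ExtendsWithE (lfVal ι) v e) (hc : (0 : ℚ) < 1 / e) :
    KInt K (scaleVal v hv (1 / e) hc) := by
  intro a ha
  obtain ⟨z, hz⟩ := lfVal_of_ne ι ha
  exact ⟨z, wK ι hv he hc hz⟩

theorem wK_unif {v : L → WithTop ℤ} (hv : IsNormVal v) {e : ℕ}
    (he : ExtendsWithE (lfVal ι) v e) (hc : (0 : ℚ) < 1 / e) :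
    ∃ t : K, scaleVal v hv (1 / e) hc (algebraMap K L t) = ((1 : ℚ) : WithTop ℚ) := by
  refine ⟨ι.symm (HahnSeries.single 1 1), ?_⟩
  have := wK ι hv he hc (a := ι.symm (HahnSeries.single 1 1)) (z := 1) (by
    rw [lfVal, RingEquiv.apply_symm_apply, lsVal, if_neg (by simp), HahnSeries.order_single one_ne_zero])
  simpa using this

theorem wK_perf {p : ℕ} [Fact p.Prime] [PerfectField k] [CharP k p]
    {v : L → WithTop ℤ} (hv : IsNormVal v) {e : ℕ}
    (he : ExtendsWithE (lfVal ι) v e) (hc : (0 : ℚ) < 1 / e) (a : K)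
    (ha : scaleVal v hv (1 / e) hc (algebraMap K L a) = ((0 : ℚ) : WithTop ℚ)) :
    ∃ κ : K, scaleVal v hv (1 / e) hc (algebraMap K L κ) = ((0 : ℚ) : WithTop ℚ) ∧
      ((0 : ℚ) : WithTop ℚ) < scaleVal v hv (1 / e) hc (algebraMap K L a - algebraMap K L κ ^ p) := by
  have ha0 : a ≠ 0 := by
    rintro rfl
    rw [map_zero, AddValuation.map_zero] at ha
    exact WithTop.top_ne_coe ha
  have hι : ι a ≠ 0 := by simpa using ha0
  have hord : (ι a).order = 0 := by
    have h1 := wK ι hv he hc (a := a) (z := (ι a).order) (by rw [lfVal, lsVal, if_neg hι])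
    have := av_eq_of_eq _ h1 ha
    exact_mod_cast this
  have : PerfectRing k p := PerfectField.toPerfectRing p
  obtain ⟨r, hr⟩ := (PerfectRing.bijective_frobenius (R := k) (p := p)).2 ((ι a).coeff 0)
  replace hr : r ^ p = (ι a).coeff 0 := hr
  have hc0 : (ι a).coeff 0 ≠ 0 := by
    have := HahnSeries.coeff_order_eq_zero.not.2 hι
    rwa [hord] at this
  have hr0 : r ≠ 0 := by
    rintro rfl
    rw [zero_pow (Fact.out : p.Prime).ne_zero] at hr
    exact hc0 hr.symm
  refine ⟨ι.symm (HahnSeries.C r), ?_, ?_⟩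
  · have := wK ι hv he hc (a := ι.symm (HahnSeries.C r)) (z := 0) (by
      rw [lfVal, RingEquiv.apply_symm_apply, lsVal, if_neg (by simpa using hr0)]
      rw [HahnSeries.C_apply, HahnSeries.order_single hr0])
    simpa using this
  · rw [← map_pow, ← map_sub]
    by_cases h : a - ι.symm (HahnSeries.C r) ^ p = 0
    · rw [h, map_zero, AddValuation.map_zero]; exact WithTop.coe_lt_top _
    · obtain ⟨z, hz⟩ := lfVal_of_ne ι h
      rw [wK ι hv he hc hz, WithTop.coe_lt_coe]
      have hh : ι (a - ι.symm (HahnSeries.C r) ^ p) = ι a - HahnSeries.C ((ι a).coeff 0) := by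
        rw [map_sub, map_pow, RingEquiv.apply_symm_apply, ← map_pow, hr]
      have hne : ι a - HahnSeries.C ((ι a).coeff 0) ≠ 0 := by
        rw [← hh]; exact (map_ne_zero_iff ι ι.injective).2 h
      rw [lfVal, lsVal, hh, if_neg hne] at hz
      have hz' : (ι a - HahnSeries.C ((ι a).coeff 0)).order = z := WithTop.coe_injective hz
      have hnz := HahnSeries.coeff_order_eq_zero.not.2 hne
      rw [hz', HahnSeries.coeff_sub, HahnSeries.C_apply] at hnz
      by_contra hle
      have hle' : z ≤ 0 := by
        have : (z : ℚ) ≤ 0 := not_lt.1 hle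
        exact_mod_cast this
      rcases hle'.lt_or_eq with h1 | h1
      · rw [HahnSeries.coeff_single_of_ne h1.ne, HahnSeries.coeff_eq_zero_of_lt_order (by rw [hord]; exact h1)] at hnz
        simp at hnz
      · rw [h1] at hnz; simp at hnz

end ScaleVal

set_option linter.unusedSectionVars false

section GaloisPart

open WittVector

variable {p : ℕ} [hp : Fact p.Prime] {R : Type*} [CommRing R] [CharP R p]

theorem frob_diff {n : ℕ} {X A : WittVector p R} (g : R →+* R)
    (h : WEq n (WittVector.frobenius X) (X + A)) (hA : map g A = A) :
    ∀ j < n, (map g X - X).coeff j ^ p = (map g X - X).coeff j := by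
  have h1 : WittVector.frobenius (map g X) = map g (WittVector.frobenius X) := by
    ext k
    rw [map_coeff, coeff_frobenius_charP, coeff_frobenius_charP, map_coeff, map_pow]
  have h2 : WEq n (WittVector.frobenius (map g X - X)) (map g X - X) := by
    rw [map_sub, h1]
    refine weq_trans (weq_sub (weq_map g h) h) ?_
    rw [map_add, hA]
    have : map g X + A - (X + A) = map g X - X := by ring
    rw [this]; exact weq_refl _ _
  intro j hj
  rw [← coeff_frobenius_charP]; exact h2 j hj

variable {K L : Type*} [Field K] [Field L] [Algebra K L] [FiniteDimensional K L] [CharP L p]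
  [IsGalois K L] {w : AddValuation L (WithTop ℚ)} {n m0 : ℕ} {a0 : K} {X : WittVector p L}

theorem fix_teich (σ : L ≃ₐ[K] L) (a0 : K) :
    map (σ : L →+* L) (teichmuller p (algebraMap K L a0)) = teichmuller p (algebraMap K L a0) := by
  rw [map_teichmuller]; congr 1; exact σ.commutes a0

theorem bot_fixed (σ : L ≃ₐ[K] L) {z : L} (hz : z ^ p = z) : σ z = z := by
  have h1 : z ∈ (⊥ : Subfield L) := (Subfield.mem_bot_iff_pow_eq_self L p).2 hz
  have h2 : (⊥ : Subfield L) ≤ RingHom.eqLocusField (σ : L →+* L) (RingHom.id L) := bot_le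
  exact h2 h1

theorem card_le (hX : WEq n (WittVector.frobenius X) (X + teichmuller p (algebraMap K L a0)))
    (hgen : ∀ σ : L ≃ₐ[K] L, (∀ j < n, σ (X.coeff j) = X.coeff j) → σ = 1) :
    Nat.card (L ≃ₐ[K] L) ≤ p ^ n := by
  have hD : ∀ (σ : L ≃ₐ[K] L) (j : Fin n), (map (σ : L →+* L) X - X).coeff j ∈ (⊥ : Subfield L) :=
    fun σ j => (Subfield.mem_bot_iff_pow_eq_self L p).2 (frob_diff _ hX (fix_teich σ a0) j j.2)
  let f : (L ≃ₐ[K] L) → (Fin n → (⊥ : Subfield L)) := fun σ j => ⟨_, hD σ j⟩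
  have hf : Function.Injective f := by
    intro σ ρ h
    have h1 : WEq n (map (σ : L →+* L) X - X) (map (ρ : L →+* L) X - X) := by
      intro j hj
      exact congrArg Subtype.val (congrFun h ⟨j, hj⟩)
    have h2 : WEq n (map (σ : L →+* L) X) (map (ρ : L →+* L) X) := by
      simpa using weq_add h1 (weq_refl n X)
    have h3 : ρ⁻¹ * σ = 1 := by
      apply hgen
      intro j hj
      have := h2 j hj
      rw [map_coeff, map_coeff] at this
      replace this : σ (X.coeff j) = ρ (X.coeff j) := this
      rw [AlgEquiv.mul_apply, this]
      exact ρ.symm_apply_apply _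
    exact (inv_mul_eq_one.1 h3).symm
  have hb : Nat.card (⊥ : Subfield L) = p := Subfield.card_bot L p
  have hfin : Finite (⊥ : Subfield L) := Nat.finite_of_card_ne_zero (by rw [hb]; exact hp.out.ne_zero)
  have := Nat.card_le_card_of_injective f hf
  rw [Nat.card_fun, hb] at this
  simpa using this

theorem nsmul_coeff_low (c : WittVector p L) {i j : ℕ} (h : j < i) : ((p ^ i) • c).coeff j = 0 := by
  have : (p ^ i) • c = c * (p : WittVector p L) ^ i := by rw [nsmul_eq_mul, mul_comm]; push_cast; rfl
  rw [this]; exact mul_pow_charP_coeff_zero c h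

theorem nsmul_coeff_self (c : WittVector p L) (i : ℕ) : ((p ^ i) • c).coeff i = c.coeff 0 ^ p ^ i := by
  have : (p ^ i) • c = c * (p : WittVector p L) ^ i := by rw [nsmul_eq_mul, mul_comm]; push_cast; rfl
  have h := mul_pow_charP_coeff_succ (p := p) c (m := 0) (n := i)
  rw [this]; rwa [zero_add] at h

theorem act_pow' {τ : L ≃ₐ[K] L} {c : WittVector p L} (hτ : WEq n (map (τ : L →+* L) X) (X + c))
    (hc : map (τ : L →+* L) c = c) (m : ℕ) :
    WEq n (map ((τ ^ m : L ≃ₐ[K] L) : L →+* L) X) (X + m • c) := by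
  induction m with
  | zero =>
    have : map ((τ ^ 0 : L ≃ₐ[K] L) : L →+* L) X = X := by
      ext j; rw [map_coeff]; simp
    rw [this]; simpa using weq_refl n X
  | succ m ih =>
    have e : map ((τ ^ (m + 1) : L ≃ₐ[K] L) : L →+* L) X
        = map (τ : L →+* L) (map ((τ ^ m : L ≃ₐ[K] L) : L →+* L) X) := by
      ext j; rw [map_coeff, map_coeff, map_coeff, pow_succ']; rfl
    rw [e]
    refine weq_trans (weq_map _ ih) ?_
    rw [map_add, map_nsmul, hc, succ_nsmul', ← add_assoc]
    exact weq_add hτ (weq_refl _ _)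

theorem galois_main (hn : 1 ≤ n)
    (kint : KInt K w)
    (unif : ∃ t : K, w (algebraMap K L t) = ((1 : ℚ) : WithTop ℚ))
    (perf : ∀ a : K, w (algebraMap K L a) = ((0 : ℚ) : WithTop ℚ) →
      ∃ κ : K, w (algebraMap K L κ) = ((0 : ℚ) : WithTop ℚ) ∧
        ((0 : ℚ) : WithTop ℚ) < w (algebraMap K L a - algebraMap K L κ ^ p))
    (m0pos : 0 < m0) (hpm : ¬ p ∣ m0)
    (wa0 : w (algebraMap K L a0) = ((-(m0 : ℚ) : ℚ) : WithTop ℚ))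
    (hX : WEq n (WittVector.frobenius X) (X + teichmuller p (algebraMap K L a0)))
    (hgen : ∀ σ : L ≃ₐ[K] L, (∀ j < n, σ (X.coeff j) = X.coeff j) → σ = 1) :
    ∃ (τ : L ≃ₐ[K] L) (c : WittVector p L), TW p w τ n m0 a0 X c ∧ orderOf τ = p ^ n ∧
      (∀ σ, σ ∈ Subgroup.zpowers τ) ∧ Module.finrank K L = p ^ n := by
  have hm : (0 : ℚ) < m0 := by exact_mod_cast m0pos
  have hp0 : (0 : ℚ) < p := by exact_mod_cast hp.out.pos
  obtain ⟨τ, hτ0⟩ : ∃ τ : L ≃ₐ[K] L, τ (X.coeff 0) ≠ X.coeff 0 := by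
    by_contra! hcon
    have h1 := (IsGalois.mem_bot_iff_fixed (F := K) (X.coeff 0)).2 hcon
    obtain ⟨b, hb⟩ := IntermediateField.mem_bot.1 h1
    have h2 := hX 0 (by omega)
    rw [coeff_frobenius_charP, add_coeff_zero, teichmuller_coeff_zero] at h2
    have h3 := av_as_neg w hp.out (y := X.coeff 0) (r := -m0) (by linarith) (by
      rw [h2, add_sub_cancel_left]; exact wa0)
    have hb0 : b ≠ 0 := by
      rintro rfl
      rw [map_zero] at hb
      exact av_ne_zero w h3 hb.symm
    obtain ⟨m, hm'⟩ := kint b hb0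
    rw [hb] at hm'
    have h4 := av_eq_of_eq w hm' h3
    field_simp at h4
    have h5 : m * (p : ℤ) = -(m0 : ℤ) := by exact_mod_cast (by linarith : (m : ℚ) * p = -m0)
    exact hpm (Int.natCast_dvd_natCast.1 ⟨-m, by linarith⟩)
  set D := map (τ : L →+* L) X - X with hDdef
  have hDp := frob_diff (τ : L →+* L) hX (fix_teich τ a0)
  set c := init n D with hcdef
  have hcD : WEq n c D := weq_init n D
  have hcp : ∀ j, c.coeff j ^ p = c.coeff j := by
    intro j
    by_cases hj : j < n
    · rw [hcD j hj]; exact hDp j hj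
    · have : c.coeff j = 0 := by simp [hcdef, init, select, hj]
      rw [this, zero_pow hp.out.ne_zero]
  have hrel : WEq n (map (τ : L →+* L) X) (X + c) := by
    have := weq_add (weq_refl n X) (weq_symm hcD)
    rwa [hDdef, add_sub_cancel] at this
  have hcfix : map (τ : L →+* L) c = c := by
    rw [map_eq_iff]; intro j; exact bot_fixed τ (hcp j)
  have hc0 : c.coeff 0 ≠ 0 := by
    intro h
    have := hrel 0 (by omega)
    rw [map_coeff, add_coeff_zero, h, add_zero] at this
    exact hτ0 this
  have hact := act_pow' hrel hcfix
  have hord : orderOf τ = p ^ n := by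
    obtain ⟨n', rfl⟩ : ∃ n', n = n' + 1 := ⟨n - 1, by omega⟩
    refine orderOf_eq_prime_pow ?_ ?_
    · intro h
      have h1 := hact (p ^ n') n' (by omega)
      rw [h, (coeff_add_of_low X _ (fun j hj => nsmul_coeff_low c hj)).2, nsmul_coeff_self,
        map_coeff] at h1
      have h2 : X.coeff n' = X.coeff n' + c.coeff 0 ^ p ^ n' := h1
      exact pow_ne_zero (p ^ n') hc0 (by simpa using h2.symm)
    · apply hgen
      intro j hj
      have h1 := hact (p ^ (n' + 1)) j hj
      rw [(coeff_add_of_low X _ (fun j hj => nsmul_coeff_low c hj)).1 j hj, map_coeff] at h1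
      exact h1
  have hcard : Nat.card (L ≃ₐ[K] L) = p ^ n := by
    refine le_antisymm (card_le hX hgen) ?_
    rw [← hord]; exact Nat.le_of_dvd Nat.card_pos (orderOf_dvd_natCard τ)
  have hfin : Module.finrank K L = p ^ n := by
    rw [← IsGalois.card_aut_eq_finrank K L, hcard]
  have hgenτ : ∀ σ, σ ∈ Subgroup.zpowers τ := by
    have : Subgroup.zpowers τ = ⊤ := by
      apply Subgroup.eq_top_of_card_eq
      rw [Nat.card_zpowers, hord, hcard]
    intro σ; rw [this]; trivial
  refine ⟨τ, c, ⟨kint, unif, perf, ?_, m0pos, hpm, wa0, hX, hrel, hcfix, hcp, hc0⟩, hord, hgenτ, hfin⟩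
  intro i hi
  have h1 : Module.finrank (Fx p τ i) L = p ^ (n - i) := by
    rw [Fx, IntermediateField.finrank_fixedField_eq_card, Nat.card_zpowers,
      orderOf_pow_of_dvd (pow_ne_zero _ hp.out.ne_zero) (by rw [hord]; exact pow_dvd_pow p hi), hord,
      Nat.pow_div hi hp.out.pos]
  have h2 := Module.finrank_mul_finrank K (Fx p τ i) L
  rw [h1, hfin] at h2
  have h3 : p ^ n = p ^ i * p ^ (n - i) := by rw [← pow_add]; congr 1; omega
  rw [h3] at h2
  exact (Nat.eq_of_mul_eq_mul_right (pow_pos hp.out.pos _) h2).le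

end GaloisPart

set_option linter.unusedSectionVars false

section RamPart

open WittVector

variable {p : ℕ} [hp : Fact p.Prime]
  {K L : Type*} [Field K] [Field L] [Algebra K L] [FiniteDimensional K L] [CharP L p]
  {n m0 : ℕ} {a0 : K} {X c : WittVector p L} {τ : L ≃ₐ[K] L}

theorem exp_decomp (n m : ℕ) :
    p ^ n ∣ m ∨ ∃ j < n, ∃ q, ¬ p ∣ q ∧ m = p ^ j * q := by
  by_cases hm : m = 0
  · left; rw [hm]; exact dvd_zero _
  obtain ⟨j, q, hq, h⟩ := Nat.exists_eq_pow_mul_and_not_dvd hm p hp.out.ne_one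
  by_cases hj : j < n
  · exact Or.inr ⟨j, hj, q, hq, h⟩
  · left; rw [h]; exact (pow_dvd_pow p (not_lt.1 hj)).mul_right q

theorem ram_main {v : L → WithTop ℤ} (hv : IsNormVal v) {e : ℕ} (hc : (0 : ℚ) < 1 / e)
    (hn : 1 ≤ n) (T : TW p (scaleVal v hv (1 / e) hc) τ n m0 a0 X c) (hord : orderOf τ = p ^ n)
    (hgen : ∀ σ, σ ∈ Subgroup.zpowers τ) {π : L} (hπ : v π = (1 : ℤ)) :
    e = p ^ n ∧ (∀ σ : L ≃ₐ[K] L, InInertia v σ) ∧ ∀ j < n, ∀ q, ¬ p ∣ q →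
      v ((τ ^ (p ^ j * q)) π - π) = ((1 + bs p m0 j : ℤ) : WithTop ℤ) := by
  set w := scaleVal v hv (1 / e) hc with hw
  obtain ⟨y, hy1, hy2, hy3, hy4⟩ := stage_all T (n - 1) (by omega)
  rw [show n - 1 + 1 = n by omega] at hy1 hy2 hy4
  have htop : ∀ z : L, z ∈ Fx p τ n := by
    intro z; rw [mem_Fx, ← hord, pow_orderOf_eq_one]; rfl
  have hpn : (p : ℚ) ^ n ≠ 0 := pow_ne_zero _ (by exact_mod_cast hp.out.ne_zero)
  have he0 : (e : ℚ) ≠ 0 := by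
    intro h; rw [h] at hc; simp at hc
  have hbm := bs_mod (m := m0) T.hpm (n - 1) (p := p)
  have hwπ : w π = ((1 / e : ℚ) : WithTop ℚ) := by
    have := (scaleVal_eq_iff hv hc π 1).2 hπ
    rw [this]; congr 1; simp
  have hdvd1 : p ^ n ∣ e := by
    have hne : v y ≠ ⊤ := by
      intro h; exact av_ne_zero w hy2 ((hv.1 y).1 h)
    obtain ⟨k, hk⟩ := WithTop.ne_top_iff_exists.1 hne
    have h1 := (scaleVal_eq_iff hv hc y k).2 hk.symm
    have h2 := av_eq_of_eq w h1 hy2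
    field_simp at h2
    have h3 : k * (p : ℤ) ^ n = - (e * bs p m0 (n - 1)) := by exact_mod_cast h2
    have hcop : IsCoprime ((p : ℤ) ^ n) (bs p m0 (n - 1)) := by
      refine IsCoprime.pow_left ?_
      exact ((Nat.prime_iff_prime_int.1 hp.out).coprime_iff_not_dvd).2 hbm
    have h4 : (p : ℤ) ^ n ∣ e := hcop.dvd_of_dvd_mul_right ⟨-k, by linarith⟩
    exact_mod_cast h4
  have hdvd2 : e ∣ p ^ n := by
    obtain ⟨m, hm⟩ := gr_disc w hp.out T.kint hbm hy2 _ hy1 (T.fr n le_rfl) π (htop π)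
      (av_ne_zero w hwπ)
    have h2 := av_eq_of_eq w hm hwπ
    field_simp at h2
    have h3 : (e : ℤ) * m = (p : ℤ) ^ n := by exact_mod_cast (by linarith : (e : ℚ) * m = p ^ n)
    have h4 : (e : ℤ) ∣ (p : ℤ) ^ n := ⟨m, h3.symm⟩
    exact_mod_cast h4
  have hee : e = p ^ n := Nat.dvd_antisymm hdvd2 hdvd1
  have heq : (e : ℚ) = p ^ n := by rw [hee]; push_cast; rfl
  have hspos : ∀ j, (0 : ℚ) < (bs p m0 j : ℚ) / p ^ n := by
    intro j
    have h1 : (0 : ℚ) < bs p m0 j := by exact_mod_cast bs_pos hp.out T.m0pos j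
    have h2 : (0 : ℚ) < p := by exact_mod_cast hp.out.pos
    positivity
  have hsame : ∀ j < n, ∀ q, ¬ p ∣ q → w ((τ ^ (p ^ j * q)) y - y)
      = ((-(bs p m0 (n - 1) : ℚ) / p ^ n + (bs p m0 j : ℚ) / p ^ n : ℚ) : WithTop ℚ) :=
    fun j hj q hq => hy4 j (by omega) q hq
  refine ⟨hee, ?_, ?_⟩
  · intro σ x hx
    have hfo : IsOfFinOrder τ := by
      rw [← orderOf_pos_iff, hord]; exact pow_pos hp.out.pos _
    obtain ⟨m, rfl⟩ : ∃ m : ℕ, τ ^ m = σ := by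
      obtain ⟨m, -, hm⟩ := Finset.mem_image.1 (hfo.mem_zpowers_iff_mem_range_orderOf.1 (hgen σ))
      exact ⟨m, hm⟩
    rcases exp_decomp (p := p) n m with h | ⟨j, hj, q, hq, rfl⟩
    · have : τ ^ m = 1 := by rw [← orderOf_dvd_iff_pow_eq_one, hord]; exact h
      rw [this, AlgEquiv.one_apply, sub_self, (hv.1 0).2 rfl]; exact le_top
    · have hx' : ((0 : ℚ) : WithTop ℚ) ≤ w x := by
        have := (scaleVal_ge_iff hv hc x 0).2 (by simpa using hx)
        refine le_trans (le_of_eq ?_) this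
        congr 1; simp
      have h1 := gr_sigma w T.kint hbm hy2 _ hy1 (T.fr n le_rfl) _ (hspos j) (hsame j hj q hq) x
        (htop x) hx'
      have h2 : (((bs p m0 j : ℤ) * (1 / e) : ℚ) : WithTop ℚ) ≤ w ((τ ^ (p ^ j * q)) x - x) := by
        refine av_mono w h1 (le_of_eq ?_)
        rw [heq]; ring
      have h3 := (scaleVal_ge_iff hv hc _ _).1 h2
      refine le_trans ?_ h3
      exact WithTop.coe_le_coe.2 (bs_pos hp.out T.m0pos j)
  · intro j hj q hq
    have hp1 : ¬ (p : ℤ) ∣ 1 := by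
      intro h
      have : p ∣ 1 := by exact_mod_cast h
      exact hp.out.one_lt.ne' (Nat.dvd_one.1 this)
    have h1 := gr_sigma_eq w T.kint hn hbm hy2 _ hy1 (T.fr n le_rfl) _ (hspos j) (hsame j hj q hq) π
      (htop π) (c := 1) hp1 (by rw [hwπ, heq]; congr 1)
    rw [← scaleVal_eq_iff hv hc, ← hw, h1]
    congr 1; rw [heq]; push_cast; ring

theorem ram_pow {v : L → WithTop ℤ} (hv : IsNormVal v) {π : L} 
    (hord : orderOf τ = p ^ n) (hin : ∀ σ : L ≃ₐ[K] L, InInertia v σ)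
    (hval : ∀ j < n, ∀ q, ¬ p ∣ q →
      v ((τ ^ (p ^ j * q)) π - π) = ((1 + bs p m0 j : ℤ) : WithTop ℤ))
    {i : ℕ} (hi : i ≤ n) {x : ℝ} (h1 : ∀ j < i, (bs p m0 j : ℝ) < x)
    (h2 : ∀ j, i ≤ j → j < n → x ≤ bs p m0 j) (m : ℕ) :
    τ ^ m ∈ ramGrp K v π x ↔ p ^ i ∣ m := by
  have hmem : τ ^ m ∈ ramGrp K v π x ↔ ((⌈x + 1⌉ : ℤ) : WithTop ℤ) ≤ v ((τ ^ m) π - π) :=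
    ⟨fun h => h.2, fun h => ⟨hin _, h⟩⟩
  rw [hmem]
  rcases exp_decomp (p := p) n m with h | ⟨j, hj, q, hq, rfl⟩
  · have : τ ^ m = 1 := by rw [← orderOf_dvd_iff_pow_eq_one, hord]; exact h
    rw [this, AlgEquiv.one_apply, sub_self, (hv.1 0).2 rfl]
    exact iff_of_true le_top ((pow_dvd_pow p hi).trans h)
  · rw [hval j hj q hq, WithTop.coe_le_coe, Int.ceil_le]
    push_cast
    have hiff : x + 1 ≤ 1 + (bs p m0 j : ℝ) ↔ i ≤ j := by
      constructor
      · intro h; by_contra hlt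
        have := h1 j (by omega); linarith
      · intro h; have := h2 j h hj; linarith
    rw [hiff]
    constructor
    · intro h; exact (pow_dvd_pow p h).mul_right q
    · intro h; by_contra hlt
      have h3 : p ^ (j + 1) ∣ p ^ j * q := (pow_dvd_pow p (by omega)).trans h
      rw [pow_succ] at h3
      exact hq (Nat.dvd_of_mul_dvd_mul_left (pow_pos hp.out.pos j) h3)

theorem ram_eq {v : L → WithTop ℤ} (hv : IsNormVal v) {π : L} 
    (hord : orderOf τ = p ^ n) (hgen : ∀ σ, σ ∈ Subgroup.zpowers τ)
    (hin : ∀ σ : L ≃ₐ[K] L, InInertia v σ)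
    (hval : ∀ j < n, ∀ q, ¬ p ∣ q →
      v ((τ ^ (p ^ j * q)) π - π) = ((1 + bs p m0 j : ℤ) : WithTop ℤ))
    {i : ℕ} (hi : i ≤ n) {x : ℝ} (h1 : ∀ j < i, (bs p m0 j : ℝ) < x)
    (h2 : ∀ j, i ≤ j → j < n → x ≤ bs p m0 j) :
    ramGrp K v π x = (Subgroup.zpowers (τ ^ p ^ i) : Set (L ≃ₐ[K] L)) := by
  have hfo : IsOfFinOrder τ := by
    rw [← orderOf_pos_iff, hord]; exact pow_pos hp.out.pos _
  ext σ
  obtain ⟨m, rfl⟩ : ∃ m : ℕ, τ ^ m = σ := by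
    obtain ⟨m, -, hm⟩ := Finset.mem_image.1 (hfo.mem_zpowers_iff_mem_range_orderOf.1 (hgen σ))
    exact ⟨m, hm⟩
  rw [ram_pow hv hord hin hval hi h1 h2]
  constructor
  · rintro ⟨q, rfl⟩
    rw [pow_mul]; exact Subgroup.npow_mem_zpowers _ _
  · intro h
    have hfo' : IsOfFinOrder (τ ^ p ^ i) := hfo.pow
    obtain ⟨q, -, hq⟩ := Finset.mem_image.1 (hfo'.mem_zpowers_iff_mem_range_orderOf.1 h)
    rw [← pow_mul, pow_eq_pow_iff_modEq, hord] at hq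
    have h3 : p ^ i ∣ p ^ n := pow_dvd_pow p hi
    exact (hq.dvd_iff h3).1 (Dvd.intro _ rfl)

theorem ncard_zp (hord : orderOf τ = p ^ n) {i : ℕ} (hi : i ≤ n) :
    (Subgroup.zpowers (τ ^ p ^ i) : Set (L ≃ₐ[K] L)).ncard = p ^ (n - i) := by
  rw [← Nat.card_coe_set_eq]
  change Nat.card (Subgroup.zpowers (τ ^ p ^ i)) = _
  rw [Nat.card_zpowers,
      orderOf_pow_of_dvd (pow_ne_zero _ hp.out.ne_zero) (by rw [hord]; exact pow_dvd_pow p hi), hord,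
      Nat.pow_div hi hp.out.pos]

end RamPart

set_option linter.unusedSectionVars false

section Breaks

theorem bs_formula (p m : ℕ) (i : ℕ) : (bs p m i : ℝ) = (m : ℝ) *
    ∑ j ∈ Finset.range (2 * i + 1), (-1 : ℝ) ^ j * (p : ℝ) ^ (2 * i - j) := by
  induction i with
  | zero => simp [bs]
  | succ i ih =>
    rw [bs, show 2 * (i + 1) + 1 = 2 * i + 1 + 1 + 1 by ring, Finset.sum_range_succ',
      Finset.sum_range_succ']
    have : ∑ j ∈ Finset.range (2 * i + 1), (-1 : ℝ) ^ (j + 1 + 1) * (p : ℝ) ^ (2 * (i + 1) - (j + 1 + 1))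
        = ∑ j ∈ Finset.range (2 * i + 1), (-1 : ℝ) ^ j * (p : ℝ) ^ (2 * i - j) := by
      refine Finset.sum_congr rfl fun j _ => ?_
      rw [pow_succ, pow_succ, show 2 * (i + 1) - (j + 1 + 1) = 2 * i - j by omega]; ring
    rw [this, show 2 * (i + 1) - (0 + 1) = 2 * i + 1 by omega,
      show 2 * (i + 1) - 0 = 2 * i + 2 by omega]
    push_cast
    rw [ih]; ring

variable {p : ℕ} [hp : Fact p.Prime] {n m0 : ℕ}

theorem pos_exists (hm : 0 < m0) (n : ℕ) (x : ℝ) : ∃ i ≤ n, (∀ j < i, (bs p m0 j : ℝ) < x) ∧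
    ∀ j, i ≤ j → j < n → x ≤ bs p m0 j := by
  by_cases h : ∃ j, j < n ∧ x ≤ bs p m0 j
  · refine ⟨Nat.find h, (Nat.find_spec h).1.le, ?_, ?_⟩
    · intro j hj
      have h1 := Nat.find_min h hj
      have h2 := (Nat.find_spec h).1
      by_contra hlt
      exact h1 ⟨by omega, not_lt.1 hlt⟩
    · intro j hj _
      refine (Nat.find_spec h).2.trans ?_
      exact_mod_cast (bs_strictMono hp.out hm).monotone hj
  · push Not at h
    exact ⟨n, le_rfl, fun j hj => h j hj, fun j h1 h2 => absurd h2 (by omega)⟩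

variable {F L : Type*} [Field F] [Field L] [Algebra F L] {v : L → WithTop ℤ} {π : L}
  {S : ℕ → Set (L ≃ₐ[F] L)}

/-- summary of the ramification filtration -/
structure RF (p n m0 : ℕ) {F L : Type*} [Field F] [Field L] [Algebra F L] (v : L → WithTop ℤ) (π : L)
    (S : ℕ → Set (L ≃ₐ[F] L)) : Prop where
  hm : 0 < m0
  eq : ∀ i ≤ n, ∀ x : ℝ, (∀ j < i, (bs p m0 j : ℝ) < x) →
    (∀ j, i ≤ j → j < n → x ≤ bs p m0 j) → ramGrp F v π x = S i
  card : ∀ i ≤ n, (S i).ncard = p ^ (n - i)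

theorem S_inj (H : RF p n m0 v π S) {i j : ℕ} (hi : i ≤ n) (hj : j ≤ n) (h : S i = S j) : i = j := by
  have h1 := H.card i hi
  rw [h, H.card j hj] at h1
  have := Nat.pow_right_injective hp.out.two_le h1
  omega

theorem lower_iff (H : RF p n m0 v π S) (b : ℝ) :
    IsLowerBreak F v π b ↔ ∃ i < n, b = bs p m0 i := by
  have hmono := (bs_strictMono hp.out H.hm : StrictMono (bs p m0))
  constructor
  · rintro ⟨hb0, hb⟩
    by_contra! hne
    obtain ⟨i, hi, h1, h2⟩ := pos_exists (p := p) H.hm n b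
    obtain ⟨ε, hε, h3⟩ : ∃ ε : ℝ, 0 < ε ∧ ∀ j, i ≤ j → j < n → b + ε ≤ bs p m0 j := by
      by_cases hin : i < n
      · refine ⟨bs p m0 i - b, ?_, ?_⟩
        · have := lt_of_le_of_ne (h2 i le_rfl hin) (hne i hin); linarith
        · intro j hj _
          have : (bs p m0 i : ℝ) ≤ bs p m0 j := by exact_mod_cast hmono.monotone hj
          linarith
      · exact ⟨1, one_pos, fun j _ _ => absurd hin (by omega)⟩
    apply hb ε hε
    rw [H.eq i hi b h1 h2, H.eq i hi (b + ε) (fun j hj => by linarith [h1 j hj]) h3]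
  · rintro ⟨i, hi, rfl⟩
    refine ⟨by exact_mod_cast (bs_pos hp.out H.hm i).le, ?_⟩
    intro ε hε heq
    rw [H.eq i hi.le (bs p m0 i) (fun j hj => by exact_mod_cast hmono hj)
      (fun j hj _ => by exact_mod_cast hmono.monotone hj)] at heq
    obtain ⟨i', hi', h1, h2⟩ := pos_exists (p := p) H.hm n (bs p m0 i + ε)
    rw [H.eq i' hi' _ h1 h2] at heq
    have := S_inj H hi' hi.le heq
    subst this
    have := h2 i' le_rfl hi
    linarith

/-- the integrand -/
def gg (F : Type*) {L : Type*} [Field F] [Field L] [Algebra F L]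
    (v : L → WithTop ℤ) (π : L) (t : ℝ) : ℝ :=
  ((ramGrp F v π t).ncard : ℝ) / ((ramGrp F v π 0).ncard : ℝ)

theorem gg_eq (H : RF p n m0 v π S) {i : ℕ} (hi : i ≤ n) {x : ℝ} (h1 : ∀ j < i, (bs p m0 j : ℝ) < x)
    (h2 : ∀ j, i ≤ j → j < n → x ≤ bs p m0 j) : gg F v π x = ((p : ℝ) ^ i)⁻¹ := by
  have hp0 : (p : ℝ) ≠ 0 := by exact_mod_cast hp.out.ne_zero
  rw [gg, H.eq i hi x h1 h2, H.eq 0 (by omega) 0 (fun j hj => absurd hj (by omega))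
    (fun j _ _ => by exact_mod_cast (bs_pos hp.out H.hm j).le), H.card i hi, H.card 0 (by omega)]
  have : p ^ (n - 0) = p ^ (n - i) * p ^ i := by rw [← pow_add]; congr 1; omega
  rw [this]; push_cast
  field_simp

theorem gg_anti (H : RF p n m0 v π S) : Antitone (gg F v π) := by
  intro x y hxy
  obtain ⟨i, hi, h1, h2⟩ := pos_exists (p := p) H.hm n x
  obtain ⟨i', hi', h1', h2'⟩ := pos_exists (p := p) H.hm n y
  rw [gg_eq H hi h1 h2, gg_eq H hi' h1' h2']
  have hii : i ≤ i' := by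
    by_contra hlt
    have a1 := h1 i' (by omega)
    have a2 := h2' i' le_rfl (by omega)
    linarith
  have hp1 : (1 : ℝ) ≤ p := by exact_mod_cast hp.out.one_lt.le
  gcongr

theorem gg_lower (H : RF p n m0 v π S) (x : ℝ) : ((p : ℝ) ^ n)⁻¹ ≤ gg F v π x := by
  obtain ⟨i, hi, h1, h2⟩ := pos_exists (p := p) H.hm n x
  rw [gg_eq H hi h1 h2]
  have hp1 : (1 : ℝ) ≤ p := by exact_mod_cast hp.out.one_lt.le
  gcongr

theorem gg_int (H : RF p n m0 v π S) (x y : ℝ) :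
    IntervalIntegrable (gg F v π) MeasureTheory.volume x y := (gg_anti H).intervalIntegrable

theorem phi_def (x : ℝ) : hhPhi F v π x = ∫ t in (0 : ℝ)..x, gg F v π t := rfl

theorem phi_sub (H : RF p n m0 v π S) (x y : ℝ) :
    hhPhi F v π y - hhPhi F v π x = ∫ t in x..y, gg F v π t := by
  rw [phi_def, phi_def, intervalIntegral.integral_interval_sub_left (gg_int H _ _) (gg_int H _ _)]

theorem phi_ge (H : RF p n m0 v π S) {x y : ℝ} (hxy : x ≤ y) :
    ((p : ℝ) ^ n)⁻¹ * (y - x) ≤ hhPhi F v π y - hhPhi F v π x := by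
  rw [phi_sub H]
  have := intervalIntegral.integral_mono_on hxy (intervalIntegrable_const (c := ((p : ℝ) ^ n)⁻¹)
    (μ := MeasureTheory.volume))
    (gg_int H x y) (fun t _ => gg_lower H t)
  rw [intervalIntegral.integral_const, smul_eq_mul, mul_comm] at this
  exact this

theorem phi_strict (H : RF p n m0 v π S) : StrictMono (hhPhi F v π) := by
  intro x y hxy
  have h1 := phi_ge H hxy.le
  have hp0 : (0 : ℝ) < p := by exact_mod_cast hp.out.pos
  have : 0 < ((p : ℝ) ^ n)⁻¹ * (y - x) := mul_pos (by positivity) (by linarith)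
  linarith

theorem phi_cont (H : RF p n m0 v π S) : Continuous (hhPhi F v π) :=
  intervalIntegral.continuous_primitive (fun a b => gg_int H a b) 0

theorem phi_zero : hhPhi F v π 0 = 0 := by rw [phi_def, intervalIntegral.integral_same]

theorem phi_surj (H : RF p n m0 v π S) {u : ℝ} (hu : 0 ≤ u) : ∃ x ∈ Set.Ici (0 : ℝ), hhPhi F v π x = u := by
  have hp0 : (0 : ℝ) < p := by exact_mod_cast hp.out.pos
  have hX : 0 ≤ (p : ℝ) ^ n * u := by positivity
  have h1 := phi_ge H hX
  rw [phi_zero, sub_zero, sub_zero, inv_mul_cancel_left₀ (by positivity)] at h1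
  obtain ⟨x, hx, h⟩ := intermediate_value_Icc hX (phi_cont H).continuousOn
    (show u ∈ Set.Icc (hhPhi F v π 0) (hhPhi F v π ((p : ℝ) ^ n * u)) from ⟨by rw [phi_zero]; exact hu, h1⟩)
  exact ⟨x, hx.1, h⟩

theorem psi_spec (H : RF p n m0 v π S) {u : ℝ} (hu : 0 ≤ u) :
    0 ≤ hhPsi F v π u ∧ hhPhi F v π (hhPsi F v π u) = u :=
  ⟨Function.invFunOn_mem (phi_surj H hu), Function.invFunOn_eq (phi_surj H hu)⟩

theorem phi_nonneg (H : RF p n m0 v π S) {x : ℝ} (hx : 0 ≤ x) : 0 ≤ hhPhi F v π x := by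
  rw [← phi_zero (F := F) (v := v) (π := π)]; exact (phi_strict H).monotone hx

theorem psi_phi (H : RF p n m0 v π S) {x : ℝ} (hx : 0 ≤ x) : hhPsi F v π (hhPhi F v π x) = x :=
  (phi_strict H).injective (psi_spec H (phi_nonneg H hx)).2

theorem upper_iff_lower (H : RF p n m0 v π S) (u : ℝ) :
    IsUpperBreak F v π u ↔ 0 ≤ u ∧ IsLowerBreak F v π (hhPsi F v π u) := by
  constructor
  · rintro ⟨hu, h⟩
    obtain ⟨h1, h2⟩ := psi_spec H hu
    refine ⟨hu, h1, ?_⟩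
    intro ε hε heq
    have h3 := phi_strict H (show hhPsi F v π u < hhPsi F v π u + ε by linarith)
    apply h (hhPhi F v π (hhPsi F v π u + ε) - u) (by linarith)
    rw [upperRamGrp, upperRamGrp, add_sub_cancel, psi_phi H (by linarith), heq]
  · rintro ⟨hu, h1, h⟩
    refine ⟨hu, ?_⟩
    intro δ hδ heq
    obtain ⟨-, h2⟩ := psi_spec H hu
    obtain ⟨-, h3⟩ := psi_spec H (show 0 ≤ u + δ by linarith)
    have hlt : hhPsi F v π u < hhPsi F v π (u + δ) := by
      rw [← (phi_strict H).lt_iff_lt, h2, h3]; linarith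
    apply h (hhPsi F v π (u + δ) - hhPsi F v π u) (by linarith)
    rw [add_sub_cancel]; exact heq

theorem int_const_on {f : ℝ → ℝ} {a b c : ℝ} (hab : a ≤ b) (h : ∀ t, a < t → t ≤ b → f t = c) :
    ∫ t in a..b, f t = (b - a) * c := by
  have : ∫ t in a..b, f t = ∫ _ in a..b, c := by
    refine intervalIntegral.integral_congr_ae (Filter.Eventually.of_forall fun t ht => ?_)
    rw [Set.uIoc_of_le hab] at ht
    exact h t ht.1 ht.2
  rw [this, intervalIntegral.integral_const, smul_eq_mul]

theorem phi_bs (H : RF p n m0 v π S) (i : ℕ) (hi : i < n) :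
    hhPhi F v π (bs p m0 i) = (p : ℝ) ^ i * m0 := by
  have hp0 : (p : ℝ) ≠ 0 := by exact_mod_cast hp.out.ne_zero
  have hmono := (bs_strictMono hp.out H.hm : StrictMono (bs p m0))
  induction i with
  | zero =>
    rw [phi_def, int_const_on (c := 1)]
    · simp [bs]
    · exact_mod_cast (bs_pos hp.out H.hm 0).le
    · intro t h1 h2
      rw [gg_eq H (i := 0) (by omega) (fun j hj => absurd hj (by omega))]
      · simp
      · intro j _ _
        refine h2.trans ?_
        exact_mod_cast hmono.monotone (Nat.zero_le j)
  | succ i ih =>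
    have h1 := phi_sub H (bs p m0 i : ℝ) (bs p m0 (i + 1))
    rw [int_const_on (c := ((p : ℝ) ^ (i + 1))⁻¹), ih (by omega)] at h1
    · have h2 : (bs p m0 (i + 1) : ℝ) - bs p m0 i = ((p : ℝ) ^ (2 * i + 2) - (p : ℝ) ^ (2 * i + 1)) * m0 := by
        rw [bs]; push_cast; ring
      rw [h2] at h1
      have h3 : ((p : ℝ) ^ (2 * i + 2) - (p : ℝ) ^ (2 * i + 1)) * m0 * ((p : ℝ) ^ (i + 1))⁻¹
          = (p : ℝ) ^ (i + 1) * m0 - (p : ℝ) ^ i * m0 := by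
        field_simp; ring
      linarith
    · exact_mod_cast (hmono (Nat.lt_succ_self i)).le
    · intro t ha hb
      refine gg_eq H (i := i + 1) (by omega) ?_ ?_
      · intro j hj
        refine lt_of_le_of_lt ?_ ha
        exact_mod_cast hmono.monotone (by omega : j ≤ i)
      · intro j hj _
        refine hb.trans ?_
        exact_mod_cast hmono.monotone hj

theorem upper_iff (H : RF p n m0 v π S) (u : ℝ) :
    IsUpperBreak F v π u ↔ ∃ i < n, u = (p : ℝ) ^ i * m0 := by
  rw [upper_iff_lower H, lower_iff H]
  constructor
  · rintro ⟨hu, i, hi, h⟩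
    refine ⟨i, hi, ?_⟩
    rw [← phi_bs H i hi, ← h, (psi_spec H hu).2]
  · rintro ⟨i, hi, rfl⟩
    refine ⟨by positivity, i, hi, ?_⟩
    rw [← phi_bs H i hi, psi_phi H]
    exact_mod_cast (bs_pos hp.out H.hm i).le

end Breaks

set_option linter.unusedSectionVars false

section Final

open WittVector

theorem rel_omega {p : ℕ} [hp : Fact p.Prime] {K Ω : Type*} [Field K] [Field Ω] [Algebra K Ω] [CharP Ω p]
    {n : ℕ} {a0 : K} {a : TruncatedWittVector p n K}
    (ha : a = TruncatedWittVector.mk p (fun j => if (j : ℕ) = 0 then a0 else 0))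
    {x : TruncatedWittVector p n Ω}
    (hx : wittF x = x + wittMap (algebraMap K Ω) a) :
    WEq n (WittVector.frobenius x.out) (x.out + teichmuller p (algebraMap K Ω a0)) := by
  rw [weq_iff, map_add]
  have h1 : truncate n x.out = x := TruncatedWittVector.truncateFun_out x
  have h2 : truncate n (WittVector.frobenius x.out) = wittF x := by
    ext j
    rw [coeff_truncate, coeff_frobenius_charP, TruncatedWittVector.coeff_out, wittF,
      TruncatedWittVector.coeff_mk]
  have h3 : truncate n (teichmuller p (algebraMap K Ω a0)) = wittMap (algebraMap K Ω) a := by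
    ext j
    rw [coeff_truncate, wittMap, TruncatedWittVector.coeff_mk, ha, TruncatedWittVector.coeff_mk]
    split_ifs with h
    · rw [h, teichmuller_coeff_zero]
    · rw [teichmuller_coeff_pos _ _ _ (Nat.pos_of_ne_zero h), map_zero]
  rw [h1, h2, h3, hx]

variable {p : ℕ} [hp : Fact p.Prime] {K Ω : Type*} [Field K] [Field Ω] [Algebra K Ω] [CharP Ω p]
  {n : ℕ} {a0 : K} {X : WittVector p Ω} {M : IntermediateField K Ω}

theorem lift_witt (M : IntermediateField K Ω) (X : WittVector p Ω) (h : ∀ j, X.coeff j ∈ M) :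
    ∃ X' : WittVector p M, map (algebraMap M Ω) X' = X := by
  refine ⟨WittVector.mk p fun j => ⟨X.coeff j, h j⟩, ?_⟩
  ext j; rw [map_coeff]; rfl

theorem bot_mem (M : IntermediateField K Ω) {z : Ω} (hz : z ^ p = z) : z ∈ M := by
  have h1 : z ∈ (⊥ : Subfield Ω) := (Subfield.mem_bot_iff_pow_eq_self Ω p).2 hz
  exact (bot_le : (⊥ : Subfield Ω) ≤ M.toSubfield) h1

theorem normal_M [Normal K Ω] (hM : M = IntermediateField.adjoin K {α : Ω | ∃ j < n, X.coeff j = α})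
    (hXM : ∀ j, X.coeff j ∈ M)
    (hX : WEq n (WittVector.frobenius X) (X + teichmuller p (algebraMap K Ω a0))) : Normal K M := by
  rw [IntermediateField.normal_iff_forall_map_le]
  intro σ
  conv_lhs => rw [hM, IntermediateField.adjoin_map]
  rw [IntermediateField.adjoin_le_iff]
  rintro _ ⟨_, ⟨j, hj, rfl⟩, rfl⟩
  have hD := frob_diff (σ : Ω →+* Ω) hX (by
    rw [map_teichmuller]; congr 1; exact σ.commutes a0)
  set D := map (σ : Ω →+* Ω) X - X with hDdef
  obtain ⟨D', hD'⟩ := lift_witt M (init n D) (by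
    intro i
    by_cases hi : i < n
    · rw [weq_init n D i hi]; exact bot_mem M (hD i hi)
    · have : (init n D).coeff i = 0 := by simp [init, select, hi]
      rw [this]; exact zero_mem _)
  obtain ⟨X', hX'⟩ := lift_witt M X hXM
  have h1 : WEq n (map (σ : Ω →+* Ω) X) (map (algebraMap M Ω) (X' + D')) := by
    rw [map_add, hX', hD']
    have := weq_add (weq_refl n X) (weq_symm (weq_init n D))
    rwa [hDdef, add_sub_cancel] at this
  have h2 := h1 j hj
  rw [map_coeff, map_coeff] at h2
  change σ (X.coeff j) ∈ M
  have h3 : σ (X.coeff j) = algebraMap M Ω ((X' + D').coeff j) := h2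
  rw [h3]; exact ((X' + D').coeff j).2

theorem fin_M [Algebra.IsAlgebraic K Ω]
    (hM : M = IntermediateField.adjoin K {α : Ω | ∃ j < n, X.coeff j = α}) :
    FiniteDimensional K M := by
  rw [hM]
  have : Finite {α : Ω | ∃ j < n, X.coeff j = α} := by
    refine Set.Finite.to_subtype ?_
    have : {α : Ω | ∃ j < n, X.coeff j = α} = X.coeff '' (Set.Iio n) := rfl
    rw [this]; exact (Set.finite_Iio n).image _
  exact IntermediateField.finiteDimensional_adjoin fun x _ =>
    (Algebra.IsAlgebraic.isAlgebraic x).isIntegral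

theorem gen_M (hM : M = IntermediateField.adjoin K {α : Ω | ∃ j < n, X.coeff j = α})
    {X' : WittVector p M} (hX' : map (algebraMap M Ω) X' = X) (σ : M ≃ₐ[K] M)
    (h : ∀ j < n, σ (X'.coeff j) = X'.coeff j) : σ = 1 := by
  have h1 : M ≤ (IntermediateField.fixedField (Subgroup.zpowers σ)).map M.val := by
    conv_lhs => rw [hM]
    rw [IntermediateField.adjoin_le_iff]
    rintro _ ⟨j, hj, rfl⟩
    refine ⟨X'.coeff j, ?_, ?_⟩
    · have := (mem_Fx (p := p) (τ := σ) (i := 0) (z := X'.coeff j)).2 (by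
        rw [pow_zero, pow_one]; exact h j hj)
      rw [Fx, pow_zero, pow_one] at this
      exact this
    · rw [← hX', map_coeff]; rfl
  ext z
  obtain ⟨y, hy, hyz⟩ := h1 z.2
  have hyz' : y = z := Subtype.ext hyz
  subst hyz'
  have := (mem_Fx (p := p) (τ := σ) (i := 0) (z := y)).1 (by
    rw [Fx, pow_zero, pow_one]; exact hy)
  rw [pow_zero, pow_one] at this
  rw [this]; rfl

theorem rel_M {X' : WittVector p M} [CharP M p] (hX' : map (algebraMap M Ω) X' = X)
    (hX : WEq n (WittVector.frobenius X) (X + teichmuller p (algebraMap K Ω a0))) :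
    WEq n (WittVector.frobenius X') (X' + teichmuller p (algebraMap K M a0)) := by
  intro j hj
  apply (algebraMap M Ω).injective
  have h1 := hX j hj
  have h2 : X + teichmuller p (algebraMap K Ω a0)
      = map (algebraMap M Ω) (X' + teichmuller p (algebraMap K M a0)) := by
    rw [map_add, hX', map_teichmuller]; rfl
  rw [h2, map_coeff] at h1
  rw [← h1, coeff_frobenius_charP, coeff_frobenius_charP, map_pow, ← hX', map_coeff]

end Final

/-- the computation of the breaks of `M = K[μ_1(a)]` in the proof of
Theorem 7.  Let `K ≅ k((t))` be a local field of characteristic `p > 0` with perfect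
residue field `k`, let `a_0 ∈ K` with `v_K(a_0) = -m_0`, `m_0 > 0`, `p ∤ m_0`, and let
`a = (a_0, 0, …, 0) ∈ W_n(K)`.  Then `K[a]/K` (where `K[a] = K(x_0, …, x_{n-1})` for a
Witt vector `x` with `F(x) = x ⊕ a`) is a totally ramified `(ℤ/p^nℤ)`-extension whose
upper ramification breaks are `m_0, p m_0, …, p^{n-1} m_0` and whose lower
ramification breaks are `b_i = (p^{2i-2} - p^{2i-3} + ⋯ + p^2 - p + 1) m_0`,
i.e. `b_i = m_0 · Σ_{j=0}^{2i-2} (-1)^j p^{2i-2-j}`, for `1 ≤ i ≤ n`. -/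
theorem stmt_14 {p : ℕ} [Fact p.Prime] (k : Type) [Field k] [PerfectField k] [CharP k p]
    (K : Type) [Field K] [CharP K p] (ι : K ≃+* LaurentSeries k)
    (n : ℕ) (hn : 1 ≤ n)
    (a0 : K) (m0 : ℕ) (hm0 : 1 ≤ m0) (hpm : ¬ p ∣ m0)
    (ha0 : lfVal ι a0 = ((-(m0 : ℤ) : ℤ) : WithTop ℤ))
    (a : TruncatedWittVector p n K)
    (ha : a = TruncatedWittVector.mk p (fun j => if (j : ℕ) = 0 then a0 else 0))
    (x : TruncatedWittVector p n (SepCl K))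
    (hx : wittF x = x + wittMap (algebraMap K (SepCl K)) a)
    (Kn : IntermediateField K (SepCl K))
    (hKn : Kn = IntermediateField.adjoin K {α : SepCl K | ∃ j : Fin n, x.coeff j = α})
    (v : Kn → WithTop ℤ) (hv : IsNormVal v) (e : ℕ) (he : ExtendsWithE (lfVal ι) v e)
    (π : Kn) (hπ : v π = (1 : ℤ)) :
    IsGalois K Kn ∧
    IsCyclic (Kn ≃ₐ[K] Kn) ∧
    Module.finrank K Kn = p ^ n ∧
    e = p ^ n ∧
    (∀ u' : ℝ, IsUpperBreak K v π u' ↔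
      ∃ i ∈ Finset.Icc 1 n, u' = (p : ℝ) ^ (i - 1) * (m0 : ℝ)) ∧
    (∀ b' : ℝ, IsLowerBreak K v π b' ↔
      ∃ i ∈ Finset.Icc 1 n,
        b' = (m0 : ℝ) * ∑ j ∈ Finset.range (2 * i - 1), (-1 : ℝ) ^ j * (p : ℝ) ^ (2 * i - 2 - j)) := by
  have hmain : ∃ S : ℕ → Set (Kn ≃ₐ[K] Kn), IsGalois K Kn ∧ IsCyclic (Kn ≃ₐ[K] Kn) ∧
      Module.finrank K Kn = p ^ n ∧ e = p ^ n ∧ RF p n m0 v π S := by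
    have hchΩ : CharP (SepCl K) p := charP_of_injective_algebraMap (algebraMap K (SepCl K)).injective p
    have hchM : CharP Kn p := charP_of_injective_algebraMap (algebraMap K Kn).injective p
    have hX := rel_omega ha hx
    set X := x.out with hXdef
    have hKn' : Kn = IntermediateField.adjoin K {α : SepCl K | ∃ j < n, X.coeff j = α} := by
      rw [hKn]; congr 1; ext α
      constructor
      · rintro ⟨j, rfl⟩
        exact ⟨j, j.2, TruncatedWittVector.coeff_out x j⟩
      · rintro ⟨j, hj, rfl⟩
        exact ⟨⟨j, hj⟩, (TruncatedWittVector.coeff_out x ⟨j, hj⟩).symm⟩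
    have hXM : ∀ j, X.coeff j ∈ Kn := by
      intro j
      by_cases hj : j < n
      · rw [hKn']; exact IntermediateField.subset_adjoin _ _ ⟨j, hj, rfl⟩
      · have : X.coeff j = 0 := by
          rw [hXdef, TruncatedWittVector.out]; simp [hj]
        rw [this]; exact zero_mem _
    have hnorm : Normal K Kn := normal_M hKn' hXM hX
    have hfd : FiniteDimensional K Kn := fin_M hKn'
    have hgal : IsGalois K Kn := ⟨⟩
    obtain ⟨X', hX'⟩ := lift_witt Kn X hXM
    have hrel := rel_M hX' hX
    have he0 := e_ne_zero ι hv he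
    have hc : (0 : ℚ) < 1 / e := by
      have : (0 : ℚ) < e := by exact_mod_cast Nat.pos_of_ne_zero he0
      positivity
    have wa0 : scaleVal v hv (1 / e) hc (algebraMap K Kn a0) = ((-(m0 : ℚ) : ℚ) : WithTop ℚ) := by
      rw [wK ι hv he hc ha0]; congr 1
    obtain ⟨τ, c, T, hord, hgen, hfr⟩ := galois_main hn (wK_kint ι hv he hc) (wK_unif ι hv he hc)
      (wK_perf ι hv he hc) hm0 hpm wa0 hrel (gen_M hKn' hX')
    obtain ⟨hee, hin, hval⟩ := ram_main hv hc hn T hord hgen hπ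
    refine ⟨fun i => (Subgroup.zpowers (τ ^ p ^ i) : Set (Kn ≃ₐ[K] Kn)), hgal, ⟨τ, hgen⟩, hfr, hee, hm0, ?_, ?_⟩
    · intro i hi y h1 h2
      exact ram_eq hv hord hgen hin hval hi h1 h2
    · intro i hi
      exact ncard_zp hord hi
  obtain ⟨S, h1, h2, h3, h4, H⟩ := hmain
  refine ⟨h1, h2, h3, h4, ?_, ?_⟩
  · intro u
    rw [upper_iff H]
    constructor
    · rintro ⟨i, hi, rfl⟩
      exact ⟨i + 1, Finset.mem_Icc.2 ⟨by omega, by omega⟩, by rw [Nat.add_sub_cancel]⟩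
    · rintro ⟨i, hi, rfl⟩
      have := Finset.mem_Icc.1 hi
      exact ⟨i - 1, by omega, rfl⟩
  · intro b
    rw [lower_iff H]
    constructor
    · rintro ⟨i, hi, rfl⟩
      refine ⟨i + 1, Finset.mem_Icc.2 ⟨by omega, by omega⟩, ?_⟩
      rw [bs_formula]; rfl
    · rintro ⟨i, hi, rfl⟩
      have := Finset.mem_Icc.1 hi
      obtain ⟨i, rfl⟩ : ∃ i', i = i' + 1 := ⟨i - 1, by omega⟩
      refine ⟨i, by omega, ?_⟩
      rw [bs_formula]; rfl
end
end
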